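/- Fix constants μ > 0 and b < 0. Suppose P satisfies: (d_n, λ_n)_{n∈ℤ} is stationary and ergodic, (d_n)_{n∈ℤ} is independent of (λ_n)_{n∈ℤ}, E_P(log d_0) < ∞, E_P(d_0) = μ, and E_P(log ξ_0) = b. Then the asymptotic speed v_P = lim_{n→∞} X_n/n (which exists ℙ-a.s.) satisfies v_P ≤ (1/μ)·(1−e^b)/(1+e^b), with equality if and only if VAR_P(d_0) = 0 and VAR_P(λ_0) = 0, in which case λ_0 = 1/(1+e^b) P-almost surely. -/

import Mathlib

open MeasureTheory ProbabilityTheory Filter Set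
open scoped ENNReal NNReal Topology

noncomputable section

/-- One-step transition probability of the nearest-neighbour walk in environment `env`:
probability `env i` of a step from `i` to `i+1`, probability `1 - env i` of a step
from `i` to `i-1`. -/
def stepProb (env : ℤ → ℝ) (i j : ℤ) : ℝ :=
  if j = i + 1 then env i else if j = i - 1 then 1 - env i else 0

/-- `IsQuenchedRW env x μ` says that `μ` is the quenched law `P_{x,ω}` of the random walk
in the environment `env` started at `x`: a probability measure on trajectories whose
cylinder probabilities are products of the one-step transition probabilities. -/
def IsQuenchedRW (env : ℤ → ℝ) (x : ℤ) (μ : Measure (ℕ → ℤ)) : Prop :=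
  IsProbabilityMeasure μ ∧
  ∀ (n : ℕ) (path : ℕ → ℤ), path 0 = x →
    μ {f | ∀ k ≤ n, f k = path k}
      = ENNReal.ofReal (∏ k ∈ Finset.range n, stepProb env (path k) (path (k + 1)))

/-- The sparse environment: `lam k` at the marked site `a k`, and `1/2` elsewhere. -/
def sparseEnv (lam : ℤ → ℝ) (a : ℤ → ℤ) (n : ℤ) : ℝ :=
  haveI := Classical.propDecidable (∃ k, a k = n)
  if h : ∃ k, a k = n then lam h.choose else 1 / 2


namespace SRE

/-- running maximum of Birkhoff sums -/
def gmax {X : Type*} (T : X → X) (f : X → ℝ) : ℕ → X → ℝ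
  | 0, _ => 0
  | n + 1, x => max 0 (f x + gmax T f n (T x))

lemma gmax_nonneg {X : Type*} (T : X → X) (f : X → ℝ) (n : ℕ) (x : X) : 0 ≤ gmax T f n x := by
  cases n with
  | zero => exact le_rfl
  | succ n => exact le_max_left _ _

lemma gmax_le_succ {X : Type*} (T : X → X) (f : X → ℝ) (n : ℕ) :
    ∀ x : X, gmax T f n x ≤ gmax T f (n + 1) x := by
  induction n with
  | zero => intro x; exact le_max_left _ _
  | succ n ih =>
    intro x
    simp only [gmax] at ih ⊢
    exact max_le_max le_rfl (by linarith [ih (T x)])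

lemma gmax_mono {X : Type*} (T : X → X) (f : X → ℝ) (x : X) : Monotone fun n => gmax T f n x :=
  monotone_nat_of_le_succ fun n => gmax_le_succ T f n x

lemma birkhoffSum_le_gmax {X : Type*} (T : X → X) (f : X → ℝ) (n : ℕ) :
    ∀ x : X, birkhoffSum T f n x ≤ gmax T f n x := by
  induction n with
  | zero => intro x; simp [gmax]
  | succ n ih =>
    intro x
    rw [birkhoffSum_succ']
    exact le_max_of_le_right (by linarith [ih (T x)])

lemma gmax_measurable {X : Type*} [MeasurableSpace X] {T : X → X} {f : X → ℝ}
    (hT : Measurable T) (hf : Measurable f) (n : ℕ) : Measurable (gmax T f n) := by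
  induction n with
  | zero => exact measurable_const
  | succ n ih => exact measurable_const.max (hf.add (ih.comp hT))

lemma gmax_integrable {X : Type*} [MeasurableSpace X] {μ : Measure X} [IsFiniteMeasure μ]
    {T : X → X} {f : X → ℝ}
    (hT : MeasurePreserving T μ μ) (hi : Integrable f μ) (n : ℕ) :
    Integrable (gmax T f n) μ := by
  induction n with
  | zero => exact integrable_const 0
  | succ n ih => exact (integrable_const 0).sup (hi.add (hT.integrable_comp_of_integrable ih))

lemma maximal_n {X : Type*} [MeasurableSpace X] {μ : Measure X} [IsFiniteMeasure μ]
    {T : X → X} {f : X → ℝ}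
    (hT : MeasurePreserving T μ μ) (hf : Measurable f) (hi : Integrable f μ) (n : ℕ) :
    0 ≤ ∫ x in {x | 0 < gmax T f n x}, f x ∂μ := by
  cases n with
  | zero => simp [gmax]
  | succ n =>
    set A := {x | 0 < gmax T f (n+1) x} with hA
    have hm := gmax_measurable hT.measurable hf (n+1)
    have hAm : MeasurableSet A := measurableSet_lt measurable_const hm
    have hI := gmax_integrable hT hi (n+1)
    have hI' : Integrable (fun x => gmax T f (n+1) (T x)) μ := hT.integrable_comp_of_integrable hI
    have h0 : ∫ x, (gmax T f (n+1) x - gmax T f (n+1) (T x)) ∂μ = 0 := by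
      rw [integral_sub hI hI']
      have h2 : ∫ x, gmax T f (n+1) (T x) ∂μ = ∫ x, gmax T f (n+1) x ∂μ := by
        conv_rhs => rw [← hT.map_eq]
        rw [integral_map hT.measurable.aemeasurable]
        exact hm.aestronglyMeasurable
      rw [h2, sub_self]
    rw [← integral_indicator hAm]
    rw [← h0]
    apply integral_mono (hI.sub hI') (hi.indicator hAm)
    intro x
    change gmax T f (n+1) x - gmax T f (n+1) (T x) ≤ _
    by_cases hx : x ∈ A
    · simp only [indicator_of_mem hx]
      have hx' : 0 < gmax T f (n+1) x := hx
      have h1 : gmax T f (n+1) x = f x + gmax T f n (T x) := by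
        have : gmax T f (n+1) x = max 0 (f x + gmax T f n (T x)) := rfl
        rw [this] at hx' ⊢
        rcases lt_max_iff.1 hx' with h | h
        · exact absurd h (lt_irrefl _)
        · exact max_eq_right h.le
      have := gmax_le_succ T f n (T x)
      linarith
    · simp only [indicator_of_notMem hx]
      have h1 : gmax T f (n+1) x ≤ 0 := not_lt.1 hx
      have := gmax_nonneg T f (n+1) (T x)
      linarith

lemma maximal {X : Type*} [MeasurableSpace X] {μ : Measure X} [IsFiniteMeasure μ]
    {T : X → X} {f : X → ℝ}
    (hT : MeasurePreserving T μ μ) (hf : Measurable f) (hi : Integrable f μ)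
    (h : ∀ᵐ x ∂μ, ∃ n, 0 < birkhoffSum T f n x) : 0 ≤ ∫ x, f x ∂μ := by
  have hmono : Monotone fun n => {x | 0 < gmax T f n x} := by
    intro a b hab x hx
    exact lt_of_lt_of_le hx (gmax_mono T f x hab)
  have hlim := tendsto_setIntegral_of_monotone (μ := μ) (f := f)
    (s := fun n => {x | 0 < gmax T f n x})
    (fun n => measurableSet_lt measurable_const (gmax_measurable hT.measurable hf n)) hmono
    hi.integrableOn
  have hU : ∫ x in ⋃ n, {x | 0 < gmax T f n x}, f x ∂μ = ∫ x, f x ∂μ := by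
    have : (⋃ n, {x | 0 < gmax T f n x} : Set X) =ᵐ[μ] univ := by
      rw [eventuallyEq_univ]
      filter_upwards [h] with x hx
      obtain ⟨n, hn⟩ := hx
      exact mem_iUnion.2 ⟨n, lt_of_lt_of_le hn (birkhoffSum_le_gmax T f n x)⟩
    rw [setIntegral_congr_set this, setIntegral_univ]
  rw [hU] at hlim
  exact ge_of_tendsto' hlim fun n => maximal_n hT hf hi n

lemma maximal_inv {X : Type*} [MeasurableSpace X] {μ : Measure X} [IsFiniteMeasure μ]
    {T : X → X} {f : X → ℝ} {B : Set X} (α : ℝ)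
    (hT : MeasurePreserving T μ μ) (hf : Measurable f) (hi : Integrable f μ)
    (hB : MeasurableSet B) (hinv : T ⁻¹' B = B)
    (h : ∀ᵐ x ∂μ, x ∈ B → ∃ n : ℕ, α * n < birkhoffSum T f n x) :
    α * μ.real B ≤ ∫ x in B, f x ∂μ := by
  have hT' : MeasurePreserving T (μ.restrict B) (μ.restrict B) := by
    have := hT.restrict_preimage hB
    rwa [hinv] at this
  have key := maximal (f := fun x => f x - α) hT' (hf.sub_const α)
    (hi.integrableOn.sub (integrable_const α)) (by
      rw [ae_restrict_iff' hB]
      filter_upwards [h] with x hx hxB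
      obtain ⟨n, hn⟩ := hx hxB
      refine ⟨n, ?_⟩
      have : birkhoffSum T (fun x => f x - α) n x = birkhoffSum T f n x - α * n := by
        simp [birkhoffSum, Finset.sum_sub_distrib, mul_comm]
      rw [this]; linarith)
  rw [integral_sub hi.integrableOn (integrable_const α)] at key
  simp [mul_comm] at key
  linarith

/-- the set where the limsup of the averages exceeds `α` -/
def bset {X : Type*} (T : X → X) (f : X → ℝ) (α : ℝ) : Set X :=
  {x | ∃ m : ℕ, ∃ᶠ n : ℕ in atTop, (α + 1 / (m + 1 : ℝ)) * n < birkhoffSum T f n x}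

lemma birkhoffSum_measurable {X : Type*} [MeasurableSpace X] {T : X → X} {f : X → ℝ}
    (hT : Measurable T) (hf : Measurable f) (n : ℕ) : Measurable (birkhoffSum T f n) := by
  unfold birkhoffSum
  exact Finset.measurable_sum _ fun i _ => hf.comp (hT.iterate i)

lemma bset_measurable {X : Type*} [MeasurableSpace X] {T : X → X} {f : X → ℝ}
    (hT : Measurable T) (hf : Measurable f) (α : ℝ) : MeasurableSet (bset T f α) := by
  have : bset T f α = ⋃ m : ℕ, ⋂ N : ℕ, ⋃ n : ℕ, ⋃ (_ : N ≤ n),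
      {x | (α + 1 / (m + 1 : ℝ)) * n < birkhoffSum T f n x} := by
    ext x
    simp only [bset, frequently_atTop, mem_ofPred_eq, mem_iUnion, mem_iInter, exists_prop]
  rw [this]
  refine MeasurableSet.iUnion fun m => MeasurableSet.iInter fun N => MeasurableSet.iUnion fun n =>
    MeasurableSet.iUnion fun _ => measurableSet_lt measurable_const (birkhoffSum_measurable hT hf n)

lemma bset_inv {X : Type*} {T : X → X} {f : X → ℝ} (α : ℝ) : T ⁻¹' (bset T f α) = bset T f α := by
  have aux : ∀ (m : ℕ) (c : ℝ), ∀ᶠ n : ℕ in atTop,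
      (α + 1 / ((m + 1 : ℕ) + 1 : ℝ)) * n + c < (α + 1 / (m + 1 : ℝ)) * n := by
    intro m c
    have hpos : 0 < 1 / (m + 1 : ℝ) - 1 / ((m + 1 : ℕ) + 1 : ℝ) := by
      rw [sub_pos]; push_cast
      apply one_div_lt_one_div_of_lt <;> [positivity; linarith]
    have := (tendsto_natCast_atTop_atTop (R := ℝ)).const_mul_atTop hpos
    filter_upwards [this.eventually_gt_atTop c] with n hn
    nlinarith
  ext x
  constructor
  · rintro ⟨m, hm⟩
    refine ⟨m + 1, ?_⟩
    have h2 := hm.and_eventually (aux m (α + 1 / ((m + 1 : ℕ) + 1 : ℝ) - f x))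
    rw [frequently_atTop] at h2 ⊢
    intro N
    obtain ⟨n, hn, h3, h4⟩ := h2 N
    refine ⟨n + 1, by omega, ?_⟩
    rw [birkhoffSum_succ']
    push_cast at h3 h4 ⊢
    nlinarith
  · rintro ⟨m, hm⟩
    refine ⟨m + 1, ?_⟩
    have h2 := hm.and_eventually (aux m (f x - (α + 1 / ((m + 1 : ℕ) + 1 : ℝ))))
    rw [frequently_atTop] at h2 ⊢
    intro N
    obtain ⟨n, hn, h3, h4⟩ := h2 (N + 1)
    obtain ⟨k, rfl⟩ : ∃ k, n = k + 1 := ⟨n - 1, by omega⟩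
    refine ⟨k, by omega, ?_⟩
    rw [birkhoffSum_succ'] at h3
    push_cast at h3 h4 ⊢
    nlinarith

lemma not_mem_bset {X : Type*} {T : X → X} {f : X → ℝ} {α : ℝ} {x : X} (hx : x ∉ bset T f α)
    {β : ℝ} (hβ : α < β) : ∀ᶠ n : ℕ in atTop, birkhoffSum T f n x ≤ β * n := by
  obtain ⟨m, hm⟩ := exists_nat_one_div_lt (sub_pos.2 hβ)
  have h1 : ¬ ∃ᶠ n : ℕ in atTop, (α + 1 / (m + 1 : ℝ)) * n < birkhoffSum T f n x :=
    fun h => hx ⟨m, h⟩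
  rw [not_frequently] at h1
  filter_upwards [h1] with n hn
  rw [not_lt] at hn
  have : (0:ℝ) ≤ n := Nat.cast_nonneg n
  nlinarith

lemma mem_bset {X : Type*} {T : X → X} {f : X → ℝ} {α : ℝ} {x : X} (hx : x ∈ bset T f α) :
    ∃ n : ℕ, α * n < birkhoffSum T f n x := by
  obtain ⟨m, hm⟩ := hx
  obtain ⟨n, hn⟩ := hm.exists
  refine ⟨n, lt_of_le_of_lt ?_ hn⟩
  have : (0:ℝ) ≤ 1 / (m + 1 : ℝ) * n := by positivity
  nlinarith

lemma tendsto_div_of_bounds {S : ℕ → ℝ} {c : ℝ} (h1 : ∀ β, c < β → ∀ᶠ n : ℕ in atTop, S n ≤ β * n)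
    (h2 : ∀ β, β < c → ∀ᶠ n : ℕ in atTop, β * n ≤ S n) :
    Tendsto (fun n : ℕ => S n / n) atTop (𝓝 c) := by
  rw [tendsto_order]
  constructor
  · intro a ha
    obtain ⟨β, h3, h4⟩ := exists_between ha
    filter_upwards [h2 β h4, eventually_gt_atTop 0] with n hn hn0
    have : (0:ℝ) < n := Nat.cast_pos.2 hn0
    rw [lt_div_iff₀ this]; nlinarith
  · intro a ha
    obtain ⟨β, h3, h4⟩ := exists_between ha
    filter_upwards [h1 β h3, eventually_gt_atTop 0] with n hn hn0
    have : (0:ℝ) < n := Nat.cast_pos.2 hn0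
    rw [div_lt_iff₀ this]; nlinarith

lemma ae_forall_gt {X : Type*} [MeasurableSpace X] {μ : Measure X} {c : ℝ} {p : ℝ → X → Prop}
    (h : ∀ β, c < β → ∀ᵐ x ∂μ, p β x) (hp : ∀ x β β', β ≤ β' → p β x → p β' x) :
    ∀ᵐ x ∂μ, ∀ β, c < β → p β x := by
  have : ∀ᵐ x ∂μ, ∀ m : ℕ, p (c + 1 / (m + 1 : ℝ)) x := ae_all_iff.2 fun m => h _ (by
    have : (0:ℝ) < 1 / (m + 1 : ℝ) := by positivity
    linarith)
  filter_upwards [this] with x hx β hβ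
  obtain ⟨m, hm⟩ := exists_nat_one_div_lt (sub_pos.2 hβ)
  exact hp x _ _ (by linarith) (hx m)

lemma ae_le_of_ergodic {X : Type*} [MeasurableSpace X] {μ : Measure X} [IsProbabilityMeasure μ]
    {T : X → X} {f : X → ℝ} (hT : Ergodic T μ) (hf : Measurable f) (hi : Integrable f μ) :
    ∀ᵐ x ∂μ, ∀ β, ∫ x, f x ∂μ < β → ∀ᶠ n : ℕ in atTop, birkhoffSum T f n x ≤ β * n := by
  apply ae_forall_gt
  · intro β hβ
    obtain ⟨α, h3, h4⟩ := exists_between hβ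
    have hBm := bset_measurable hT.measurable hf α
    have hmax := maximal_inv α hT.toMeasurePreserving hf hi hBm (bset_inv α)
      (Eventually.of_forall fun x => mem_bset)
    rcases hT.toPreErgodic.ae_mem_or_ae_notMem hBm (bset_inv α) with h | h
    · exfalso
      have hu : bset T f α =ᵐ[μ] univ := by rwa [eventuallyEq_univ]
      rw [setIntegral_congr_set hu, setIntegral_univ, measureReal_congr hu] at hmax
      simp at hmax
      linarith
    · filter_upwards [h] with x hx
      exact not_mem_bset hx h4
  · intro x β β' hb h
    filter_upwards [h] with n hn
    have : (0:ℝ) ≤ n := Nat.cast_nonneg n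
    nlinarith

/-- Birkhoff's pointwise ergodic theorem, ergodic case. -/
theorem birkhoff_ergodic {X : Type*} [MeasurableSpace X] {μ : Measure X} [IsProbabilityMeasure μ]
    {T : X → X} {f : X → ℝ} (hT : Ergodic T μ) (hf : Measurable f) (hi : Integrable f μ) :
    ∀ᵐ x ∂μ, Tendsto (fun n : ℕ => birkhoffSum T f n x / n) atTop (𝓝 (∫ x, f x ∂μ)) := by
  filter_upwards [ae_le_of_ergodic hT hf hi, ae_le_of_ergodic hT hf.neg hi.neg] with x h1 h2
  refine tendsto_div_of_bounds h1 fun β hβ => ?_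
  have h3 : ∫ x, (-f) x ∂μ = - ∫ x, f x ∂μ := integral_neg f
  filter_upwards [h2 (-β) (by rw [h3]; linarith)] with n hn
  have : birkhoffSum T (-f) n x = - birkhoffSum T f n x := by
    simp [birkhoffSum]
  rw [this] at hn; linarith

/-- If the lower bound for the averages is known, the full convergence follows. -/
theorem birkhoff_of_lower {X : Type*} [MeasurableSpace X] {μ : Measure X} [IsProbabilityMeasure μ]
    {T : X → X} {f : X → ℝ} (hT : MeasurePreserving T μ μ) (hf : Measurable f)
    (hi : Integrable f μ)
    (hlow : ∀ᵐ x ∂μ, ∀ β, β < ∫ x, f x ∂μ → ∀ᶠ n : ℕ in atTop, β * n ≤ birkhoffSum T f n x) :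
    ∀ᵐ x ∂μ, Tendsto (fun n : ℕ => birkhoffSum T f n x / n) atTop (𝓝 (∫ x, f x ∂μ)) := by
  have hup : ∀ᵐ x ∂μ, ∀ β, ∫ x, f x ∂μ < β → ∀ᶠ n : ℕ in atTop, birkhoffSum T f n x ≤ β * n := by
    apply ae_forall_gt
    · intro β hβ
      obtain ⟨α, h3, h4⟩ := exists_between hβ
      have hBm := bset_measurable hT.measurable hf α
      have hmax := maximal_inv α hT hf hi hBm (bset_inv α)
        (Eventually.of_forall fun x => mem_bset)
      have hmax2 : ∀ γ, γ < ∫ x, f x ∂μ →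
          γ * μ.real (bset T f α)ᶜ ≤ ∫ x in (bset T f α)ᶜ, f x ∂μ := by
        intro γ hγ
        apply maximal_inv γ hT hf hi hBm.compl (by rw [preimage_compl, bset_inv])
        filter_upwards [hlow] with x hx _
        obtain ⟨γ', h5, h6⟩ := exists_between hγ
        obtain ⟨n, hn, hn0⟩ := ((hx γ' h6).and (eventually_gt_atTop 0)).exists
        have : (0:ℝ) < n := Nat.cast_pos.2 hn0
        exact ⟨n, by nlinarith⟩
      have hmax3 : (∫ x, f x ∂μ) * μ.real (bset T f α)ᶜ ≤ ∫ x in (bset T f α)ᶜ, f x ∂μ := by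
        have hcont : Tendsto (fun γ : ℝ => γ * μ.real (bset T f α)ᶜ) (𝓝[<] (∫ x, f x ∂μ))
            (𝓝 ((∫ x, f x ∂μ) * μ.real (bset T f α)ᶜ)) :=
          ((continuous_id.mul continuous_const).tendsto _).mono_left nhdsWithin_le_nhds
        refine le_of_tendsto hcont ?_
        filter_upwards [self_mem_nhdsWithin] with γ hγ using hmax2 γ hγ
      have hsum := integral_add_compl hBm hi
      have hms : μ.real (bset T f α)ᶜ = 1 - μ.real (bset T f α) := probReal_compl_eq_one_sub hBm
      rw [hms] at hmax3
      have hz : μ.real (bset T f α) = 0 := by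
        have := measureReal_nonneg (μ := μ) (s := bset T f α)
        nlinarith
      have hz' : μ (bset T f α) = 0 := by
        rwa [measureReal_eq_zero_iff] at hz
      filter_upwards [measure_eq_zero_iff_ae_notMem.1 hz'] with x hx
      exact not_mem_bset hx h4
    · intro x β β' hb h
      filter_upwards [h] with n hn
      have : (0:ℝ) ≤ n := Nat.cast_nonneg n
      nlinarith
  filter_upwards [hup, hlow] with x h1 h2
  exact tendsto_div_of_bounds h1 h2

end SRE


namespace SRE

/-- first passage probabilities -/
def fp (p q : ℤ → ℝ≥0∞) : ℕ → ℤ → ℤ → ℝ≥0∞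
  | 0, x, y => if x = y then 1 else 0
  | t + 1, x, y => if x = y then 0 else p x * fp p q t (x + 1) y + q x * fp p q t (x - 1) y

/-- survival probabilities: the target has not been hit up to time `n` -/
def su (p q : ℤ → ℝ≥0∞) : ℕ → ℤ → ℤ → ℝ≥0∞
  | 0, x, y => if x = y then 0 else 1
  | t + 1, x, y => if x = y then 0 else p x * su p q t (x + 1) y + q x * su p q t (x - 1) y

/-- n-step transition probabilities -/
def tp (p q : ℤ → ℝ≥0∞) : ℕ → ℤ → ℤ → ℝ≥0∞
  | 0, x, y => if x = y then 1 else 0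
  | t + 1, x, y => p x * tp p q t (x + 1) y + q x * tp p q t (x - 1) y

variable {p q : ℤ → ℝ≥0∞}

lemma fp_self (t : ℕ) (y : ℤ) : fp p q (t + 1) y y = 0 := by simp [fp]
lemma su_self (t : ℕ) (y : ℤ) : su p q t y y = 0 := by cases t <;> simp [su]

lemma fp_zero_add_su (x y : ℤ) : fp p q 0 x y + su p q 0 x y = 1 := by
  by_cases h : x = y <;> simp [fp, su, h]

lemma fp_add_su (hpq : ∀ x, p x + q x = 1) (t : ℕ) :
    ∀ x y : ℤ, fp p q (t + 1) x y + su p q (t + 1) x y = su p q t x y := by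
  induction t with
  | zero =>
    intro x y
    by_cases h : x = y
    · simp [fp, su, h]
    · have h1 := fp_zero_add_su (p := p) (q := q) (x + 1) y
      have h2 := fp_zero_add_su (p := p) (q := q) (x - 1) y
      calc fp p q (0 + 1) x y + su p q (0 + 1) x y
          = p x * (fp p q 0 (x + 1) y + su p q 0 (x + 1) y)
            + q x * (fp p q 0 (x - 1) y + su p q 0 (x - 1) y) := by
              simp only [fp, su, h, if_false]; ring
        _ = su p q 0 x y := by rw [h1, h2, mul_one, mul_one, hpq]; simp [su, h]
  | succ t ih =>
    intro x y
    by_cases h : x = y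
    · simp [fp, su, h]
    · calc fp p q (t + 1 + 1) x y + su p q (t + 1 + 1) x y
          = p x * (fp p q (t + 1) (x + 1) y + su p q (t + 1) (x + 1) y)
            + q x * (fp p q (t + 1) (x - 1) y + su p q (t + 1) (x - 1) y) := by
              rw [fp, su]; simp only [h, if_false]; ring
        _ = su p q (t + 1) x y := by rw [ih, ih, su]; simp [h]

lemma su_le_one (hpq : ∀ x, p x + q x = 1) (t : ℕ) (x y : ℤ) : su p q t x y ≤ 1 := by
  induction t with
  | zero => rw [← fp_zero_add_su (p := p) (q := q) x y]; exact le_add_self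
  | succ t ih => exact le_trans (by rw [← fp_add_su hpq t x y]; exact le_add_self) ih

lemma sum_fp_add_su (hpq : ∀ x, p x + q x = 1) (x y : ℤ) (n : ℕ) :
    ∑ t ∈ Finset.range (n + 1), fp p q t x y + su p q n x y = 1 := by
  induction n with
  | zero => simpa using fp_zero_add_su x y
  | succ n ih => rw [Finset.sum_range_succ, add_assoc, fp_add_su hpq, ih]

lemma sum_mul_fp (hpq : ∀ x, p x + q x = 1) (x y : ℤ) (n : ℕ) :
    ∑ t ∈ Finset.range (n + 1), (t : ℝ≥0∞) * fp p q t x y + n * su p q n x y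
      = ∑ t ∈ Finset.range n, su p q t x y := by
  induction n with
  | zero => simp
  | succ n ih =>
    rw [Finset.sum_range_succ, add_assoc, ← mul_add, fp_add_su hpq,
      Finset.sum_range_succ (fun t => su p q t x y) n, ← ih]
    push_cast; ring

/-- generating function of the first passage time -/
def gf (p q : ℤ → ℝ≥0∞) (w : ℝ≥0∞) (x y : ℤ) : ℝ≥0∞ := ∑' t, fp p q t x y * w ^ t

/-- generating function of the survival probabilities -/
def gs (p q : ℤ → ℝ≥0∞) (w : ℝ≥0∞) (x y : ℤ) : ℝ≥0∞ := ∑' t, su p q t x y * w ^ t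

/-- mean passage time -/
def mt (p q : ℤ → ℝ≥0∞) (x y : ℤ) : ℝ≥0∞ := ∑' t, su p q t x y

lemma tsum_mul_fp_le (hpq : ∀ x, p x + q x = 1) (x y : ℤ) :
    ∑' t : ℕ, (t : ℝ≥0∞) * fp p q t x y ≤ mt p q x y := by
  apply ENNReal.tsum_le_of_sum_range_le
  intro n
  calc ∑ t ∈ Finset.range n, (t : ℝ≥0∞) * fp p q t x y
      ≤ ∑ t ∈ Finset.range (n + 1), (t : ℝ≥0∞) * fp p q t x y := by
        rw [Finset.sum_range_succ]; exact le_self_add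
    _ ≤ ∑ t ∈ Finset.range n, su p q t x y := by
        rw [← sum_mul_fp hpq]; exact le_self_add
    _ ≤ _ := ENNReal.sum_le_tsum _

lemma tsum_fp_eq_one (hpq : ∀ x, p x + q x = 1) {x y : ℤ} (h : mt p q x y ≠ ⊤) :
    ∑' t : ℕ, fp p q t x y = 1 := by
  have h1 : Tendsto (fun n => su p q n x y) atTop (𝓝 0) := ENNReal.tendsto_atTop_zero_of_tsum_ne_top h
  have h2 : Tendsto (fun n => ∑ t ∈ Finset.range (n + 1), fp p q t x y) atTop
      (𝓝 (∑' t : ℕ, fp p q t x y)) :=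
    (ENNReal.tendsto_nat_tsum fun t => fp p q t x y).comp (tendsto_add_atTop_nat 1)
  have h3 := h2.add h1
  simp only [sum_fp_add_su hpq, add_zero] at h3
  exact (tendsto_nhds_unique h3 tendsto_const_nhds)

lemma gf_add_gs (hpq : ∀ x, p x + q x = 1) (w : ℝ≥0∞) (x y : ℤ) :
    gf p q w x y + gs p q w x y = 1 + w * gs p q w x y := by
  unfold gf gs
  rw [← ENNReal.tsum_add, tsum_eq_zero_add' ENNReal.summable, ← ENNReal.tsum_mul_left]
  congr 1
  · simp [fp_zero_add_su]
  · congr 1; ext t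
    rw [← add_mul, fp_add_su hpq]; ring

lemma gs_le (hpq : ∀ x, p x + q x = 1) (w : ℝ≥0∞) (x y : ℤ) : gs p q w x y ≤ (1 - w)⁻¹ := by
  rw [← ENNReal.tsum_geometric]
  refine ENNReal.tsum_le_tsum fun t => ?_
  calc su p q t x y * w ^ t ≤ 1 * w ^ t := by gcongr; exact su_le_one hpq t x y
    _ = _ := one_mul _

lemma fp_conv (t : ℕ) : ∀ x y z : ℤ, x ≤ y → y ≤ z →
    fp p q t x z = ∑ ij ∈ Finset.HasAntidiagonal.antidiagonal t, fp p q ij.1 x y * fp p q ij.2 y z := by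
  induction t with
  | zero =>
    intro x y z hxy hyz
    rcases hxy.eq_or_lt with rfl | h
    · simp [fp]
    · have h1 : x ≠ y := h.ne
      have h2 : x ≠ z := (h.trans_le hyz).ne
      simp [fp, h1, h2]
  | succ t ih =>
    intro x y z hxy hyz
    rw [Finset.Nat.sum_antidiagonal_succ]
    rcases hxy.eq_or_lt with rfl | h
    · simp only [fp_self, zero_mul, Finset.sum_const_zero, add_zero]
      simp [fp]
    · have h1 : x ≠ y := h.ne
      have h2 : x ≠ z := (h.trans_le hyz).ne
      rw [show fp p q 0 x y = 0 by simp [fp, h1], zero_mul, zero_add]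
      rw [fp, if_neg h2, ih (x + 1) y z (by omega) hyz, ih (x - 1) y z (by omega) hyz,
        Finset.mul_sum, Finset.mul_sum, ← Finset.sum_add_distrib]
      refine Finset.sum_congr rfl fun ij _ => ?_
      rw [fp, if_neg h1]; ring

lemma su_conv (t : ℕ) : ∀ x y z : ℤ, x ≤ y → y ≤ z →
    su p q t x z = su p q t x y
      + ∑ ij ∈ Finset.HasAntidiagonal.antidiagonal t, fp p q ij.1 x y * su p q ij.2 y z := by
  induction t with
  | zero =>
    intro x y z hxy hyz
    rcases hxy.eq_or_lt with rfl | h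
    · simp [fp, su]
    · have h1 : x ≠ y := h.ne
      have h2 : x ≠ z := (h.trans_le hyz).ne
      simp [fp, su, h1, h2]
  | succ t ih =>
    intro x y z hxy hyz
    rw [Finset.Nat.sum_antidiagonal_succ]
    rcases hxy.eq_or_lt with rfl | h
    · simp only [fp_self, zero_mul, Finset.sum_const_zero, add_zero, su_self, zero_add]
      simp [fp]
    · have h1 : x ≠ y := h.ne
      have h2 : x ≠ z := (h.trans_le hyz).ne
      rw [show fp p q 0 x y = 0 by simp [fp, h1], zero_mul, zero_add]
      rw [su, if_neg h2, ih (x + 1) y z (by omega) hyz, ih (x - 1) y z (by omega) hyz,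
        su, if_neg h1, mul_add, mul_add,
        Finset.mul_sum, Finset.mul_sum, add_add_add_comm, ← Finset.sum_add_distrib]
      congr 1
      refine Finset.sum_congr rfl fun ij _ => ?_
      rw [fp, if_neg h1]; ring

lemma tsum_conv (f g : ℕ → ℝ≥0∞) :
    ∑' t, ∑ ij ∈ Finset.HasAntidiagonal.antidiagonal t, f ij.1 * g ij.2 = (∑' t, f t) * ∑' t, g t := by
  rw [← ENNReal.tsum_mul_right]
  simp_rw [← ENNReal.tsum_mul_left]
  rw [← ENNReal.tsum_prod (f := fun a b => f a * g b),
    ← (Finset.HasAntidiagonal.sigmaAntidiagonalEquivProd (A := ℕ)).tsum_eq, ENNReal.tsum_sigma']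
  refine tsum_congr fun t => ?_
  rw [tsum_fintype]
  exact (Finset.sum_coe_sort (Finset.HasAntidiagonal.antidiagonal t) (fun ij => f ij.1 * g ij.2)).symm

lemma gf_mul (w : ℝ≥0∞) {x y z : ℤ} (hxy : x ≤ y) (hyz : y ≤ z) :
    gf p q w x z = gf p q w x y * gf p q w y z := by
  unfold gf
  rw [← tsum_conv]
  refine tsum_congr fun t => ?_
  rw [fp_conv t x y z hxy hyz, Finset.sum_mul]
  refine Finset.sum_congr rfl fun ij h => ?_
  rw [← Finset.HasAntidiagonal.mem_antidiagonal.1 h, pow_add]; ring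

lemma mt_add (hpq : ∀ x, p x + q x = 1) {x y z : ℤ} (hxy : x ≤ y) (hyz : y ≤ z)
    (h : mt p q x y ≠ ⊤) : mt p q x z = mt p q x y + mt p q y z := by
  unfold mt
  simp_rw [su_conv _ x y z hxy hyz]
  rw [ENNReal.tsum_add, tsum_conv (fun i => fp p q i x y) (fun j => su p q j y z),
    tsum_fp_eq_one hpq h, one_mul]

lemma mt_step {x y : ℤ} (h : x ≠ y) :
    mt p q x y = 1 + (p x * mt p q (x + 1) y + q x * mt p q (x - 1) y) := by
  unfold mt
  rw [tsum_eq_zero_add' ENNReal.summable, ← ENNReal.tsum_mul_left, ← ENNReal.tsum_mul_left,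
    ← ENNReal.tsum_add]
  simp [su, h]

lemma mt_self (x : ℤ) : mt p q x x = 0 := by simp [mt, su_self]

/-- truncated candidate for the mean time of one step to the right -/
def cand (r : ℤ → ℝ≥0∞) : ℕ → ℤ → ℝ≥0∞
  | 0, _ => 0
  | n + 1, x => 1 + r x + r x * cand r n (x - 1)

lemma cand_mono (r : ℤ → ℝ≥0∞) (n : ℕ) : ∀ x, cand r n x ≤ cand r (n + 1) x := by
  induction n with
  | zero => intro x; simp [cand]
  | succ n ih =>
    intro x
    rw [cand, cand]
    gcongr
    exact ih _

lemma sum_su_le {r : ℤ → ℝ≥0∞} (hpq : ∀ x, p x + q x = 1) (hr : ∀ x, p x * r x = q x) (y : ℤ)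
    (N : ℕ) : ∀ j : ℕ, ∑ n ∈ Finset.range N, su p q n (y - j) y
      ≤ ∑ i ∈ Finset.range j, cand r N (y - 1 - i) := by
  induction N with
  | zero => intro j; simp
  | succ N ih =>
    intro j
    cases j with
    | zero => simp [su_self]
    | succ j =>
      have hne : y - ((j + 1 : ℕ) : ℤ) ≠ y := by push_cast; omega
      set x := y - ((j + 1 : ℕ) : ℤ) with hx
      have e1 : x + 1 = y - (j : ℤ) := by rw [hx]; push_cast; ring
      have e2 : x - 1 = y - ((j + 2 : ℕ) : ℤ) := by rw [hx]; push_cast; ring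
      have e3 : y - 1 - ((j : ℕ) : ℤ) = x := by rw [hx]; push_cast; ring
      have e4 : y - 1 - ((j + 1 : ℕ) : ℤ) = x - 1 := by rw [hx]; push_cast; ring
      set H := ∑ i ∈ Finset.range j, cand r N (y - 1 - i) with hH
      have hstep : ∑ n ∈ Finset.range (N + 1), su p q n x y
          = 1 + (p x * ∑ n ∈ Finset.range N, su p q n (x + 1) y
            + q x * ∑ n ∈ Finset.range N, su p q n (x - 1) y) := by
        rw [Finset.sum_range_succ', Finset.mul_sum, Finset.mul_sum, ← Finset.sum_add_distrib,
          add_comm]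
        simp [su, hne]
      have h1 : ∑ n ∈ Finset.range N, su p q n (x + 1) y ≤ H := by rw [e1]; exact ih j
      have h2 : ∑ n ∈ Finset.range N, su p q n (x - 1) y ≤ H + cand r N x + cand r N (x - 1) := by
        have h2' := ih (j + 2)
        rwa [← e2, Finset.sum_range_succ, Finset.sum_range_succ, e3, e4] at h2'
      have hp1 : p x * cand r (N + 1) x = 1 + q x * cand r N (x - 1) := by
        rw [cand, mul_add, mul_add, ← mul_assoc, hr, mul_one, hpq]
      calc ∑ n ∈ Finset.range (N + 1), su p q n x y
          ≤ 1 + (p x * H + q x * (H + cand r N x + cand r N (x - 1))) := by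
            rw [hstep]; gcongr
        _ = (p x + q x) * H + (1 + q x * cand r N (x - 1)) + q x * cand r N x := by ring
        _ = H + p x * cand r (N + 1) x + q x * cand r N x := by rw [hp1, hpq, one_mul]
        _ ≤ H + p x * cand r (N + 1) x + q x * cand r (N + 1) x := by
            gcongr; exact cand_mono r N x
        _ = H + cand r (N + 1) x := by rw [add_assoc, ← add_mul, hpq, one_mul]
        _ ≤ ∑ i ∈ Finset.range (j + 1), cand r (N + 1) (y - 1 - i) := by
            rw [Finset.sum_range_succ, e3]
            gcongr
            rw [hH]
            exact Finset.sum_le_sum fun i _ => cand_mono r N _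

lemma mt_one_le {r : ℤ → ℝ≥0∞} (hpq : ∀ x, p x + q x = 1) (hr : ∀ x, p x * r x = q x) (x : ℤ)
    {c : ℝ≥0∞} (hc : ∀ N, cand r N x ≤ c) : mt p q x (x + 1) ≤ c := by
  apply ENNReal.tsum_le_of_sum_range_le
  intro N
  have := sum_su_le hpq hr (x + 1) N 1
  simp at this
  exact this.trans (hc N)

lemma mt_one_rec {r : ℤ → ℝ≥0∞} (hpq : ∀ x, p x + q x = 1) (hr : ∀ x, p x * r x = q x)
    (hp0 : ∀ x, p x ≠ 0) (x : ℤ)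
    (h1 : mt p q x (x + 1) ≠ ⊤) (h2 : mt p q (x - 1) x ≠ ⊤) :
    mt p q x (x + 1) = 1 + r x + r x * mt p q (x - 1) x := by
  have hstep := mt_step (p := p) (q := q) (x := x) (y := x + 1) (by omega)
  rw [mt_self, mul_zero, zero_add, mt_add hpq (x := x - 1) (y := x) (z := x + 1) (by omega)
    (by omega) h2] at hstep
  set E := mt p q x (x + 1)
  set E' := mt p q (x - 1) x
  have hq1 : q x ≠ ⊤ := ne_top_of_le_ne_top ENNReal.one_ne_top (by rw [← hpq x]; exact le_add_self)
  have hp1 : p x ≠ ⊤ := ne_top_of_le_ne_top ENNReal.one_ne_top (by rw [← hpq x]; exact le_self_add)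
  have h3 : p x * E + q x * E = (1 + q x * E') + q x * E := by
    rw [← add_mul, hpq, one_mul]
    conv_lhs => rw [hstep]
    ring
  have h4 : p x * E = 1 + q x * E' :=
    (ENNReal.add_left_inj (ENNReal.mul_ne_top hq1 h1)).1 h3
  have h5 : p x * E = p x * (1 + r x + r x * E') := by
    rw [h4, mul_add, mul_add, ← mul_assoc, hr, mul_one, hpq]
  exact (ENNReal.mul_right_inj (hp0 x) hp1).1 h5

/-- forward equation -/
lemma tp_forward (t : ℕ) : ∀ x y : ℤ,
    tp p q (t + 1) x y = tp p q t x (y - 1) * p (y - 1) + tp p q t x (y + 1) * q (y + 1) := by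
  induction t with
  | zero =>
    intro x y
    by_cases h1 : x = y - 1
    · subst h1
      have : ¬ (y - 1 - 1 = y) := by omega
      have h' : ¬ (y - 1 = y + 1) := by omega
      simp [tp, this, h']
    · by_cases h2 : x = y + 1
      · subst h2
        have : ¬ (y + 1 + 1 = y) := by omega
        have h' : ¬ (y + 1 = y - 1) := by omega
        simp [tp, this, h']
      · have h3 : ¬ (x + 1 = y) := by omega
        have h4 : ¬ (x - 1 = y) := by omega
        simp [tp, h1, h2, h3, h4]
  | succ t ih =>
    intro x y
    rw [tp, ih (x + 1) y, ih (x - 1) y, tp, tp]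
    ring

lemma tp_le {π : ℤ → ℝ≥0∞} (hπ : ∀ y, π (y - 1) * p (y - 1) + π (y + 1) * q (y + 1) ≤ π y)
    (x : ℤ) (t : ℕ) : ∀ y, π x * tp p q t x y ≤ π y := by
  induction t with
  | zero =>
    intro y
    by_cases h : x = y <;> simp [tp, h]
  | succ t ih =>
    intro y
    rw [tp_forward]
    calc π x * (tp p q t x (y - 1) * p (y - 1) + tp p q t x (y + 1) * q (y + 1))
        = (π x * tp p q t x (y - 1)) * p (y - 1) + (π x * tp p q t x (y + 1)) * q (y + 1) := by ring
      _ ≤ π (y - 1) * p (y - 1) + π (y + 1) * q (y + 1) := by gcongr <;> apply ih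
      _ ≤ π y := hπ y

end SRE


namespace SRE

def pe (env : ℤ → ℝ) (x : ℤ) : ℝ≥0∞ := ENNReal.ofReal (env x)
def qe (env : ℤ → ℝ) (x : ℤ) : ℝ≥0∞ := ENNReal.ofReal (1 - env x)

def cyl (path : ℕ → ℤ) (n : ℕ) : Set (ℕ → ℤ) := {f | ∀ k ≤ n, f k = path k}

def wt (env : ℤ → ℝ) (path : ℕ → ℤ) (n : ℕ) : ℝ≥0∞ :=
  ENNReal.ofReal (∏ k ∈ Finset.range n, stepProb env (path k) (path (k + 1)))

def ext (path : ℕ → ℤ) (n : ℕ) (j : ℤ) : ℕ → ℤ := Function.update path (n + 1) j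

lemma ext_le (path : ℕ → ℤ) {n k : ℕ} (j : ℤ) (h : k ≤ n) : ext path n j k = path k := by
  unfold ext; rw [Function.update_of_ne]; omega

lemma ext_succ (path : ℕ → ℤ) (n : ℕ) (j : ℤ) : ext path n j (n + 1) = j := by
  unfold ext; simp

lemma wt_ext {env : ℤ → ℝ} (h0 : ∀ x, 0 ≤ env x) (h1 : ∀ x, env x ≤ 1) (path : ℕ → ℤ) (n : ℕ) (j : ℤ) :
    wt env (ext path n j) (n + 1) = wt env path n * ENNReal.ofReal (stepProb env (path n) j) := by
  have hs : ∀ i j, 0 ≤ stepProb env i j := by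
    intro i j
    unfold stepProb
    split_ifs
    · exact h0 i
    · linarith [h1 i]
    · exact le_rfl
  unfold wt
  rw [Finset.prod_range_succ, ENNReal.ofReal_mul (Finset.prod_nonneg fun _ _ => hs _ _),
    ext_succ, ext_le path j le_rfl]
  congr 2
  refine Finset.prod_congr rfl fun k hk => ?_
  have := Finset.mem_range.1 hk
  rw [ext_le path j (by omega), ext_le path j (by omega)]

lemma cyl_measurable (path : ℕ → ℤ) (n : ℕ) : MeasurableSet (cyl path n) := by
  have : cyl path n = ⋂ k : ℕ, ⋂ (_ : k ≤ n), (fun f : ℕ → ℤ => f k) ⁻¹' {path k} := by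
    ext f; simp [cyl]
  rw [this]
  exact MeasurableSet.iInter fun k => MeasurableSet.iInter fun _ =>
    (measurable_pi_apply k) (measurableSet_singleton _)

lemma cyl_ext_eq (path : ℕ → ℤ) (n : ℕ) (j : ℤ) :
    cyl (ext path n j) (n + 1) = cyl path n ∩ {f | f (n + 1) = j} := by
  ext f
  constructor
  · intro h
    refine ⟨fun k hk => ?_, ?_⟩
    · rw [h k (by omega), ext_le path j hk]
    · have := h (n + 1) le_rfl
      rw [ext_succ] at this; exact this
  · rintro ⟨h, h'⟩ k hk
    rcases Nat.lt_or_ge n k with hlt | hge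
    · obtain rfl : k = n + 1 := by omega
      rw [ext_succ]; exact h'
    · rw [ext_le path j hge]; exact h k hge

section
variable {env : ℤ → ℝ} {x : ℤ} {μ : Measure (ℕ → ℤ)}

lemma measure_cyl (hK : IsQuenchedRW env x μ) (path : ℕ → ℤ) (n : ℕ) (h : path 0 = x) :
    μ (cyl path n) = wt env path n := hK.2 n path h

lemma cyl_step (hK : IsQuenchedRW env x μ)
    (h0 : ∀ x, 0 ≤ env x) (h1 : ∀ x, env x ≤ 1)
    (path : ℕ → ℤ) (n : ℕ) (h : path 0 = x) (B : Set (ℕ → ℤ)) :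
    μ (cyl path n ∩ B) = μ (cyl (ext path n (path n + 1)) (n + 1) ∩ B)
      + μ (cyl (ext path n (path n - 1)) (n + 1) ∩ B) := by
  have hm : ∀ j : ℤ, MeasurableSet {f : ℕ → ℤ | f (n + 1) = j} := by
    intro j
    have e : {f : ℕ → ℤ | f (n + 1) = j} = (fun f : ℕ → ℤ => f (n + 1)) ⁻¹' {j} := by ext f; simp
    rw [e]
    exact (measurable_pi_apply (n + 1)) (measurableSet_singleton j)
  have hz : ∀ j, j ≠ path n + 1 → j ≠ path n - 1 → μ (cyl (ext path n j) (n + 1)) = 0 := by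
    intro j hj1 hj2
    rw [measure_cyl hK _ _ (by rw [ext_le path j (Nat.zero_le n), h]), wt_ext h0 h1]
    simp [stepProb, hj1, hj2]
  rw [← measure_inter_add_sdiff (cyl path n ∩ B) (hm (path n + 1))]
  congr 1
  · rw [cyl_ext_eq, inter_right_comm]
  · rw [← measure_inter_add_sdiff _ (hm (path n - 1))]
    have : μ (((cyl path n ∩ B) \ {f | f (n + 1) = path n + 1}) \ {f | f (n + 1) = path n - 1}) = 0 := by
      refine measure_mono_null (t := ⋃ j : ℤ, ⋃ (_ : j ≠ path n + 1), ⋃ (_ : j ≠ path n - 1),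
        cyl (ext path n j) (n + 1)) ?_ ?_
      · rintro f ⟨⟨⟨hf, _⟩, hf1⟩, hf2⟩
        simp only [mem_iUnion]
        refine ⟨f (n + 1), hf1, hf2, ?_⟩
        rw [cyl_ext_eq]; exact ⟨hf, rfl⟩
      · simp only [measure_iUnion_null_iff]
        exact hz
    rw [this, add_zero, cyl_ext_eq]
    congr 1
    ext f
    simp only [mem_inter_iff, Set.mem_sdiff, mem_ofPred_eq]
    constructor
    · rintro ⟨⟨⟨a, b⟩, c⟩, d⟩; exact ⟨⟨a, d⟩, b⟩
    · rintro ⟨⟨a, d⟩, b⟩; exact ⟨⟨⟨a, b⟩, by omega⟩, d⟩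

/-- consecutive first hits -/
def hitEv : ℕ → List (ℤ × ℕ) → Set (ℕ → ℤ)
  | _, [] => univ
  | n, (y, t) :: L => {f | (∀ s < t, f (n + s) ≠ y) ∧ f (n + t) = y} ∩ hitEv (n + t) L

def lw (p q : ℤ → ℝ≥0∞) : ℤ → List (ℤ × ℕ) → ℝ≥0∞
  | _, [] => 1
  | x, (y, t) :: L => fp p q t x y * lw p q y L

lemma hitEv_succ (n : ℕ) (y : ℤ) (t : ℕ) (L : List (ℤ × ℕ)) :
    hitEv n ((y, t + 1) :: L) = {f | f n ≠ y} ∩ hitEv (n + 1) ((y, t) :: L) := by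
  ext f
  simp only [hitEv, mem_inter_iff, mem_ofPred_eq]
  rw [show n + 1 + t = n + (t + 1) by ring]
  constructor
  · rintro ⟨⟨h1, h2⟩, h3⟩
    refine ⟨h1 0 (by omega), ⟨fun s hs => ?_, h2⟩, h3⟩
    rw [show n + 1 + s = n + (s + 1) by ring]
    exact h1 (s + 1) (by omega)
  · rintro ⟨h0, ⟨h1, h2⟩, h3⟩
    refine ⟨⟨fun s hs => ?_, h2⟩, h3⟩
    cases s with
    | zero => exact h0
    | succ s =>
      rw [show n + (s + 1) = n + 1 + s by ring]
      exact h1 s (by omega)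

lemma cyl_inter_eval (path : ℕ → ℤ) (n : ℕ) (A : Set ℤ) (B : Set (ℕ → ℤ)) (h : path n ∈ A) :
    cyl path n ∩ ({f | f n ∈ A} ∩ B) = cyl path n ∩ B := by
  ext f
  simp only [mem_inter_iff, mem_ofPred_eq]
  constructor
  · rintro ⟨a, b, c⟩; exact ⟨a, c⟩
  · rintro ⟨a, c⟩
    refine ⟨a, ?_, c⟩
    rw [a n le_rfl]; exact h

lemma cyl_inter_eval' (path : ℕ → ℤ) (n : ℕ) (A : Set ℤ) (B : Set (ℕ → ℤ)) (h : path n ∉ A) :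
    cyl path n ∩ ({f | f n ∈ A} ∩ B) = ∅ := by
  ext f
  simp only [mem_inter_iff, mem_ofPred_eq, mem_empty_iff_false, iff_false]
  rintro ⟨a, b, c⟩
  rw [a n le_rfl] at b
  exact h b

lemma measure_cyl_hitEv (hK : IsQuenchedRW env x μ)
    (h0 : ∀ x, 0 ≤ env x) (h1 : ∀ x, env x ≤ 1) (L : List (ℤ × ℕ)) :
    ∀ (n : ℕ) (path : ℕ → ℤ), path 0 = x →
      μ (cyl path n ∩ hitEv n L) = wt env path n * lw (pe env) (qe env) (path n) L := by
  induction L with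
  | nil => intro n path h; simp [hitEv, lw, measure_cyl hK path n h]
  | cons a L ih =>
    obtain ⟨y, t⟩ := a
    induction t with
    | zero =>
      intro n path h
      have e : hitEv n ((y, 0) :: L) = {f | f n ∈ ({y} : Set ℤ)} ∩ hitEv n L := by
        ext f; simp [hitEv]
      rw [e]
      by_cases hy : path n = y
      · rw [cyl_inter_eval _ _ _ _ (by simpa using hy), ih n path h, lw]
        simp [fp, hy]
      · rw [cyl_inter_eval' _ _ _ _ (by simpa using hy), lw]
        simp [fp, hy]
    | succ t iht =>
      intro n path h
      rw [hitEv_succ]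
      by_cases hy : path n = y
      · rw [show {f : ℕ → ℤ | f n ≠ y} = {f | f n ∈ ({y}ᶜ : Set ℤ)} from rfl,
          cyl_inter_eval' _ _ _ _ (by simpa using hy), lw]
        simp [fp, hy]
      · rw [show {f : ℕ → ℤ | f n ≠ y} = {f | f n ∈ ({y}ᶜ : Set ℤ)} from rfl,
          cyl_inter_eval _ _ _ _ (by simpa using hy), cyl_step hK h0 h1 path n h,
          iht (n + 1) _ (by rw [ext_le path _ (Nat.zero_le n), h]),
          iht (n + 1) _ (by rw [ext_le path _ (Nat.zero_le n), h]), wt_ext h0 h1, wt_ext h0 h1,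
          ext_succ, ext_succ, lw, lw, lw, fp, if_neg hy]
        have e1 : stepProb env (path n) (path n + 1) = env (path n) := by simp [stepProb]
        have e2 : stepProb env (path n) (path n - 1) = 1 - env (path n) := by
          have : ¬ (path n - 1 = path n + 1) := by omega
          simp [stepProb, this]
        rw [e1, e2]
        unfold pe qe
        ring

lemma measure_cyl_tp (hK : IsQuenchedRW env x μ)
    (h0 : ∀ x, 0 ≤ env x) (h1 : ∀ x, env x ≤ 1) (y : ℤ) (m : ℕ) :
    ∀ (n : ℕ) (path : ℕ → ℤ), path 0 = x →
      μ (cyl path n ∩ {f | f (n + m) = y}) = wt env path n * tp (pe env) (qe env) m (path n) y := by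
  induction m with
  | zero =>
    intro n path h
    rw [show {f : ℕ → ℤ | f (n + 0) = y} = {f | f n ∈ ({y} : Set ℤ)} ∩ univ by ext f; simp]
    by_cases hy : path n = y
    · rw [cyl_inter_eval _ _ _ _ (by simpa using hy), inter_univ, measure_cyl hK path n h]
      simp [tp, hy]
    · rw [cyl_inter_eval' _ _ _ _ (by simpa using hy)]
      simp [tp, hy]
  | succ m ih =>
    intro n path h
    rw [cyl_step hK h0 h1 path n h, show n + (m + 1) = n + 1 + m by ring,
      ih (n + 1) _ (by rw [ext_le path _ (Nat.zero_le n), h]),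
      ih (n + 1) _ (by rw [ext_le path _ (Nat.zero_le n), h]), wt_ext h0 h1, wt_ext h0 h1,
      ext_succ, ext_succ, tp]
    have e1 : stepProb env (path n) (path n + 1) = env (path n) := by simp [stepProb]
    have e2 : stepProb env (path n) (path n - 1) = 1 - env (path n) := by
      have : ¬ (path n - 1 = path n + 1) := by omega
      simp [stepProb, this]
    rw [e1, e2]
    unfold pe qe
    ring

lemma cyl_zero_ae (hK : IsQuenchedRW env x μ) : ∀ᵐ f ∂μ, f ∈ cyl (fun _ => x) 0 := by
  have := hK.1
  have h := measure_cyl hK (fun _ => x) 0 rfl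
  rw [show wt env (fun _ => x) 0 = 1 by simp [wt]] at h
  exact mem_ae_iff.2 ((prob_compl_eq_zero_iff (cyl_measurable _ _)).2 h)

lemma measure_hitEv (hK : IsQuenchedRW env x μ)
    (h0 : ∀ x, 0 ≤ env x) (h1 : ∀ x, env x ≤ 1) (L : List (ℤ × ℕ)) :
    μ (hitEv 0 L) = lw (pe env) (qe env) x L := by
  have := measure_cyl_hitEv hK h0 h1 L 0 (fun _ => x) rfl
  rw [show wt env (fun _ => x) 0 = 1 by simp [wt], one_mul] at this
  rw [← this]
  apply measure_congr
  filter_upwards [cyl_zero_ae hK] with f hf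
  have : f ∈ hitEv 0 L ↔ f ∈ cyl (fun _ => x) 0 ∩ hitEv 0 L := ⟨fun h => ⟨hf, h⟩, fun h => h.2⟩
  exact propext this

lemma measure_tp (hK : IsQuenchedRW env x μ)
    (h0 : ∀ x, 0 ≤ env x) (h1 : ∀ x, env x ≤ 1) (y : ℤ) (m : ℕ) :
    μ {f | f m = y} = tp (pe env) (qe env) m x y := by
  have := measure_cyl_tp hK h0 h1 y m 0 (fun _ => x) rfl
  rw [show wt env (fun _ => x) 0 = 1 by simp [wt], one_mul] at this
  rw [← this]
  apply measure_congr
  filter_upwards [cyl_zero_ae hK] with f hf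
  have : f ∈ {f : ℕ → ℤ | f m = y} ↔ f ∈ cyl (fun _ => x) 0 ∩ {f : ℕ → ℤ | f (0 + m) = y} :=
    ⟨fun h => ⟨hf, by simpa using h⟩, fun h => by simpa using h.2⟩
  exact propext this

/-- steps are `±1` almost surely -/
lemma nn_ae (hK : IsQuenchedRW env x μ) (h0 : ∀ x, 0 ≤ env x) (h1 : ∀ x, env x ≤ 1) :
    ∀ᵐ f ∂μ, f 0 = x ∧ ∀ n, f (n + 1) = f n + 1 ∨ f (n + 1) = f n - 1 := by
  have hn : ∀ n : ℕ, ∀ᵐ f ∂μ, f 0 = x → (f (n + 1) = f n + 1 ∨ f (n + 1) = f n - 1) := by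
    intro n
    rw [ae_iff]
    set B : Set (ℕ → ℤ) := {f | ¬ (f 0 = x → (f (n + 1) = f n + 1 ∨ f (n + 1) = f n - 1))} with hB
    refine measure_mono_null (t := ⋃ L : List ℤ, ⋃ (_ : L.getD 0 x = x),
      cyl (fun k => L.getD k x) n ∩ B) ?_ ?_
    · intro f hf
      have hf0 : f 0 = x := by
        by_contra h
        exact hf fun h' => absurd h' h
      simp only [mem_iUnion]
      have key : ∀ k ≤ n, ((List.range (n + 1)).map f).getD k x = f k := by
        intro k hk
        rw [List.getD_eq_getElem?_getD]
        simp [show k < n + 1 by omega]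
      refine ⟨(List.range (n + 1)).map f, ?_, ?_, hf⟩
      · rw [key 0 (Nat.zero_le _), hf0]
      · intro k hk
        exact (key k hk).symm
    · simp only [measure_iUnion_null_iff]
      intro L hL
      rw [cyl_step hK h0 h1 _ n hL]
      have e : ∀ j, (j = (fun k => L.getD k x) n + 1 ∨ j = (fun k => L.getD k x) n - 1) →
          cyl (ext (fun k => L.getD k x) n j) (n + 1) ∩ B = ∅ := by
        intro j hj
        rw [cyl_ext_eq]
        ext f
        simp only [mem_inter_iff, mem_empty_iff_false, iff_false]
        rintro ⟨⟨h1, h2⟩, h3⟩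
        apply h3
        intro _
        have := h1 n le_rfl
        rw [this]
        have h2' : f (n + 1) = j := h2
        rw [h2']
        exact hj
      rw [e _ (Or.inl rfl), e _ (Or.inr rfl)]
      simp
  filter_upwards [cyl_zero_ae hK, ae_all_iff.2 hn] with f hf hf'
  have : f 0 = x := hf 0 le_rfl
  exact ⟨this, fun n => hf' n this⟩
end
end SRE


namespace SRE

/-- sequence space -/
abbrev Sq := ℤ → ℝ × ℕ

def sh (s : Sq) : Sq := fun n => s (n + 1)

/-- clipped distances, always positive -/
def dd (s : Sq) (k : ℤ) : ℕ := max 1 (s k).2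

/-- clipped drift parameters, always in `(0,1)` -/
def ll (s : Sq) (k : ℤ) : ℝ := if 0 < (s k).1 ∧ (s k).1 < 1 then (s k).1 else 1 / 2

/-- marked sites -/
def aa (s : Sq) (k : ℤ) : ℤ :=
  ∑ i ∈ Finset.Ioc 0 k, (dd s i : ℤ) - ∑ i ∈ Finset.Ioc k 0, (dd s i : ℤ)

def en (s : Sq) : ℤ → ℝ := sparseEnv (ll s) (aa s)

lemma one_le_dd (s : Sq) (k : ℤ) : 1 ≤ dd s k := le_max_left _ _
lemma ll_pos (s : Sq) (k : ℤ) : 0 < ll s k := by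
  unfold ll; split_ifs with h
  · exact h.1
  · norm_num
lemma ll_lt (s : Sq) (k : ℤ) : ll s k < 1 := by
  unfold ll; split_ifs with h
  · exact h.2
  · norm_num

lemma aa_zero (s : Sq) : aa s 0 = 0 := by simp [aa]

lemma aa_rec (s : Sq) (k : ℤ) : aa s k - aa s (k - 1) = dd s k := by
  unfold aa
  rcases le_or_gt 1 k with h | h
  · have e1 : Finset.Ioc 0 k = insert k (Finset.Ioc 0 (k - 1)) := by
      ext i; simp only [Finset.mem_Ioc, Finset.mem_insert]; omega
    have e2 : Finset.Ioc k 0 = ∅ := Finset.Ioc_eq_empty (by omega)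
    have e3 : Finset.Ioc (k - 1) 0 = ∅ := Finset.Ioc_eq_empty (by omega)
    rw [e1, e2, e3, Finset.sum_insert (by simp)]
    simp
  · have e1 : Finset.Ioc (k - 1) 0 = insert k (Finset.Ioc k 0) := by
      ext i; simp only [Finset.mem_Ioc, Finset.mem_insert]; omega
    have e2 : Finset.Ioc 0 k = ∅ := Finset.Ioc_eq_empty (by omega)
    have e3 : Finset.Ioc 0 (k - 1) = ∅ := Finset.Ioc_eq_empty (by omega)
    rw [e1, e2, e3, Finset.sum_insert (by simp)]
    simp

lemma aa_succ (s : Sq) (k : ℤ) : aa s (k + 1) = aa s k + dd s (k + 1) := by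
  have := aa_rec s (k + 1)
  rw [add_sub_cancel_right] at this; omega

lemma aa_uniq (f g : ℤ → ℤ) (h0 : f 0 = g 0) (h : ∀ k, f k - f (k - 1) = g k - g (k - 1)) (k : ℤ) :
    f k = g k := by
  induction k using Int.induction_on with
  | zero => exact h0
  | succ i ih => have := h (i + 1); rw [add_sub_cancel_right] at this; omega
  | pred i ih => have := h (-i); omega

lemma dd_sh (s : Sq) (k : ℤ) : dd (sh s) k = dd s (k + 1) := rfl
lemma ll_sh (s : Sq) (k : ℤ) : ll (sh s) k = ll s (k + 1) := rfl

lemma aa_sh (s : Sq) (k : ℤ) : aa (sh s) k = aa s (k + 1) - aa s 1 := by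
  refine aa_uniq (aa (sh s)) (fun k => aa s (k + 1) - aa s 1) (by simp [aa_zero]) (fun k => ?_) k
  rw [aa_rec, dd_sh]
  have := aa_rec s (k + 1)
  simp only [show k - 1 + 1 = k + 1 - 1 by ring]
  omega

lemma sh_iter (s : Sq) (n : ℕ) (k : ℤ) : (sh^[n] s) k = s (k + n) := by
  induction n generalizing k with
  | zero => simp
  | succ n ih =>
    rw [Function.iterate_succ_apply']
    show (sh^[n] s) (k + 1) = _
    rw [ih]; congr 1; push_cast; ring

lemma dd_iter (s : Sq) (n : ℕ) (k : ℤ) : dd (sh^[n] s) k = dd s (k + n) := by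
  unfold dd; rw [sh_iter]
lemma ll_iter (s : Sq) (n : ℕ) (k : ℤ) : ll (sh^[n] s) k = ll s (k + n) := by
  unfold ll; rw [sh_iter]
lemma aa_iter (s : Sq) (n : ℕ) (k : ℤ) : aa (sh^[n] s) k = aa s (k + n) - aa s n := by
  refine aa_uniq (aa (sh^[n] s)) (fun k => aa s (k + n) - aa s n) (by simp [aa_zero]) (fun k => ?_) k
  rw [aa_rec, dd_iter]
  have := aa_rec s (k + n)
  simp only [show k - 1 + (n : ℤ) = k + n - 1 by ring]
  omega

lemma aa_lt_succ (s : Sq) (k : ℤ) : aa s k < aa s (k + 1) := by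
  rw [aa_succ]
  have := one_le_dd s (k + 1)
  omega

lemma aa_strictMono (s : Sq) : StrictMono (aa s) := strictMono_int_of_lt_succ (aa_lt_succ s)

lemma le_aa (s : Sq) (n : ℕ) : (n : ℤ) ≤ aa s n := by
  induction n with
  | zero => simp [aa_zero]
  | succ n ih => have := aa_lt_succ s n; push_cast; omega

lemma aa_neg_le (s : Sq) (n : ℕ) : aa s (-n) ≤ -n := by
  induction n with
  | zero => simp [aa_zero]
  | succ n ih =>
    have := aa_lt_succ s (-(n + 1))
    rw [show -((n : ℤ) + 1) + 1 = -n by ring] at this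
    push_cast; omega

lemma abs_le_aa (s : Sq) (k : ℤ) : |k| ≤ |aa s k| := by
  rcases le_total 0 k with h | h
  · obtain ⟨n, rfl⟩ := Int.eq_ofNat_of_zero_le h
    exact abs_le_abs (le_aa s n) (by have := le_aa s n; simp; omega)
  · obtain ⟨n, hn⟩ := Int.eq_ofNat_of_zero_le (neg_nonneg.2 h)
    obtain rfl : k = -n := by omega
    have := aa_neg_le s n
    rw [← abs_neg (aa s _), ← abs_neg (-(n : ℤ))]
    exact abs_le_abs (by omega) (by omega)

lemma en_aa (s : Sq) (k : ℤ) : en s (aa s k) = ll s k := by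
  unfold en sparseEnv
  have h : ∃ j, aa s j = aa s k := ⟨k, rfl⟩
  simp only [h, dite_true]
  rw [(aa_strictMono s).injective h.choose_spec]

lemma en_half (s : Sq) {x : ℤ} (h : ∀ k, aa s k ≠ x) : en s x = 1 / 2 := by
  unfold en sparseEnv
  rw [dif_neg]
  push Not; exact h

lemma en_mem (s : Sq) (x : ℤ) : 0 < en s x ∧ en s x < 1 := by
  by_cases h : ∃ k, aa s k = x
  · obtain ⟨k, rfl⟩ := h
    rw [en_aa]; exact ⟨ll_pos s k, ll_lt s k⟩
  · rw [en_half s (by push Not at h; exact h)]; norm_num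

lemma en_gap (s : Sq) {k x : ℤ} (h1 : aa s k < x) (h2 : x < aa s (k + 1)) : en s x = 1 / 2 := by
  apply en_half
  rintro j rfl
  have a := (aa_strictMono s).lt_iff_lt.1 h1
  have b := (aa_strictMono s).lt_iff_lt.1 h2
  omega

lemma en_iter (s : Sq) (n : ℕ) (x : ℤ) : en (sh^[n] s) x = en s (x + aa s n) := by
  by_cases h : ∃ k, aa (sh^[n] s) k = x
  · obtain ⟨k, rfl⟩ := h
    rw [en_aa, aa_iter, sub_add_cancel, en_aa, ll_iter]
  · rw [en_half _ (by push Not at h; exact h), en_half]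
    intro k hk
    apply h
    refine ⟨k - n, ?_⟩
    rw [aa_iter, sub_add_cancel, hk]; ring

/-! measurability -/
lemma meas_sh : Measurable sh := by
  unfold sh
  exact measurable_pi_lambda _ fun n => measurable_pi_apply _

lemma meas_dd (k : ℤ) : Measurable fun s : Sq => dd s k := by
  unfold dd
  exact measurable_const.max (measurable_snd.comp (measurable_pi_apply k))

lemma meas_ll (k : ℤ) : Measurable fun s : Sq => ll s k := by
  unfold ll
  have h : Measurable fun s : Sq => (s k).1 := measurable_fst.comp (measurable_pi_apply k)
  refine Measurable.ite ?_ h measurable_const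
  exact (measurableSet_lt measurable_const h).inter (measurableSet_lt h measurable_const)

lemma meas_aa (k : ℤ) : Measurable fun s : Sq => aa s k := by
  unfold aa
  have h : ∀ i, Measurable fun s : Sq => (dd s i : ℤ) := fun i => measurable_from_top.comp (meas_dd i)
  exact (Finset.measurable_fun_sum _ fun i _ => h i).sub (Finset.measurable_fun_sum _ fun i _ => h i)

lemma en_eq (s : Sq) (x : ℤ) :
    en s x = 1 / 2 + ∑ k ∈ Finset.Icc (-|x|) |x|, if aa s k = x then ll s k - 1 / 2 else 0 := by
  by_cases h : ∃ k, aa s k = x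
  · obtain ⟨k, rfl⟩ := h
    rw [Finset.sum_eq_single k, en_aa, if_pos rfl]
    · ring
    · intro j _ hj
      rw [if_neg]
      exact fun h => hj ((aa_strictMono s).injective h)
    · intro hk
      exfalso; apply hk
      rw [Finset.mem_Icc]; exact abs_le.1 (abs_le_aa s k)
  · push Not at h
    rw [en_half s h, Finset.sum_eq_zero, add_zero]
    intro k _
    rw [if_neg (h k)]

lemma meas_en (x : ℤ) : Measurable fun s : Sq => en s x := by
  simp_rw [en_eq]
  refine measurable_const.add (Finset.measurable_fun_sum _ fun k _ => ?_)
  refine Measurable.ite ?_ ((meas_ll k).sub measurable_const) measurable_const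
  exact (meas_aa k) (measurableSet_singleton x)

/-- walk weights in the environment of `s` -/
def ps (s : Sq) : ℤ → ℝ≥0∞ := pe (en s)
def qs (s : Sq) : ℤ → ℝ≥0∞ := qe (en s)

lemma pq (s : Sq) (x : ℤ) : ps s x + qs s x = 1 := by
  unfold ps qs pe qe
  have := en_mem s x
  rw [← ENNReal.ofReal_add (by linarith) (by linarith)]
  simp

lemma meas_fp (t : ℕ) : ∀ x y, Measurable fun s : Sq => fp (ps s) (qs s) t x y := by
  induction t with
  | zero => intro x y; simp only [fp]; exact measurable_const
  | succ t ih =>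
    intro x y
    simp only [fp]
    split_ifs
    · exact measurable_const
    · exact ((meas_en x).ennreal_ofReal.mul (ih _ _)).add
        ((measurable_const.sub (meas_en x)).ennreal_ofReal.mul (ih _ _))

lemma meas_su (t : ℕ) : ∀ x y, Measurable fun s : Sq => su (ps s) (qs s) t x y := by
  induction t with
  | zero => intro x y; simp only [su]; exact measurable_const
  | succ t ih =>
    intro x y
    simp only [su]
    split_ifs
    · exact measurable_const
    · exact ((meas_en x).ennreal_ofReal.mul (ih _ _)).add
        ((measurable_const.sub (meas_en x)).ennreal_ofReal.mul (ih _ _))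

lemma meas_eval {F : Sq → ℤ → ℝ≥0∞} (hF : ∀ y, Measurable fun s => F s y) {g : Sq → ℤ}
    (hg : Measurable g) : Measurable fun s => F s (g s) := by
  have : Measurable (fun p : Sq × ℤ => F p.1 p.2) := measurable_from_prod_countable_left hF
  exact this.comp (measurable_id.prodMk hg)

/-- passage from `a_0` to `a_1` -/
def Fp (s : Sq) (t : ℕ) : ℝ≥0∞ := fp (ps s) (qs s) t 0 (aa s 1)
def Gs (w : ℝ≥0∞) (s : Sq) : ℝ≥0∞ := gs (ps s) (qs s) w 0 (aa s 1)
def Gf (w : ℝ≥0∞) (s : Sq) : ℝ≥0∞ := gf (ps s) (qs s) w 0 (aa s 1)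
def Mt (s : Sq) : ℝ≥0∞ := mt (ps s) (qs s) 0 (aa s 1)

lemma meas_Fp (t : ℕ) : Measurable fun s => Fp s t :=
  meas_eval (fun y => meas_fp t 0 y) (meas_aa 1)
lemma meas_Gs (w : ℝ≥0∞) : Measurable (Gs w) :=
  Measurable.ennreal_tsum fun t => (meas_eval (fun y => meas_su t 0 y) (meas_aa 1)).mul_const _
lemma meas_Mt : Measurable Mt :=
  Measurable.ennreal_tsum fun t => (meas_eval (fun y => meas_su t 0 y) (meas_aa 1))

lemma fp_shift (p q : ℤ → ℝ≥0∞) (c : ℤ) (t : ℕ) : ∀ x y,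
    fp (fun x => p (x + c)) (fun x => q (x + c)) t x y = fp p q t (x + c) (y + c) := by
  induction t with
  | zero => intro x y; simp [fp]
  | succ t ih =>
    intro x y
    simp only [fp, ih, add_left_inj]
    rw [show x + 1 + c = x + c + 1 by ring, show x - 1 + c = x + c - 1 by ring]

lemma su_shift (p q : ℤ → ℝ≥0∞) (c : ℤ) (t : ℕ) : ∀ x y,
    su (fun x => p (x + c)) (fun x => q (x + c)) t x y = su p q t (x + c) (y + c) := by
  induction t with
  | zero => intro x y; simp [su]
  | succ t ih =>
    intro x y
    simp only [su, ih, add_left_inj]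
    rw [show x + 1 + c = x + c + 1 by ring, show x - 1 + c = x + c - 1 by ring]

lemma ps_iter (s : Sq) (n : ℕ) : ps (sh^[n] s) = fun x => ps s (x + aa s n) := by
  ext x; simp only [ps, pe, en_iter]
lemma qs_iter (s : Sq) (n : ℕ) : qs (sh^[n] s) = fun x => qs s (x + aa s n) := by
  ext x; simp only [qs, qe, en_iter]

lemma aa_iter_one (s : Sq) (n : ℕ) : aa (sh^[n] s) 1 + aa s n = aa s (n + 1) := by
  rw [aa_iter, sub_add_cancel, add_comm]

lemma Fp_iter (s : Sq) (n t : ℕ) : Fp (sh^[n] s) t = fp (ps s) (qs s) t (aa s n) (aa s (n + 1)) := by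
  unfold Fp
  rw [ps_iter, qs_iter, fp_shift, zero_add, aa_iter_one]

lemma Gs_iter (s : Sq) (w : ℝ≥0∞) (n : ℕ) :
    Gs w (sh^[n] s) = gs (ps s) (qs s) w (aa s n) (aa s (n + 1)) := by
  unfold Gs gs
  simp_rw [ps_iter, qs_iter, su_shift, zero_add, aa_iter_one]

lemma Gf_iter (s : Sq) (w : ℝ≥0∞) (n : ℕ) :
    Gf w (sh^[n] s) = gf (ps s) (qs s) w (aa s n) (aa s (n + 1)) := by
  unfold Gf gf
  simp_rw [ps_iter, qs_iter, fp_shift, zero_add, aa_iter_one]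

lemma gf_prod (s : Sq) (w : ℝ≥0∞) (n : ℕ) :
    gf (ps s) (qs s) w 0 (aa s n) = ∏ k ∈ Finset.range n, Gf w (sh^[k] s) := by
  induction n with
  | zero =>
    simp only [Nat.cast_zero, aa_zero, Finset.range_zero, Finset.prod_empty]
    unfold gf
    rw [tsum_eq_single 0]
    · simp [fp]
    · intro t ht
      obtain ⟨m, rfl⟩ := Nat.exists_eq_succ_of_ne_zero ht
      simp [fp]
  | succ n ih =>
    rw [Finset.prod_range_succ, ← ih, Gf_iter, ← gf_mul]
    · simp
    · have := le_aa s n; omega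
    · exact (aa_lt_succ s n).le
end SRE


namespace SRE

def xi (s : Sq) (k : ℤ) : ℝ := (1 - ll s k) / ll s k
def xe (s : Sq) (k : ℤ) : ℝ≥0∞ := ENNReal.ofReal (xi s k)
def rho (s : Sq) (x : ℤ) : ℝ≥0∞ := ENNReal.ofReal ((1 - en s x) / en s x)

lemma xi_pos (s : Sq) (k : ℤ) : 0 < xi s k :=
  div_pos (by linarith [ll_lt s k]) (ll_pos s k)

lemma meas_xi (k : ℤ) : Measurable fun s => xi s k :=
  (measurable_const.sub (meas_ll k)).div (meas_ll k)
lemma meas_xe (k : ℤ) : Measurable fun s => xe s k := (meas_xi k).ennreal_ofReal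

lemma ps_rho (s : Sq) (x : ℤ) : ps s x * rho s x = qs s x := by
  unfold ps qs pe qe rho
  have h := (en_mem s x).1
  rw [← ENNReal.ofReal_mul h.le, mul_div_cancel₀ _ h.ne']

lemma ps_ne (s : Sq) (x : ℤ) : ps s x ≠ 0 := by
  unfold ps pe
  simpa using (en_mem s x).1

lemma rho_aa (s : Sq) (k : ℤ) : rho s (aa s k) = xe s k := by
  unfold rho xe xi; rw [en_aa]

lemma rho_gap (s : Sq) {k x : ℤ} (h1 : aa s k < x) (h2 : x < aa s (k + 1)) : rho s x = 1 := by
  unfold rho; rw [en_gap s h1 h2]; norm_num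

def rt (s : Sq) (k : ℤ) (j : ℕ) : ℝ≥0∞ :=
  2 * (∏ i ∈ Finset.range (j + 1), xe s (k - i)) * dd s (k - j)

def Rr (s : Sq) (k : ℤ) : ℝ≥0∞ := ∑' j : ℕ, rt s k j

lemma rt_zero (s : Sq) (k : ℤ) : rt s k 0 = xe s k * (2 * dd s k) := by
  simp [rt]; ring

lemma rt_succ (s : Sq) (k : ℤ) (j : ℕ) : rt s k (j + 1) = xe s k * rt s (k - 1) j := by
  unfold rt
  rw [Finset.prod_range_succ']
  have : ∀ i : ℕ, k - ((i + 1 : ℕ) : ℤ) = k - 1 - i := fun i => by push_cast; ring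
  simp_rw [this]
  simp only [Nat.cast_zero, sub_zero]
  ring

lemma Rr_rec (s : Sq) (k : ℤ) : Rr s k = xe s k * (2 * dd s k + Rr s (k - 1)) := by
  unfold Rr
  rw [tsum_eq_zero_add' ENNReal.summable, rt_zero, mul_add, ← ENNReal.tsum_mul_left]
  simp_rw [rt_succ]

lemma aa_pred (s : Sq) (k : ℤ) : aa s k - 1 = aa s (k - 1) + ((dd s k - 1 : ℕ) : ℤ) := by
  have := aa_rec s k
  have h1 := one_le_dd s k
  push_cast [h1]; omega

lemma two_dd (s : Sq) (k : ℤ) : (2 : ℝ≥0∞) * ((dd s k - 1 : ℕ) : ℝ≥0∞) + 2 = 2 * dd s k := by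
  have h1 := one_le_dd s k
  have : 2 * (dd s k - 1) + 2 = 2 * dd s k := by omega
  exact_mod_cast this

lemma cand_le (s : Sq) (N : ℕ) : ∀ (k : ℤ) (i : ℕ), i < dd s (k + 1) →
    cand (rho s) N (aa s k + i) ≤ 1 + Rr s k + 2 * i := by
  induction N with
  | zero => intro k i _; simp [cand]
  | succ N ih =>
    intro k i hi
    cases i with
    | zero =>
      simp only [Nat.cast_zero, add_zero, mul_zero, cand]
      rw [rho_aa, aa_pred, Rr_rec s k]
      have h := ih (k - 1) (dd s k - 1) (by
        rw [sub_add_cancel]; have := one_le_dd s k; omega)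
      calc 1 + xe s k + xe s k * cand (rho s) N (aa s (k - 1) + ((dd s k - 1 : ℕ) : ℤ))
          ≤ 1 + xe s k + xe s k * (1 + Rr s (k - 1) + 2 * ((dd s k - 1 : ℕ) : ℝ≥0∞)) := by gcongr
        _ = 1 + xe s k * ((2 * ((dd s k - 1 : ℕ) : ℝ≥0∞) + 2) + Rr s (k - 1)) := by ring
        _ = _ := by rw [two_dd]
    | succ i =>
      simp only [cand]
      have h := ih k i (by omega)
      have e := aa_succ s k
      rw [rho_gap s (k := k) (by push_cast; omega) (by push_cast; omega),
        show aa s k + ((i + 1 : ℕ) : ℤ) - 1 = aa s k + i by push_cast; ring]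
      calc (1 : ℝ≥0∞) + 1 + 1 * cand (rho s) N (aa s k + i)
          ≤ 1 + 1 + 1 * (1 + Rr s k + 2 * i) := by gcongr
        _ = 1 + Rr s k + 2 * ((i + 1 : ℕ) : ℝ≥0∞) := by push_cast; ring

section
variable {s : Sq}

abbrev m1 (s : Sq) (x : ℤ) : ℝ≥0∞ := mt (ps s) (qs s) x (x + 1)

lemma m1_le (s : Sq) (k : ℤ) (i : ℕ) (hi : i < dd s (k + 1)) :
    m1 s (aa s k + i) ≤ 1 + Rr s k + 2 * i :=
  mt_one_le (pq s) (ps_rho s) _ fun N => cand_le s N k i hi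

lemma m1_ne_top (hR : ∀ k, Rr s k ≠ ⊤) (k : ℤ) (i : ℕ) (hi : i < dd s (k + 1)) :
    m1 s (aa s k + i) ≠ ⊤ := by
  refine ne_top_of_le_ne_top ?_ (m1_le s k i hi)
  have := hR k
  finiteness

lemma m1_gap (hR : ∀ k, Rr s k ≠ ⊤) (k : ℤ) (i : ℕ) (hi : i < dd s (k + 1)) :
    m1 s (aa s k + i) = m1 s (aa s k) + 2 * i := by
  induction i with
  | zero => simp
  | succ i ih =>
    have e := aa_succ s k
    have e1 : aa s k + ((i + 1 : ℕ) : ℤ) - 1 = aa s k + i := by push_cast; ring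
    have h2 := m1_ne_top hR k i (by omega)
    unfold m1 at h2 ih ⊢
    have e2 : aa s k + (i : ℤ) + 1 = aa s k + ((i + 1 : ℕ) : ℤ) := by push_cast; ring
    rw [e2] at h2 ih
    rw [mt_one_rec (pq s) (ps_rho s) (ps_ne s) _ (m1_ne_top hR k (i + 1) hi) (by rw [e1]; exact h2),
      e1, ih (by omega), rho_gap s (k := k) (by push_cast; omega) (by push_cast; omega)]
    push_cast; ring

lemma m1_rec (hR : ∀ k, Rr s k ≠ ⊤) (k : ℤ) :
    1 + m1 s (aa s k) = 2 + xe s k * (2 * dd s k - 1 + m1 s (aa s (k - 1))) := by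
  have hd := one_le_dd s k
  have hlt : dd s k - 1 < dd s (k - 1 + 1) := by rw [sub_add_cancel]; omega
  have h1 := m1_ne_top hR k 0 (one_le_dd s _)
  have h2 := m1_ne_top hR (k - 1) (dd s k - 1) hlt
  have h3 := m1_gap hR (k - 1) (dd s k - 1) hlt
  rw [← aa_pred] at h2 h3
  simp only [Nat.cast_zero, add_zero] at h1
  unfold m1 at *
  rw [sub_add_cancel] at h2 h3
  rw [mt_one_rec (pq s) (ps_rho s) (ps_ne s) _ h1 h2, h3, rho_aa]
  have : (2 : ℝ≥0∞) * dd s k - 1 = 1 + 2 * ((dd s k - 1 : ℕ) : ℝ≥0∞) := by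
    rw [← two_dd]
    rw [show (2 : ℝ≥0∞) * ((dd s k - 1 : ℕ) : ℝ≥0∞) + 2 = 1 + 2 * ((dd s k - 1 : ℕ) : ℝ≥0∞) + 1 by
      rw [← one_add_one_eq_two]; ring]
    exact ENNReal.add_sub_cancel_right (by simp)
  rw [this]
  ring

lemma le_m1 (hR : ∀ k, Rr s k ≠ ⊤) (n : ℕ) : ∀ k,
    1 + ∑ j ∈ Finset.range n, rt s k j ≤ m1 s (aa s k) := by
  have hm : ∀ k, m1 s (aa s k) = 1 + xe s k * (2 * dd s k - 1 + m1 s (aa s (k - 1))) := by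
    intro k
    have := m1_rec hR k
    rw [show (2 : ℝ≥0∞) = 1 + 1 by norm_num, add_assoc] at this
    rw [← one_add_one_eq_two]
    exact (ENNReal.add_right_inj (by simp)).1 this
  induction n with
  | zero => intro k; rw [hm k]; simp
  | succ n ih =>
    intro k
    rw [hm k, Finset.sum_range_succ', rt_zero]
    simp_rw [rt_succ]
    rw [← Finset.mul_sum, ← mul_add]
    refine add_le_add_right (mul_le_mul_right ?_ (xe s k)) 1
    calc ∑ j ∈ Finset.range n, rt s (k - 1) j + 2 * (dd s k : ℝ≥0∞)
        = ∑ j ∈ Finset.range n, rt s (k - 1) j + (2 * (dd s k : ℝ≥0∞) - 1 + 1) := by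
          rw [tsub_add_cancel_of_le]
          have := one_le_dd s k
          have h : 1 ≤ 2 * dd s k := by omega
          exact_mod_cast h
      _ = 2 * (dd s k : ℝ≥0∞) - 1 + (1 + ∑ j ∈ Finset.range n, rt s (k - 1) j) := by ring
      _ ≤ _ := add_le_add_right (ih (k - 1)) _

lemma m1_eq (hR : ∀ k, Rr s k ≠ ⊤) (k : ℤ) : m1 s (aa s k) = 1 + Rr s k := by
  apply le_antisymm
  · simpa using m1_le s k 0 (one_le_dd s _)
  · unfold Rr
    rw [ENNReal.tsum_eq_iSup_nat, ENNReal.add_iSup]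
    exact iSup_le fun n => le_m1 hR n k

lemma mt_gap (hR : ∀ k, Rr s k ≠ ⊤) (k : ℤ) (j : ℕ) (hj : j ≤ dd s (k + 1)) :
    mt (ps s) (qs s) (aa s k) (aa s k + j) = j * (j + Rr s k) := by
  induction j with
  | zero => simp [mt_self]
  | succ j ih =>
    have h := ih (by omega)
    have hfin : mt (ps s) (qs s) (aa s k) (aa s k + j) ≠ ⊤ := by
      rw [h]; have := hR k; finiteness
    rw [mt_add (pq s) (y := aa s k + j) (by omega) (by push_cast; omega) hfin, h]
    have h2 := m1_gap hR k j (by omega)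
    rw [m1_eq hR] at h2
    unfold m1 at h2
    rw [show aa s k + ((j + 1 : ℕ) : ℤ) = aa s k + j + 1 by push_cast; ring, h2]
    push_cast; ring

lemma Mt_eq (hR : ∀ k, Rr s k ≠ ⊤) : Mt s = dd s 1 * (dd s 1 + Rr s 0) := by
  have := mt_gap hR 0 (dd s 1) le_rfl
  rw [aa_zero, zero_add] at this
  unfold Mt
  rw [show aa s 1 = dd s 1 by have := aa_succ s 0; rw [aa_zero] at this; simpa using this]
  exact this
end

lemma meas_Rr (k : ℤ) : Measurable fun s => Rr s k := by
  unfold Rr rt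
  refine Measurable.tsum fun j => ?_
  refine (measurable_const.mul (Finset.measurable_fun_prod _ fun i _ => meas_xe _)).mul ?_
  exact measurable_from_top.comp (meas_dd _)
end SRE


namespace SRE

structure Good (Q : Measure Sq) (μ b : ℝ) : Prop where
  prob : IsProbabilityMeasure Q
  erg : Ergodic sh Q
  dmean : ∫⁻ s, (dd s 0 : ℝ≥0∞) ∂Q = ENNReal.ofReal μ
  lint : Integrable (fun s => Real.log (xi s 0)) Q
  lmean : ∫ s, Real.log (xi s 0) ∂Q = b
  ind : IndepFun (fun s k => dd s k) (fun s k => ll s k) Q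
  mpos : 0 < μ
  bneg : b < 0

def she : Sq ≃ᵐ Sq where
  toFun := sh
  invFun := fun s n => s (n - 1)
  left_inv := fun s => by ext n <;> simp [sh]
  right_inv := fun s => by ext n <;> simp [sh]
  measurable_toFun := meas_sh
  measurable_invFun := measurable_pi_lambda _ fun n => measurable_pi_apply _

lemma shm_iter (s : Sq) (n : ℕ) (k : ℤ) : (she.symm^[n] s) k = s (k - n) := by
  induction n generalizing k with
  | zero => simp
  | succ n ih =>
    rw [Function.iterate_succ_apply']
    show (she.symm^[n] s) (k - 1) = _
    rw [ih]; congr 1; push_cast; ring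

lemma dd_shm (s : Sq) (n : ℕ) (k : ℤ) : dd (she.symm^[n] s) k = dd s (k - n) := by
  unfold dd; rw [shm_iter]
lemma xi_shm (s : Sq) (n : ℕ) (k : ℤ) : xi (she.symm^[n] s) k = xi s (k - n) := by
  unfold xi ll; rw [shm_iter]
lemma xi_iter (s : Sq) (n : ℕ) (k : ℤ) : xi (sh^[n] s) k = xi s (k + n) := by
  unfold xi ll; rw [sh_iter]
lemma xi_sh (s : Sq) (k : ℤ) : xi (sh s) k = xi s (k + 1) := rfl
lemma xe_sh (s : Sq) (k : ℤ) : xe (sh s) k = xe s (k + 1) := rfl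

section
variable {Q : Measure Sq} {μ b : ℝ}

lemma Good.mp (h : Good Q μ b) : MeasurePreserving sh Q Q := h.erg.toMeasurePreserving

lemma Good.ergm (h : Good Q μ b) : Ergodic she.symm Q := Ergodic.symm (e := she) h.erg

lemma meas_ddr (k : ℤ) : Measurable fun s : Sq => (dd s k : ℝ) := measurable_from_top.comp (meas_dd k)
lemma meas_dde (k : ℤ) : Measurable fun s : Sq => (dd s k : ℝ≥0∞) :=
  measurable_from_top.comp (meas_dd k)

lemma Good.dmean' (h : Good Q μ b) (k : ℤ) : ∫⁻ s, (dd s k : ℝ≥0∞) ∂Q = ENNReal.ofReal μ := by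
  have hs : ∀ k : ℤ, ∫⁻ s, (dd s (k + 1) : ℝ≥0∞) ∂Q = ∫⁻ s, (dd s k : ℝ≥0∞) ∂Q := fun k =>
    h.mp.lintegral_comp (meas_dde k)
  induction k using Int.induction_on with
  | zero => exact h.dmean
  | succ i ih => rw [hs, ih]
  | pred i ih => rw [← ih, ← hs (-i - 1)]; simp

lemma Good.dint (h : Good Q μ b) (k : ℤ) : Integrable (fun s => (dd s k : ℝ)) Q := by
  refine ⟨(meas_ddr k).aestronglyMeasurable, ?_⟩
  unfold HasFiniteIntegral
  have : ∀ s : Sq, ‖(dd s k : ℝ)‖ₑ = (dd s k : ℝ≥0∞) := fun s => by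
    rw [Real.enorm_eq_ofReal (by positivity)]; simp
  simp_rw [this, h.dmean' k]
  simp

lemma Good.dmeanr (h : Good Q μ b) (k : ℤ) : ∫ s, (dd s k : ℝ) ∂Q = μ := by
  rw [integral_eq_lintegral_of_nonneg_ae (ae_of_all _ fun s => by positivity)
    (meas_ddr k).aestronglyMeasurable]
  have : ∀ s : Sq, ENNReal.ofReal (dd s k : ℝ) = (dd s k : ℝ≥0∞) := fun s => by simp
  simp_rw [this, h.dmean' k]
  exact ENNReal.toReal_ofReal h.mpos.le

lemma aa_birk (s : Sq) (n : ℕ) : birkhoffSum sh (fun s => (dd s 1 : ℝ)) n s = aa s n := by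
  induction n with
  | zero => simp [aa_zero, birkhoffSum]
  | succ n ih =>
    rw [birkhoffSum_succ, ih, dd_iter]
    push_cast
    rw [aa_succ]; push_cast; rw [add_comm 1 (n : ℤ)]

lemma Good.aa_lim (h : Good Q μ b) :
    ∀ᵐ s ∂Q, Tendsto (fun n : ℕ => (aa s n : ℝ) / n) atTop (𝓝 μ) := by
  have := h.prob
  have := birkhoff_ergodic h.erg (meas_ddr 1) (h.dint 1)
  rw [h.dmeanr] at this
  simpa only [aa_birk] using this

lemma aam_birk (s : Sq) (n : ℕ) :
    birkhoffSum she.symm (fun s => (dd s 0 : ℝ)) n s = -aa s (-n) := by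
  induction n with
  | zero => simp [aa_zero, birkhoffSum]
  | succ n ih =>
    rw [birkhoffSum_succ, ih, dd_shm]
    have := aa_rec s (-n)
    have h2 : (aa s (-n) : ℝ) - aa s (-n - 1) = dd s (-n) := by exact_mod_cast this
    push_cast
    rw [show (0 : ℤ) - n = -n by ring, ← h2, show -((n : ℤ) + 1) = -n - 1 by ring]; ring
  
lemma Good.aam_lim (h : Good Q μ b) :
    ∀ᵐ s ∂Q, Tendsto (fun n : ℕ => -(aa s (-n) : ℝ) / n) atTop (𝓝 μ) := by
  have := h.prob
  have := birkhoff_ergodic h.ergm (meas_ddr 0) (h.dint 0)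
  rw [h.dmeanr] at this
  simpa only [aam_birk] using this

lemma xi_birk (s : Sq) (n : ℕ) : birkhoffSum she.symm (fun s => Real.log (xi s 0)) n s
    = ∑ i ∈ Finset.range n, Real.log (xi s (-i)) := by
  unfold birkhoffSum
  simp_rw [xi_shm, zero_sub]

lemma Good.xi_lim (h : Good Q μ b) :
    ∀ᵐ s ∂Q, Tendsto (fun n : ℕ => (∑ i ∈ Finset.range n, Real.log (xi s (-i))) / n) atTop (𝓝 b) := by
  have := h.prob
  have := birkhoff_ergodic h.ergm ((meas_xi 0).log) h.lint
  rw [h.lmean] at this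
  simpa only [xi_birk] using this

/-- exponential decay of the products of `ξ` to the left -/
lemma Good.xi_prod (h : Good Q μ b) :
    ∀ᵐ s ∂Q, ∀ᶠ n : ℕ in atTop, ∏ i ∈ Finset.range n, xi s (-i) ≤ Real.exp (b / 2) ^ n := by
  filter_upwards [h.xi_lim] with s hs
  have hb : b < b / 2 := by linarith [h.bneg]
  filter_upwards [hs.eventually_lt_const hb, eventually_gt_atTop 0] with n hn hn0
  have hn0' : (0 : ℝ) < n := by exact_mod_cast hn0
  rw [div_lt_iff₀ hn0'] at hn
  rw [← Real.log_prod (fun i _ => (xi_pos s _).ne')] at hn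
  rw [← Real.exp_nat_mul, mul_comm (n : ℝ)]
  rw [← Real.exp_log (Finset.prod_pos fun i _ => xi_pos s (-(i : ℕ)))]
  exact Real.exp_le_exp.2 hn.le

lemma dd_le_aa (s : Sq) (j : ℕ) : (dd s (-j) : ℝ) ≤ -(aa s (-((j + 1 : ℕ) : ℤ)) : ℝ) := by
  have h1 := aa_rec s (-j)
  have h2 := aa_neg_le s j
  have : (dd s (-j) : ℤ) ≤ -aa s (-((j + 1 : ℕ) : ℤ)) := by
    push_cast
    rw [show -((j : ℤ) + 1) = -j - 1 by ring]; omega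
  exact_mod_cast this

lemma Good.Rr_zero (h : Good Q μ b) : ∀ᵐ s ∂Q, Rr s 0 ≠ ⊤ := by
  filter_upwards [h.xi_prod, h.aam_lim] with s h1 h2
  set r := Real.exp (b / 2) with hr
  have hr1 : r < 1 := by rw [hr, Real.exp_lt_one_iff]; linarith [h.bneg]
  have hr0 : 0 < r := Real.exp_pos _
  have hterm : ∀ j, rt s 0 j
      = ENNReal.ofReal (2 * (∏ i ∈ Finset.range (j + 1), xi s (-i)) * dd s (-j)) := by
    intro j
    unfold rt xe
    rw [ENNReal.ofReal_mul (by have := Finset.prod_nonneg (s := Finset.range (j + 1)) (f := fun i : ℕ => xi s (-i)) (fun i _ => (xi_pos s _).le); positivity), ENNReal.ofReal_mul (by norm_num),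
      ENNReal.ofReal_prod_of_nonneg (fun i _ => (xi_pos s _).le)]
    simp
  have hsum : Summable fun j : ℕ => 2 * (∏ i ∈ Finset.range (j + 1), xi s (-i)) * (dd s (-j) : ℝ) := by
    have hg : Summable fun j : ℕ => 2 * (μ + 1) * (((j + 1 : ℕ) : ℝ) ^ 1 * r ^ (j + 1)) := by
      refine Summable.mul_left _ ?_
      refine (summable_nat_add_iff (f := fun n : ℕ => (n : ℝ) ^ 1 * r ^ n) 1).2 ?_
      exact summable_pow_mul_geometric_of_norm_lt_one 1 (by rw [Real.norm_of_nonneg hr0.le]; exact hr1)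
    refine Summable.of_norm_bounded_eventually_nat hg ?_
    have h1' := (tendsto_add_atTop_nat 1).eventually h1
    have h2' := (tendsto_add_atTop_nat 1).eventually (h2.eventually_lt_const (lt_add_one μ))
    filter_upwards [h1', h2'] with j e1 e2
    have hp := Finset.prod_nonneg (s := Finset.range (j + 1)) (f := fun i : ℕ => xi s (-i)) (fun i _ => (xi_pos s _).le)
    rw [div_lt_iff₀ (by positivity)] at e2
    have e3 := dd_le_aa s j
    rw [Real.norm_of_nonneg (by positivity)]
    calc 2 * (∏ i ∈ Finset.range (j + 1), xi s (-i)) * (dd s (-j) : ℝ)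
        ≤ 2 * r ^ (j + 1) * ((μ + 1) * ((j + 1 : ℕ) : ℝ)) := by
          gcongr
          exact e3.trans e2.le
      _ = _ := by ring
  unfold Rr
  simp_rw [hterm]
  rw [← ENNReal.ofReal_tsum_of_nonneg _ hsum]
  · exact ENNReal.ofReal_ne_top
  · intro j
    have hp := Finset.prod_nonneg (s := Finset.range (j + 1)) (f := fun i : ℕ => xi s (-i)) (fun i _ => (xi_pos s _).le)
    positivity

lemma Rr_all {s : Sq} (h : Rr s 0 ≠ ⊤) (k : ℤ) : Rr s k ≠ ⊤ := by
  have hx : ∀ k, xe s k ≠ 0 := fun k => by unfold xe; simpa using xi_pos s k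
  have hxt : ∀ k, xe s k ≠ ⊤ := fun k => ENNReal.ofReal_ne_top
  induction k using Int.induction_on with
  | zero => exact h
  | succ i ih =>
    rw [Rr_rec, add_sub_cancel_right]
    have := hxt (i + 1)
    finiteness
  | pred i ih =>
    intro hc
    apply ih
    rw [Rr_rec, hc]
    simp [ENNReal.mul_top, hx]

lemma Good.Mt_ae (h : Good Q μ b) : ∀ᵐ s ∂Q, Mt s = dd s 1 * (dd s 1 + Rr s 0) ∧ Mt s ≠ ⊤ := by
  filter_upwards [h.Rr_zero] with s hs
  have e := Mt_eq (Rr_all hs)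
  exact ⟨e, by rw [e]; finiteness⟩
end
end SRE


namespace SRE

section jensen
variable {α : Type*} [MeasurableSpace α] {Q : Measure α} [IsProbabilityMeasure Q] {X : α → ℝ} {c : ℝ}

lemma exp_tangent (x c : ℝ) : Real.exp c * (1 + x - c) ≤ Real.exp x := by
  have h := Real.add_one_le_exp (x - c)
  have e : Real.exp x = Real.exp c * Real.exp (x - c) := by rw [← Real.exp_add]; ring_nf
  rw [e]
  exact mul_le_mul_of_nonneg_left (by linarith) (Real.exp_pos c).le

lemma exp_tangent_eq {x c : ℝ} (h : Real.exp x = Real.exp c * (1 + x - c)) : x = c := by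
  by_contra hne
  have h1 := Real.add_one_lt_exp (sub_ne_zero.2 hne)
  have e : Real.exp x = Real.exp c * Real.exp (x - c) := by rw [← Real.exp_add]; ring_nf
  rw [e] at h
  have := mul_left_cancel₀ (Real.exp_pos c).ne' h
  linarith

lemma int_tangent (hX : Integrable X Q) (hc : ∫ x, X x ∂Q = c) :
    Integrable (fun x => Real.exp c * (1 + X x - c)) Q ∧
      ∫ x, Real.exp c * (1 + X x - c) ∂Q = Real.exp c := by
  have hi : Integrable (fun x => 1 + X x - c) Q := ((integrable_const 1).add hX).sub (integrable_const c)
  refine ⟨hi.const_mul _, ?_⟩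
  have hi' : Integrable (fun x => 1 + X x) Q := (integrable_const 1).add hX
  rw [integral_const_mul, integral_sub hi' (integrable_const c),
    integral_add (integrable_const 1) hX, hc]
  simp

lemma exp_integrable (hXm : Measurable X) (hfin : ∫⁻ x, ENNReal.ofReal (Real.exp (X x)) ∂Q ≠ ⊤) :
    Integrable (fun x => Real.exp (X x)) Q := by
  refine ⟨hXm.exp.aestronglyMeasurable, ?_⟩
  unfold HasFiniteIntegral
  simp_rw [Real.enorm_eq_ofReal (Real.exp_pos _).le]
  exact lt_top_iff_ne_top.2 hfin

lemma jensen_le (hXm : Measurable X) (hX : Integrable X Q) (hc : ∫ x, X x ∂Q = c) :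
    ENNReal.ofReal (Real.exp c) ≤ ∫⁻ x, ENNReal.ofReal (Real.exp (X x)) ∂Q := by
  by_cases hfin : ∫⁻ x, ENNReal.ofReal (Real.exp (X x)) ∂Q = ⊤
  · rw [hfin]; exact le_top
  have hi := exp_integrable hXm hfin
  rw [← ofReal_integral_eq_lintegral_ofReal hi (ae_of_all _ fun x => (Real.exp_pos _).le)]
  apply ENNReal.ofReal_le_ofReal
  obtain ⟨h1, h2⟩ := int_tangent hX hc
  rw [← h2]
  exact integral_mono h1 hi fun x => exp_tangent (X x) c

lemma jensen_eq (hXm : Measurable X) (hX : Integrable X Q) (hc : ∫ x, X x ∂Q = c)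
    (he : ∫⁻ x, ENNReal.ofReal (Real.exp (X x)) ∂Q = ENNReal.ofReal (Real.exp c)) :
    ∀ᵐ x ∂Q, X x = c := by
  have hi := exp_integrable hXm (by rw [he]; simp)
  rw [← ofReal_integral_eq_lintegral_ofReal hi (ae_of_all _ fun x => (Real.exp_pos _).le)] at he
  rw [ENNReal.ofReal_eq_ofReal_iff (integral_nonneg fun x => (Real.exp_pos _).le)
    (Real.exp_pos c).le] at he
  obtain ⟨h1, h2⟩ := int_tangent hX hc
  have h3 : ∫ x, (Real.exp (X x) - Real.exp c * (1 + X x - c)) ∂Q = 0 := by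
    rw [integral_sub hi h1, he, h2, sub_self]
  rw [integral_eq_zero_iff_of_nonneg (fun x => sub_nonneg.2 (exp_tangent _ _)) (hi.sub h1)] at h3
  filter_upwards [h3] with x hx
  exact exp_tangent_eq (sub_eq_zero.1 hx)
end jensen

section
variable {Q : Measure Sq} {μ b : ℝ}

lemma Good.lint' (h : Good Q μ b) (k : ℤ) : Integrable (fun s => Real.log (xi s k)) Q ∧
    ∫ s, Real.log (xi s k) ∂Q = b := by
  have hs : ∀ k : ℤ, (Integrable (fun s => Real.log (xi s (k + 1))) Q ↔
      Integrable (fun s => Real.log (xi s k)) Q) ∧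
      ∫ s, Real.log (xi s (k + 1)) ∂Q = ∫ s, Real.log (xi s k) ∂Q := by
    intro k
    have hm : MeasurePreserving she Q Q := h.mp
    refine ⟨?_, ?_⟩
    · exact hm.integrable_comp_emb she.measurableEmbedding (g := fun s => Real.log (xi s k))
    · exact hm.integral_comp she.measurableEmbedding (fun s => Real.log (xi s k))
  induction k using Int.induction_on with
  | zero => exact ⟨h.lint, h.lmean⟩
  | succ i ih => exact ⟨(hs i).1.2 ih.1, (hs i).2.trans ih.2⟩
  | pred i ih =>
    have := hs (-i - 1)
    rw [sub_add_cancel] at this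
    exact ⟨this.1.1 ih.1, this.2.symm.trans ih.2⟩

def ej (Q : Measure Sq) (j : ℕ) : ℝ≥0∞ := ∫⁻ s, ∏ i ∈ Finset.range (j + 1), xe s (-i) ∂Q

lemma prod_xe_eq (s : Sq) (n : ℕ) : ∏ i ∈ Finset.range n, xe s (-i)
    = ENNReal.ofReal (Real.exp (∑ i ∈ Finset.range n, Real.log (xi s (-i)))) := by
  rw [Real.exp_sum, ENNReal.ofReal_prod_of_nonneg (fun i _ => (Real.exp_pos _).le)]
  refine Finset.prod_congr rfl fun i _ => ?_
  rw [Real.exp_log (xi_pos _ _)]; rfl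

lemma Good.ej_ge (h : Good Q μ b) (j : ℕ) : ENNReal.ofReal (Real.exp b) ^ (j + 1) ≤ ej Q j := by
  have := h.prob
  unfold ej
  simp_rw [prod_xe_eq]
  rw [← ENNReal.ofReal_pow (Real.exp_pos b).le, ← Real.exp_nat_mul]
  refine jensen_le (Finset.measurable_fun_sum _ fun i _ => (meas_xi _).log)
    (integrable_finsetSum _ fun i _ => (h.lint' _).1) ?_
  rw [integral_finsetSum _ fun i _ => (h.lint' _).1]
  simp [(h.lint' _).2]

lemma Good.ej_zero (h : Good Q μ b) (he : ej Q 0 = ENNReal.ofReal (Real.exp b)) :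
    ∀ᵐ s ∂Q, Real.log (xi s 0) = b := by
  have := h.prob
  refine jensen_eq (meas_xi 0).log h.lint h.lmean ?_
  rw [← he]
  unfold ej
  simp_rw [prod_xe_eq]
  simp

/-- correlations of the gaps -/
def cj (Q : Measure Sq) (j : ℕ) : ℝ≥0∞ := ∫⁻ s, (dd s 1 : ℝ≥0∞) * dd s (-j) ∂Q
def d2 (Q : Measure Sq) : ℝ≥0∞ := ∫⁻ s, (dd s 1 : ℝ≥0∞) ^ 2 ∂Q
def EM (Q : Measure Sq) : ℝ≥0∞ := ∫⁻ s, Mt s ∂Q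

lemma Good.indep_j (h : Good Q μ b) (j : ℕ) :
    ∫⁻ s, ((dd s 1 : ℝ≥0∞) * dd s (-j)) * ∏ i ∈ Finset.range (j + 1), xe s (-i) ∂Q
      = cj Q j * ej Q j := by
  have h1 : Measurable fun f : ℤ → ℕ => ((f 1 : ℝ≥0∞) * f (-j)) := by
    have hk : ∀ k : ℤ, Measurable fun f : ℤ → ℕ => (f k : ℝ≥0∞) := fun k =>
      measurable_from_top.comp (measurable_pi_apply k)
    exact (hk 1).mul (hk _)
  have h2 : Measurable fun l : ℤ → ℝ => ∏ i ∈ Finset.range (j + 1),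
      ENNReal.ofReal ((1 - l (-i)) / l (-i)) := by
    refine Finset.measurable_fun_prod _ fun i _ => Measurable.ennreal_ofReal ?_
    exact (measurable_const.sub (measurable_pi_apply _)).div (measurable_pi_apply _)
  have hi := h.ind.comp h1 h2
  exact lintegral_mul_eq_lintegral_mul_lintegral_of_indepFun
    ((meas_dde 1).mul (meas_dde _)) (Finset.measurable_fun_prod _ fun i _ => meas_xe _) hi

lemma Good.EM_eq (h : Good Q μ b) : EM Q = d2 Q + ∑' j : ℕ, 2 * (cj Q j * ej Q j) := by
  have e1 : EM Q = ∫⁻ s, ((dd s 1 : ℝ≥0∞) ^ 2 + ∑' j : ℕ, 2 * (((dd s 1 : ℝ≥0∞) * dd s (-j)) *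
      ∏ i ∈ Finset.range (j + 1), xe s (-i))) ∂Q := by
    unfold EM
    apply lintegral_congr_ae
    filter_upwards [h.Mt_ae] with s hs
    rw [hs.1, mul_add, ← sq]
    congr 1
    unfold Rr rt
    rw [← ENNReal.tsum_mul_left]
    refine tsum_congr fun j => ?_
    simp only [zero_sub]
    ring
  rw [e1, lintegral_add_left ((meas_dde 1).pow_const 2), lintegral_tsum]
  · unfold d2
    congr 1
    refine tsum_congr fun j => ?_
    rw [lintegral_const_mul' _ _ (by simp), h.indep_j]
  · intro j
    exact (measurable_const.mul (((meas_dde 1).mul (meas_dde _)).mul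
      (Finset.measurable_fun_prod _ fun i _ => meas_xe _))).aemeasurable

def Dd (Q : Measure Sq) (r : ℝ≥0∞) : ℝ≥0∞ := d2 Q + ∑' j : ℕ, 2 * (cj Q j * r ^ (j + 1))
def Yy (r : ℝ≥0∞) (s : Sq) : ℝ≥0∞ := ∑' j : ℕ, r ^ j * dd s (-j)

lemma meas_Yy (r : ℝ≥0∞) : Measurable (Yy r) :=
  Measurable.tsum fun j => measurable_const.mul (meas_dde _)

lemma Yy_sh (r : ℝ≥0∞) (s : Sq) : Yy r (sh s) = dd s 1 + r * Yy r s := by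
  unfold Yy
  rw [tsum_eq_zero_add' ENNReal.summable, ← ENNReal.tsum_mul_left]
  congr 1
  · simp [dd_sh]
  · refine tsum_congr fun j => ?_
    rw [dd_sh, show -((j + 1 : ℕ) : ℤ) + 1 = -j by push_cast; ring]; ring

lemma Good.Dd_le (h : Good Q μ b) : Dd Q (ENNReal.ofReal (Real.exp b)) ≤ EM Q := by
  rw [h.EM_eq]
  unfold Dd
  gcongr
  exact h.ej_ge _

lemma Dd_eq (Q : Measure Sq) (r : ℝ≥0∞) :
    Dd Q r = ∫⁻ s, ((dd s 1 : ℝ≥0∞) ^ 2 + 2 * r * dd s 1 * Yy r s) ∂Q := by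
  rw [lintegral_add_left ((meas_dde 1).pow_const 2)]
  unfold Dd d2
  congr 1
  unfold Yy
  simp_rw [← ENNReal.tsum_mul_left]
  rw [lintegral_tsum]
  · refine tsum_congr fun j => ?_
    unfold cj
    have hm : Measurable fun s : Sq => (dd s 1 : ℝ≥0∞) * dd s (-j) := (meas_dde 1).mul (meas_dde _)
    rw [← lintegral_mul_const _ hm, ← lintegral_const_mul _ (hm.mul_const _)]
    refine lintegral_congr fun s => ?_
    ring
  · intro j
    exact ((measurable_const.mul (meas_dde 1)).mul (measurable_const.mul (meas_dde _))).aemeasurable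

def Vv (Q : Measure Sq) (r : ℝ≥0∞) : ℝ≥0∞ := ∫⁻ s, Yy r s ^ 2 ∂Q

lemma Good.Vv_eq (h : Good Q μ b) (r : ℝ≥0∞) : Vv Q r = Dd Q r + r ^ 2 * Vv Q r := by
  have : Vv Q r = ∫⁻ s, Yy r (sh s) ^ 2 ∂Q := by
    unfold Vv
    rw [h.mp.lintegral_comp ((meas_Yy r).pow_const 2)]
  conv_lhs => rw [this]
  simp_rw [Yy_sh]
  rw [Dd_eq]
  unfold Vv
  rw [← lintegral_const_mul _ ((meas_Yy r).pow_const 2), ← lintegral_add_right]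
  · refine lintegral_congr fun s => ?_
    ring
  · exact measurable_const.mul ((meas_Yy r).pow_const 2)

lemma Good.d2_all (h : Good Q μ b) (k : ℤ) : ∫⁻ s, (dd s k : ℝ≥0∞) ^ 2 ∂Q = d2 Q := by
  have hs : ∀ k : ℤ, ∫⁻ s, (dd s (k + 1) : ℝ≥0∞) ^ 2 ∂Q = ∫⁻ s, (dd s k : ℝ≥0∞) ^ 2 ∂Q := fun k =>
    h.mp.lintegral_comp ((meas_dde k).pow_const 2)
  have h0 : ∀ k : ℤ, ∫⁻ s, (dd s k : ℝ≥0∞) ^ 2 ∂Q = ∫⁻ s, (dd s 0 : ℝ≥0∞) ^ 2 ∂Q := by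
    intro k
    induction k using Int.induction_on with
    | zero => rfl
    | succ i ih => rw [hs, ih]
    | pred i ih => rw [← ih, ← hs (-i - 1)]; simp
  rw [h0, ← h0 1]; rfl

lemma two_mul_le (a b : ℝ≥0∞) : a * b ≤ a ^ 2 + b ^ 2 := by
  rcases le_total a b with h | h
  · calc a * b ≤ b * b := by gcongr
      _ = b ^ 2 := (sq b).symm
      _ ≤ _ := le_add_self
  · calc a * b ≤ a * a := by gcongr
      _ = a ^ 2 := (sq a).symm
      _ ≤ _ := le_self_add

lemma Good.Vv_le (h : Good Q μ b) (r : ℝ≥0∞) : Vv Q r ≤ (1 - r)⁻¹ * ((1 - r)⁻¹ * (2 * d2 Q)) := by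
  calc Vv Q r = ∫⁻ s, ∑' i : ℕ, ∑' j : ℕ, r ^ i * (r ^ j * ((dd s (-i) : ℝ≥0∞) * dd s (-j))) ∂Q := by
        unfold Vv
        refine lintegral_congr fun s => ?_
        unfold Yy
        rw [sq, ← ENNReal.tsum_mul_right]
        refine tsum_congr fun i => ?_
        rw [← ENNReal.tsum_mul_left]
        refine tsum_congr fun j => ?_
        ring
    _ ≤ ∫⁻ s, ∑' i : ℕ, ∑' j : ℕ, r ^ i * (r ^ j * ((dd s (-i) : ℝ≥0∞) ^ 2 + (dd s (-j) : ℝ≥0∞) ^ 2)) ∂Q := by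
        gcongr
        exact two_mul_le _ _
    _ = ∑' i : ℕ, ∑' j : ℕ, r ^ i * (r ^ j * (2 * d2 Q)) := by
        rw [lintegral_tsum]
        · refine tsum_congr fun i => ?_
          rw [lintegral_tsum]
          · refine tsum_congr fun j => ?_
            have hm : Measurable fun s : Sq => (dd s (-i) : ℝ≥0∞) ^ 2 + (dd s (-j) : ℝ≥0∞) ^ 2 :=
              ((meas_dde _).pow_const 2).add ((meas_dde _).pow_const 2)
            rw [lintegral_const_mul _ (hm.const_mul _), lintegral_const_mul _ hm,
              lintegral_add_left ((meas_dde _).pow_const 2), h.d2_all, h.d2_all, two_mul]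
          · intro j
            exact (measurable_const.mul (measurable_const.mul
              (((meas_dde _).pow_const 2).add ((meas_dde _).pow_const 2)))).aemeasurable
        · intro i
          exact (Measurable.tsum fun j => measurable_const.mul (measurable_const.mul
              (((meas_dde _).pow_const 2).add ((meas_dde _).pow_const 2)))).aemeasurable
    _ = _ := by
        simp_rw [ENNReal.tsum_mul_left, ENNReal.tsum_mul_right, ENNReal.tsum_geometric]

lemma Good.Yy_mean (h : Good Q μ b) (r : ℝ≥0∞) :
    ∫⁻ s, Yy r s ∂Q = (1 - r)⁻¹ * ENNReal.ofReal μ := by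
  unfold Yy
  rw [lintegral_tsum (fun j => ((meas_dde _).const_mul _).aemeasurable)]
  simp_rw [lintegral_const_mul _ (meas_dde _), h.dmean', ENNReal.tsum_mul_right, ENNReal.tsum_geometric]
end
end SRE


namespace SRE
variable {Q : Measure Sq} {μ b : ℝ}

lemma amgm (y k : ℝ≥0∞) : 2 * k * y ≤ y ^ 2 + k ^ 2 := by
  by_cases hy : y = ⊤
  · simp [hy]
  by_cases hk : k = ⊤
  · simp [hk]
  lift y to ℝ≥0 using hy
  lift k to ℝ≥0 using hk
  norm_cast
  have := sq_nonneg ((y : ℝ) - k)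
  have h : (2 * k * y : ℝ) ≤ y ^ 2 + k ^ 2 := by nlinarith
  exact_mod_cast h

lemma amgm_eq {y k : ℝ≥0∞} (hy : y ≠ ⊤) (hk : k ≠ ⊤) (h : 2 * k * y = y ^ 2 + k ^ 2) : y = k := by
  lift y to ℝ≥0 using hy
  lift k to ℝ≥0 using hk
  norm_cast at h ⊢
  have h' : (2 * k * y : ℝ) = y ^ 2 + k ^ 2 := by exact_mod_cast h
  have : (y : ℝ) = k := by
    have : ((y : ℝ) - k) ^ 2 = 0 := by nlinarith
    exact sub_eq_zero.1 (pow_eq_zero_iff (by norm_num) |>.1 this)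
  exact_mod_cast this

/-- optimal value -/
def D0 (μ b : ℝ) : ℝ := μ ^ 2 * (1 + Real.exp b) / (1 - Real.exp b)

lemma Good.r1 (h : Good Q μ b) : Real.exp b < 1 := Real.exp_lt_one_iff.2 h.bneg

lemma Good.D0_pos (h : Good Q μ b) : 0 < D0 μ b := by
  have := h.r1; have := h.mpos; have := Real.exp_pos b
  unfold D0
  apply div_pos _ (by linarith)
  positivity

lemma inv_one_sub (h : Good Q μ b) :
    (1 - ENNReal.ofReal (Real.exp b))⁻¹ = ENNReal.ofReal ((1 - Real.exp b)⁻¹) := by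
  rw [ENNReal.ofReal_inv_of_pos (by linarith [h.r1]), ENNReal.ofReal_sub _ (Real.exp_pos b).le]
  simp

lemma Good.Dd_ge (h : Good Q μ b) :
    ENNReal.ofReal (D0 μ b) ≤ Dd Q (ENNReal.ofReal (Real.exp b)) ∧
    (Dd Q (ENNReal.ofReal (Real.exp b)) = ENNReal.ofReal (D0 μ b) →
      ∀ᵐ s ∂Q, Yy (ENNReal.ofReal (Real.exp b)) s = ENNReal.ofReal (μ / (1 - Real.exp b))) := by
  have := h.prob
  set r := Real.exp b with hr
  set re := ENNReal.ofReal r with hre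
  have hr1 : r < 1 := h.r1
  have hr0 : 0 < r := Real.exp_pos b
  have hm := h.mpos
  by_cases hD : Dd Q re = ⊤
  · rw [hD]
    exact ⟨le_top, fun he => absurd he.symm ENNReal.ofReal_ne_top⟩
  have hd2 : d2 Q ≠ ⊤ := ne_top_of_le_ne_top hD le_self_add
  have hV : Vv Q re ≠ ⊤ := by
    refine ne_top_of_le_ne_top ?_ (h.Vv_le re)
    rw [hre, inv_one_sub h]
    finiteness
  set κ := μ / (1 - r) with hκ
  have hκ0 : 0 < κ := div_pos hm (by linarith)
  have hmean : ∫⁻ s, Yy re s ∂Q = ENNReal.ofReal κ := by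
    rw [h.Yy_mean, hre, inv_one_sub h, ← ENNReal.ofReal_mul (by rw [inv_nonneg]; linarith)]
    congr 1; rw [hκ, ← hr, div_eq_mul_inv, mul_comm]
  have h2 : ∫⁻ s, 2 * ENNReal.ofReal κ * Yy re s ∂Q = ENNReal.ofReal (2 * κ ^ 2) := by
    rw [lintegral_const_mul _ (meas_Yy re), hmean, ENNReal.ofReal_mul (by norm_num),
      ENNReal.ofReal_pow hκ0.le, sq, mul_assoc]
    simp
  have h3 : ∫⁻ s, (Yy re s ^ 2 + ENNReal.ofReal κ ^ 2) ∂Q = ENNReal.ofReal ((Vv Q re).toReal + κ ^ 2) := by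
    rw [lintegral_add_right _ measurable_const, ENNReal.ofReal_add ENNReal.toReal_nonneg (by positivity),
      ENNReal.ofReal_toReal hV, ENNReal.ofReal_pow hκ0.le]
    simp [Vv]
  have hle : ENNReal.ofReal (2 * κ ^ 2) ≤ ENNReal.ofReal ((Vv Q re).toReal + κ ^ 2) := by
    rw [← h2, ← h3]
    exact lintegral_mono fun s => amgm _ _
  rw [ENNReal.ofReal_le_ofReal_iff (by positivity)] at hle
  have hVeq := congrArg ENNReal.toReal (h.Vv_eq re)
  rw [ENNReal.toReal_add hD (by finiteness), ENNReal.toReal_mul, ENNReal.toReal_pow, hre,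
    ENNReal.toReal_ofReal hr0.le, ← hre] at hVeq
  set V := (Vv Q re).toReal
  set D := (Dd Q re).toReal with hDdef
  have hD0 : D0 μ b = (1 - r ^ 2) * κ ^ 2 := by
    unfold D0; rw [← hr, hκ]
    have : (1 - r) ≠ 0 := by linarith
    field_simp; ring
  have hrr : 0 < 1 - r ^ 2 := by nlinarith
  refine ⟨?_, fun he => ?_⟩
  · rw [← ENNReal.ofReal_toReal hD, ← hDdef]
    apply ENNReal.ofReal_le_ofReal
    rw [hD0]
    nlinarith
  · have he' : D = D0 μ b := by
      rw [hDdef, he, ENNReal.toReal_ofReal h.D0_pos.le]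
    have hVk : V = κ ^ 2 := by
      have : (1 - r ^ 2) * V = (1 - r ^ 2) * κ ^ 2 := by rw [← hD0, ← he']; linarith
      exact mul_left_cancel₀ hrr.ne' this
    have hae := ae_eq_of_ae_le_of_lintegral_le (μ := Q) (f := fun s => 2 * ENNReal.ofReal κ * Yy re s)
      (g := fun s => Yy re s ^ 2 + ENNReal.ofReal κ ^ 2) (ae_of_all _ fun s => amgm _ _)
      (by rw [h2]; exact ENNReal.ofReal_ne_top)
      (((meas_Yy re).pow_const 2).add_const _).aemeasurable
      (by rw [h2, h3, hVk]; exact ENNReal.ofReal_le_ofReal (by linarith))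
    have hfin : ∀ᵐ s ∂Q, Yy re s < ⊤ := ae_lt_top (meas_Yy re) (by rw [hmean]; exact ENNReal.ofReal_ne_top)
    filter_upwards [hae, hfin] with s e1 e2
    exact amgm_eq e2.ne ENNReal.ofReal_ne_top e1

lemma Good.EM_ge (h : Good Q μ b) : ENNReal.ofReal (D0 μ b) ≤ EM Q := h.Dd_ge.1.trans h.Dd_le

lemma Good.EM_eq_d (h : Good Q μ b) (he : EM Q = ENNReal.ofReal (D0 μ b)) :
    ∃ c : ℕ, ∀ᵐ s ∂Q, dd s 0 = c := by
  have := h.prob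
  have hD : Dd Q (ENNReal.ofReal (Real.exp b)) = ENNReal.ofReal (D0 μ b) :=
    le_antisymm (by rw [← he]; exact h.Dd_le) h.Dd_ge.1
  have hY := h.Dd_ge.2 hD
  have hY1 := h.mp.quasiMeasurePreserving.ae hY
  have hd : ∀ᵐ s ∂Q, (dd s 1 : ℝ≥0∞) = ENNReal.ofReal μ := by
    filter_upwards [hY, hY1] with s e1 e2
    rw [Yy_sh, e1, ← ENNReal.ofReal_mul (Real.exp_pos b).le] at e2
    have hr1 := h.r1
    have hm := h.mpos
    have hs : μ / (1 - Real.exp b) = μ + Real.exp b * (μ / (1 - Real.exp b)) := by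
      have : 1 - Real.exp b ≠ 0 := by linarith
      field_simp; ring
    have hp : 0 ≤ Real.exp b * (μ / (1 - Real.exp b)) :=
      mul_nonneg (Real.exp_pos b).le (div_nonneg hm.le (by linarith))
    conv_rhs at e2 => rw [hs]
    rw [ENNReal.ofReal_add hm.le hp] at e2
    exact (ENNReal.add_left_inj ENNReal.ofReal_ne_top).1 e2
  obtain ⟨s0, hs0⟩ := hd.exists
  refine ⟨dd s0 1, ?_⟩
  have hd1 : ∀ᵐ s ∂Q, dd s 1 = dd s0 1 := by
    filter_upwards [hd] with s hs
    rw [← hs0] at hs; exact_mod_cast hs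
  have := (MeasurePreserving.symm she h.mp).quasiMeasurePreserving.ae hd1
  filter_upwards [this] with s hs
  have e := dd_shm s 1 1
  simp only [Function.iterate_one] at e
  rw [e] at hs
  simpa using hs

lemma Good.EM_eq_l (h : Good Q μ b) (he : EM Q = ENNReal.ofReal (D0 μ b)) :
    ∀ᵐ s ∂Q, Real.log (xi s 0) = b := by
  have := h.prob
  have hD : Dd Q (ENNReal.ofReal (Real.exp b)) = ENNReal.ofReal (D0 μ b) :=
    le_antisymm (by rw [← he]; exact h.Dd_le) h.Dd_ge.1
  apply h.ej_zero
  refine le_antisymm ?_ (by simpa using h.ej_ge 0)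
  have hEMt : EM Q ≠ ⊤ := by rw [he]; exact ENNReal.ofReal_ne_top
  have h1 := h.EM_eq
  have h2 : Dd Q (ENNReal.ofReal (Real.exp b)) = EM Q := by rw [hD, he]
  rw [h1] at h2
  unfold Dd at h2
  rw [tsum_eq_zero_add' ENNReal.summable, tsum_eq_zero_add' (f := fun j : ℕ => 2 * (cj Q j * ej Q j))
    ENNReal.summable] at h2
  rw [h1, tsum_eq_zero_add' ENNReal.summable] at hEMt
  have hd2 : d2 Q ≠ ⊤ := ne_top_of_le_ne_top hEMt le_self_add
  have hrest : ∑' j : ℕ, 2 * (cj Q (j + 1) * ej Q (j + 1)) ≠ ⊤ :=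
    ne_top_of_le_ne_top hEMt (le_add_self.trans le_add_self)
  have hle : ∑' j : ℕ, 2 * (cj Q (j + 1) * ENNReal.ofReal (Real.exp b) ^ (j + 1 + 1))
      ≤ ∑' j : ℕ, 2 * (cj Q (j + 1) * ej Q (j + 1)) := by
    refine ENNReal.tsum_le_tsum fun j => ?_
    gcongr
    exact h.ej_ge _
  have h3 := ENNReal.le_of_add_le_add_left hd2 h2.ge
  have h4 := ENNReal.le_of_add_le_add_right hrest (h3.trans (add_le_add_right hle _))
  have ht0 : 2 * (cj Q 0 * ej Q 0) ≠ ⊤ := ne_top_of_le_ne_top hEMt (le_self_add.trans le_add_self)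
  have hc1 : 1 ≤ cj Q 0 := by
    unfold cj
    calc (1 : ℝ≥0∞) = ∫⁻ _, 1 ∂Q := by simp
      _ ≤ _ := by
        refine lintegral_mono fun s => ?_
        have : 1 ≤ dd s 1 * dd s (-(0 : ℕ)) := Nat.mul_pos (one_le_dd s _) (one_le_dd s _)
        show (1 : ℝ≥0∞) ≤ (dd s 1 : ℝ≥0∞) * (dd s (-(0 : ℕ)) : ℝ≥0∞)
        exact_mod_cast this
  have he0 : ej Q 0 ≠ 0 := by
    have := h.ej_ge 0
    intro h0
    rw [h0] at this
    simp at this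
    linarith [Real.exp_pos b]
  have hct : cj Q 0 ≠ ⊤ := by
    intro hc
    rw [hc, ENNReal.top_mul he0] at ht0
    simp at ht0
  have h5 : cj Q 0 * ej Q 0 ≤ cj Q 0 * ENNReal.ofReal (Real.exp b) := by
    have := (ENNReal.mul_le_mul_iff_right (a := 2) (by simp) (by simp)).1 h4
    simpa using this
  exact (ENNReal.mul_le_mul_iff_right (by positivity) hct).1 h5

lemma Good.EM_const (h : Good Q μ b) {c : ℕ} {l : ℝ} (hd : ∀ᵐ s ∂Q, dd s 0 = c)
    (hl : ∀ᵐ s ∂Q, ll s 0 = l) : EM Q = ENNReal.ofReal (D0 μ b) := by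
  have := h.prob
  have hmpos := h.mpos
  have hr1 := h.r1
  have hr0 := Real.exp_pos b
  have hcm : (c : ℝ) = μ := by
    rw [← h.dmeanr 0, integral_congr_ae (g := fun _ => (c : ℝ))]
    · simp
    · filter_upwards [hd] with s hs; rw [hs]
  have hxi : ∀ᵐ s ∂Q, xi s 0 = Real.exp b := by
    have h1 : ∀ᵐ s ∂Q, xi s 0 = (1 - l) / l := by
      filter_upwards [hl] with s hs; unfold xi; rw [hs]
    have h2 : Real.log ((1 - l) / l) = b := by
      rw [← h.lmean, integral_congr_ae (g := fun _ => Real.log ((1 - l) / l))]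
      · simp
      · filter_upwards [h1] with s hs; rw [hs]
    obtain ⟨s0, hs0⟩ := h1.exists
    have hp : 0 < (1 - l) / l := by rw [← hs0]; exact xi_pos s0 0
    filter_upwards [h1] with s hs
    rw [hs, ← h2, Real.exp_log hp]
  have hall : ∀ᵐ s ∂Q, ∀ n : ℕ, dd s (-n) = c ∧ xi s (-n) = Real.exp b := by
    rw [ae_all_iff]
    intro n
    have hmp : MeasurePreserving (she.symm^[n]) Q Q := (MeasurePreserving.symm she h.mp).iterate n
    have := hmp.quasiMeasurePreserving.ae (hd.and hxi)
    filter_upwards [this] with s hs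
    rw [dd_shm, xi_shm, zero_sub] at hs
    exact hs
  have hall1 := h.mp.quasiMeasurePreserving.ae hall
  have hM : ∀ᵐ s ∂Q, Mt s = ENNReal.ofReal (D0 μ b) := by
    filter_upwards [hall1, hall, h.Mt_ae] with s e1 e2 e3
    rw [e3.1]
    have ed : dd s 1 = c := by have := (e1 0).1; simpa [dd_sh] using this
    have eR : Rr s 0 = ENNReal.ofReal (2 * c * Real.exp b * (1 - Real.exp b)⁻¹) := by
      unfold Rr rt
      have : ∀ j : ℕ, 2 * (∏ i ∈ Finset.range (j + 1), xe s (0 - i)) * (dd s (0 - j) : ℝ≥0∞)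
          = 2 * c * ENNReal.ofReal (Real.exp b) ^ (j + 1) := by
        intro j
        simp only [zero_sub, xe, (e2 _).1, (e2 _).2, Finset.prod_const, Finset.card_range]
        ring
      simp_rw [this]
      rw [ENNReal.tsum_mul_left, ENNReal.tsum_geometric_add_one, inv_one_sub h,
        ← ENNReal.ofReal_mul hr0.le, mul_assoc (2 * (c : ℝ)),
        ENNReal.ofReal_mul (p := 2 * (c : ℝ)) (by positivity),
        ENNReal.ofReal_mul (p := 2) (by norm_num)]
      simp
    rw [ed, eR]
    have hpos : 0 ≤ 2 * (c : ℝ) * Real.exp b * (1 - Real.exp b)⁻¹ := by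
      have : 0 ≤ (1 - Real.exp b)⁻¹ := by rw [inv_nonneg]; linarith
      positivity
    rw [← ENNReal.ofReal_natCast, ← ENNReal.ofReal_add (by positivity) hpos,
      ← ENNReal.ofReal_mul (by positivity)]
    congr 1
    rw [hcm]
    unfold D0
    have : 1 - Real.exp b ≠ 0 := by linarith
    field_simp; ring
  unfold EM
  rw [lintegral_congr_ae hM]
  simp
end SRE


namespace SRE
variable {Q : Measure Sq} {μ b : ℝ}

def Gsr (w : ℝ) (s : Sq) : ℝ := (Gs (ENNReal.ofReal w) s).toReal

lemma Gs_le {w : ℝ} (hw0 : 0 < w) (hw1 : w < 1) (s : Sq) :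
    Gs (ENNReal.ofReal w) s ≤ ENNReal.ofReal ((1 - w)⁻¹) := by
  refine (gs_le (pq s) _ _ _).trans_eq ?_
  rw [ENNReal.ofReal_inv_of_pos (by linarith), ENNReal.ofReal_sub _ hw0.le]
  simp

lemma Gs_ne {w : ℝ} (hw0 : 0 < w) (hw1 : w < 1) (s : Sq) : Gs (ENNReal.ofReal w) s ≠ ⊤ :=
  ne_top_of_le_ne_top ENNReal.ofReal_ne_top (Gs_le hw0 hw1 s)

lemma meas_Gsr (w : ℝ) : Measurable (Gsr w) := (meas_Gs _).ennreal_toReal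

lemma Gsr_nonneg (w : ℝ) (s : Sq) : 0 ≤ Gsr w s := ENNReal.toReal_nonneg

lemma Gsr_int [IsProbabilityMeasure Q] {w : ℝ} (hw0 : 0 < w) (hw1 : w < 1) : Integrable (Gsr w) Q := by
  refine Integrable.of_bound (meas_Gsr w).aestronglyMeasurable ((1 - w)⁻¹) (ae_of_all _ fun s => ?_)
  rw [Real.norm_of_nonneg (Gsr_nonneg w s)]
  have hp : 0 ≤ (1 - w)⁻¹ := by rw [inv_nonneg]; linarith
  exact ENNReal.toReal_le_of_le_ofReal hp (Gs_le hw0 hw1 s)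

lemma Gf_le {w : ℝ} (hw0 : 0 < w) (hw1 : w < 1) (s : Sq) :
    Gf (ENNReal.ofReal w) s ≤ ENNReal.ofReal (Real.exp (-(1 - w) * Gsr w s)) := by
  have h := gf_add_gs (pq s) (ENNReal.ofReal w) 0 (aa s 1)
  change Gf _ s + Gs _ s = 1 + _ * Gs _ s at h
  have hG := Gs_ne hw0 hw1 s
  have hF : Gf (ENNReal.ofReal w) s ≠ ⊤ := by
    refine ne_top_of_le_ne_top ?_ (le_self_add.trans_eq h)
    finiteness
  have h' := congrArg ENNReal.toReal h
  rw [ENNReal.toReal_add hF hG, ENNReal.toReal_add (by simp) (by finiteness), ENNReal.toReal_mul,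
    ENNReal.toReal_ofReal hw0.le, ENNReal.toReal_one] at h'
  change _ + Gsr w s = 1 + w * Gsr w s at h'
  rw [← ENNReal.ofReal_toReal hF]
  apply ENNReal.ofReal_le_ofReal
  have := Real.add_one_le_exp (-(1 - w) * Gsr w s)
  linarith

lemma gf_le {w : ℝ} (hw0 : 0 < w) (hw1 : w < 1) (s : Sq) (n : ℕ) :
    gf (ps s) (qs s) (ENNReal.ofReal w) 0 (aa s n)
      ≤ ENNReal.ofReal (Real.exp (-(1 - w) * birkhoffSum sh (Gsr w) n s)) := by
  rw [gf_prod]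
  calc ∏ k ∈ Finset.range n, Gf (ENNReal.ofReal w) (sh^[k] s)
      ≤ ∏ k ∈ Finset.range n, ENNReal.ofReal (Real.exp (-(1 - w) * Gsr w (sh^[k] s))) :=
        Finset.prod_le_prod' fun k _ => Gf_le hw0 hw1 _
    _ = _ := by
        rw [← ENNReal.ofReal_prod_of_nonneg (fun k _ => (Real.exp_pos _).le), ← Real.exp_sum,
          ← Finset.mul_sum]
        rfl

lemma exists_w [IsProbabilityMeasure Q] {c : ℝ} (hc0 : 0 ≤ c) (hc : ENNReal.ofReal c < EM Q) :
    ∃ w : ℝ, 0 < w ∧ w < 1 ∧ c < w * ∫ s, Gsr w s ∂Q := by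
  set U : ℕ → ℝ≥0∞ := fun t => ∫⁻ s, su (ps s) (qs s) t 0 (aa s 1) ∂Q with hU
  have hms : ∀ t, Measurable fun s : Sq => su (ps s) (qs s) t 0 (aa s 1) := fun t =>
    meas_eval (fun y => meas_su t 0 y) (meas_aa 1)
  have hEM : EM Q = ∑' t, U t := by
    unfold EM Mt mt
    rw [lintegral_tsum fun t => (hms t).aemeasurable]
  rw [hEM, ENNReal.tsum_eq_iSup_nat, lt_iSup_iff] at hc
  obtain ⟨T, hT⟩ := hc
  have hUt : ∀ t, U t ≤ 1 := by
    intro t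
    calc U t ≤ ∫⁻ _, 1 ∂Q := lintegral_mono fun s => su_le_one (pq s) _ _ _
      _ = 1 := by simp
  have hUf : ∑ t ∈ Finset.range T, U t ≠ ⊤ :=
    ENNReal.sum_ne_top.2 fun t _ => ne_top_of_le_ne_top (by simp) (hUt t)
  set u := (∑ t ∈ Finset.range T, U t).toReal with hu
  have hcu : c < u := by
    rw [← ENNReal.ofReal_toReal hUf] at hT
    exact (ENNReal.ofReal_lt_ofReal_iff_of_nonneg hc0).1 hT
  have hcont : Tendsto (fun w : ℝ => w ^ (T + 1) * u) (𝓝[<] 1) (𝓝 u) := by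
    have : ContinuousAt (fun w : ℝ => w ^ (T + 1) * u) 1 := by fun_prop
    have h := this.tendsto.mono_left (nhdsWithin_le_nhds (s := Iio 1))
    simpa using h
  have h1 := hcont.eventually_const_lt hcu
  have h2 : ∀ᶠ w : ℝ in 𝓝[<] 1, w ∈ Ioo (0 : ℝ) 1 := Ioo_mem_nhdsLT (by norm_num)
  obtain ⟨w, hw1, hw2⟩ := (h1.and h2).exists
  refine ⟨w, hw2.1, hw2.2, hw1.trans_le ?_⟩
  rw [pow_succ', mul_assoc]
  refine mul_le_mul_of_nonneg_left ?_ hw2.1.le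
  have hhG : ∫ s, Gsr w s ∂Q = (∫⁻ s, Gs (ENNReal.ofReal w) s ∂Q).toReal :=
    integral_toReal (meas_Gs _).aemeasurable
      (ae_of_all _ fun s => lt_top_iff_ne_top.2 (Gs_ne hw2.1 hw2.2 s))
  rw [hhG]
  have hfin : ∫⁻ s, Gs (ENNReal.ofReal w) s ∂Q ≠ ⊤ := by
    refine ne_top_of_le_ne_top (b := ENNReal.ofReal ((1 - w)⁻¹)) ENNReal.ofReal_ne_top ?_
    calc ∫⁻ s, Gs (ENNReal.ofReal w) s ∂Q ≤ ∫⁻ _, ENNReal.ofReal ((1 - w)⁻¹) ∂Q :=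
          lintegral_mono fun s => Gs_le hw2.1 hw2.2 s
      _ = _ := by simp
  have hpow : w ^ T * u = (ENNReal.ofReal w ^ T * ∑ t ∈ Finset.range T, U t).toReal := by
    rw [ENNReal.toReal_mul, ENNReal.toReal_pow, ENNReal.toReal_ofReal hw2.1.le]
  rw [hpow]
  refine ENNReal.toReal_mono hfin ?_
  have hw1' : ENNReal.ofReal w ≤ 1 := by simpa using hw2.2.le
  calc ENNReal.ofReal w ^ T * ∑ t ∈ Finset.range T, U t
      = ∑ t ∈ Finset.range T, U t * ENNReal.ofReal w ^ T := by rw [mul_comm, Finset.sum_mul]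
    _ ≤ ∑ t ∈ Finset.range T, U t * ENNReal.ofReal w ^ t := by
        refine Finset.sum_le_sum fun t ht => ?_
        refine mul_le_mul_right ?_ _
        exact pow_le_pow_of_le_one zero_le hw1' (Finset.mem_range.1 ht).le
    _ ≤ ∑' t, U t * ENNReal.ofReal w ^ t := ENNReal.sum_le_tsum _
    _ = _ := by
        unfold Gs gs
        rw [lintegral_tsum fun t => ((hms t).mul_const _).aemeasurable]
        refine tsum_congr fun t => ?_
        rw [lintegral_mul_const _ (hms t)]

/-- quenched bound on the probability of an early hit -/
lemma hit_le {s : Sq} {ν : Measure (ℕ → ℤ)} (hν : IsQuenchedRW (en s) 0 ν) {w : ℝ} (hw0 : 0 < w)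
    (hw1 : w < 1) (y : ℤ) (N : ℕ) :
    ν {f | ∃ t ≤ N, f t = y} ≤ ENNReal.ofReal ((w⁻¹) ^ N) * gf (ps s) (qs s) (ENNReal.ofReal w) 0 y := by
  have h0 : ∀ x, 0 ≤ en s x := fun x => (en_mem s x).1.le
  have h1 : ∀ x, en s x ≤ 1 := fun x => (en_mem s x).2.le
  have hsub : {f : ℕ → ℤ | ∃ t ≤ N, f t = y} ⊆ ⋃ t ∈ Finset.range (N + 1), hitEv 0 [(y, t)] := by
    rintro f ⟨t, ht, hf⟩
    classical
    have hex : ∃ t, f t = y := ⟨t, hf⟩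
    simp only [mem_iUnion, exists_prop]
    refine ⟨Nat.find hex, ?_, ?_⟩
    · rw [Finset.mem_range]
      have := Nat.find_min' hex hf
      omega
    · simp only [hitEv, inter_univ, zero_add]
      exact ⟨fun u hu => Nat.find_min hex hu, Nat.find_spec hex⟩
  calc ν {f | ∃ t ≤ N, f t = y} ≤ ν (⋃ t ∈ Finset.range (N + 1), hitEv 0 [(y, t)]) := measure_mono hsub
    _ ≤ ∑ t ∈ Finset.range (N + 1), ν (hitEv 0 [(y, t)]) := measure_biUnion_finset_le _ _
    _ = ∑ t ∈ Finset.range (N + 1), fp (ps s) (qs s) t 0 y := by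
        refine Finset.sum_congr rfl fun t _ => ?_
        rw [measure_hitEv hν h0 h1]
        simp [lw, ps, qs]
    _ ≤ ∑ t ∈ Finset.range (N + 1), ENNReal.ofReal ((w⁻¹) ^ N) *
          (fp (ps s) (qs s) t 0 y * ENNReal.ofReal w ^ t) := by
        refine Finset.sum_le_sum fun t ht => ?_
        have htN : t ≤ N := by have := Finset.mem_range.1 ht; omega
        have : 1 ≤ ENNReal.ofReal ((w⁻¹) ^ N) * ENNReal.ofReal w ^ t := by
          rw [← ENNReal.ofReal_pow hw0.le, ← ENNReal.ofReal_mul (by positivity)]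
          rw [ENNReal.one_le_ofReal, inv_pow, ← div_eq_inv_mul, one_le_div (by positivity)]
          exact pow_le_pow_of_le_one hw0.le hw1.le htN
        calc fp (ps s) (qs s) t 0 y = 1 * fp (ps s) (qs s) t 0 y := (one_mul _).symm
          _ ≤ (ENNReal.ofReal ((w⁻¹) ^ N) * ENNReal.ofReal w ^ t) * fp (ps s) (qs s) t 0 y := by gcongr
          _ = _ := by ring
    _ ≤ _ := by
        rw [← Finset.mul_sum]
        gcongr
        exact ENNReal.sum_le_tsum _

lemma tsum_ne_top_of_ev {a : ℕ → ℝ≥0∞} {g : ℕ → ℝ} (ha : ∀ n, a n ≠ ⊤) (hg : ∀ n, 0 ≤ g n)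
    (hs : Summable g) (h : ∀ᶠ n in atTop, a n ≤ ENNReal.ofReal (g n)) : ∑' n, a n ≠ ⊤ := by
  obtain ⟨N, hN⟩ := eventually_atTop.1 h
  have e : ∑ i ∈ Finset.range N, a i + ∑' i, a (i + N) = ∑' i, a i :=
    ENNReal.summable.sum_add_tsum_nat_add' (f := a) (k := N)
  rw [← e]
  refine ENNReal.add_ne_top.2 ⟨ENNReal.sum_ne_top.2 fun i _ => ha i, ?_⟩
  refine ne_top_of_le_ne_top ?_ (ENNReal.tsum_le_tsum fun n => hN (n + N) (by omega))
  rw [← ENNReal.ofReal_tsum_of_nonneg (fun n => hg _)]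
  · exact ENNReal.ofReal_ne_top
  · exact (summable_nat_add_iff (f := g) N).2 hs

lemma lower_real {w c g' B : ℝ} (hw0 : 0 < w) (hw1 : w < 1) (hc0 : 0 ≤ c) (n : ℕ)
    (hn : g' * n ≤ B) :
    (w⁻¹) ^ ⌊c * n⌋₊ * Real.exp (-(1 - w) * B) ≤ Real.exp (-(1 - w) * (g' - c / w)) ^ n := by
  have e1 : w⁻¹ ≤ Real.exp ((1 - w) / w) := by
    have := Real.add_one_le_exp ((1 - w) / w)
    have e : (1 - w) / w + 1 = w⁻¹ := by field_simp; ring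
    linarith
  have e2 : (w⁻¹) ^ ⌊c * n⌋₊ ≤ Real.exp ((1 - w) / w * (c * n)) := by
    calc (w⁻¹) ^ ⌊c * n⌋₊ ≤ Real.exp ((1 - w) / w) ^ ⌊c * n⌋₊ :=
          pow_le_pow_left₀ (by positivity) e1 _
      _ = Real.exp (⌊c * n⌋₊ * ((1 - w) / w)) := (Real.exp_nat_mul _ _).symm
      _ ≤ _ := by
        apply Real.exp_le_exp.2
        rw [mul_comm]
        refine mul_le_mul_of_nonneg_left (Nat.floor_le (by positivity)) ?_
        exact div_nonneg (by linarith) hw0.le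
  calc _ ≤ Real.exp ((1 - w) / w * (c * n)) * Real.exp (-(1 - w) * (g' * n)) := by
        refine mul_le_mul e2 (Real.exp_le_exp.2 ?_) (Real.exp_pos _).le (Real.exp_pos _).le
        have : (1 - w) * (g' * n) ≤ (1 - w) * B :=
          mul_le_mul_of_nonneg_left hn (by linarith)
        linarith
    _ = _ := by
        rw [← Real.exp_nat_mul, ← Real.exp_add]
        congr 1
        field_simp; ring

lemma Good.lower (h : Good Q μ b) {c : ℝ} (hc0 : 0 ≤ c) (hc : ENNReal.ofReal c < EM Q) :
    ∀ᵐ s ∂Q, ∀ ν : Measure (ℕ → ℤ), IsQuenchedRW (en s) 0 ν →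
      ∀ᵐ f ∂ν, ∀ᶠ n : ℕ in atTop, ∀ t : ℕ, (t : ℝ) ≤ c * n → f t ≠ aa s n := by
  have := h.prob
  obtain ⟨w, hw0, hw1, hw⟩ := exists_w hc0 hc
  set g := ∫ s, Gsr w s ∂Q
  have hgc : c / w < g := by rw [div_lt_iff₀ hw0]; linarith
  obtain ⟨g', hg1, hg2⟩ := exists_between hgc
  filter_upwards [birkhoff_ergodic h.erg (meas_Gsr w) (Gsr_int hw0 hw1)] with s hs ν hν
  set ρ := Real.exp (-(1 - w) * (g' - c / w)) with hρ
  have hρ1 : ρ < 1 := by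
    rw [hρ, Real.exp_lt_one_iff]
    have : 0 < (1 - w) * (g' - c / w) := mul_pos (by linarith) (by linarith)
    linarith
  have hbound : ∀ᶠ n : ℕ in atTop, ν {f | ∃ t ≤ ⌊c * n⌋₊, f t = aa s n} ≤ ENNReal.ofReal (ρ ^ n) := by
    filter_upwards [hs.eventually_const_lt hg2, eventually_gt_atTop 0] with n hn hn0
    have hn0' : (0 : ℝ) < n := by exact_mod_cast hn0
    rw [lt_div_iff₀ hn0'] at hn
    refine (hit_le hν hw0 hw1 _ _).trans ?_
    calc _ ≤ ENNReal.ofReal ((w⁻¹) ^ ⌊c * n⌋₊) *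
          ENNReal.ofReal (Real.exp (-(1 - w) * birkhoffSum sh (Gsr w) n s)) := by
          gcongr; exact gf_le hw0 hw1 s n
      _ = ENNReal.ofReal ((w⁻¹) ^ ⌊c * n⌋₊ * Real.exp (-(1 - w) * birkhoffSum sh (Gsr w) n s)) := by
          rw [ENNReal.ofReal_mul (by positivity)]
      _ ≤ _ := by
          apply ENNReal.ofReal_le_ofReal
          exact lower_real hw0 hw1 hc0 n hn.le
  have := hν.1
  have hsum : ∑' n : ℕ, ν {f | ∃ t ≤ ⌊c * n⌋₊, f t = aa s n} ≠ ⊤ :=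
    tsum_ne_top_of_ev (fun n => measure_ne_top _ _) (fun n => pow_nonneg (Real.exp_pos _).le n)
      (summable_geometric_of_lt_one (Real.exp_pos _).le hρ1) hbound
  filter_upwards [ae_eventually_notMem hsum] with f hf
  filter_upwards [hf] with n hn t ht heq
  exact hn ⟨t, Nat.le_floor ht, heq⟩
end SRE


namespace SRE
variable {Q : Measure Sq} {μ b : ℝ}

def prim (g : ℤ → ℝ) (x : ℤ) : ℝ := ∑ i ∈ Finset.Ico 0 x, g i - ∑ i ∈ Finset.Ico x 0, g i

lemma prim_zero (g : ℤ → ℝ) : prim g 0 = 0 := by simp [prim]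

lemma prim_succ (g : ℤ → ℝ) (x : ℤ) : prim g (x + 1) = prim g x + g x := by
  unfold prim
  rcases le_or_gt 0 x with h | h
  · have e1 : Finset.Ico 0 (x + 1) = insert x (Finset.Ico 0 x) := by
      ext i; simp only [Finset.mem_Ico, Finset.mem_insert]; omega
    have e2 : Finset.Ico x 0 = ∅ := Finset.Ico_eq_empty (by omega)
    have e3 : Finset.Ico (x + 1) 0 = ∅ := Finset.Ico_eq_empty (by omega)
    rw [e1, e2, e3, Finset.sum_insert (by simp)]
    simp; ring
  · have e1 : Finset.Ico x 0 = insert x (Finset.Ico (x + 1) 0) := by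
      ext i; simp only [Finset.mem_Ico, Finset.mem_insert]; omega
    have e2 : Finset.Ico 0 x = ∅ := Finset.Ico_eq_empty (by omega)
    have e3 : Finset.Ico 0 (x + 1) = ∅ := Finset.Ico_eq_empty (by omega)
    rw [e1, e2, e3, Finset.sum_insert (by simp)]
    simp

def rr (s : Sq) (x : ℤ) : ℝ := (1 - en s x) / en s x

lemma rr_pos (s : Sq) (x : ℤ) : 0 < rr s x :=
  div_pos (by linarith [(en_mem s x).2]) (en_mem s x).1

/-- conductances -/
def cc (s : Sq) (x : ℤ) : ℝ := Real.exp (-prim (fun i => Real.log (rr s i)) x)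

lemma cc_pos (s : Sq) (x : ℤ) : 0 < cc s x := Real.exp_pos _
lemma cc_zero (s : Sq) : cc s 0 = 1 := by simp [cc, prim_zero]

lemma cc_step (s : Sq) (x : ℤ) : cc s x = rr s x * cc s (x + 1) := by
  unfold cc
  rw [prim_succ, neg_add, Real.exp_add, Real.exp_neg (Real.log _), Real.exp_log (rr_pos s x)]
  have := (rr_pos s x).ne'
  field_simp

def ppi (s : Sq) (x : ℤ) : ℝ≥0∞ := ENNReal.ofReal (cc s x + cc s (x + 1))

lemma ppi_p (s : Sq) (x : ℤ) : ppi s x * ps s x = ENNReal.ofReal (cc s (x + 1)) := by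
  unfold ppi ps pe
  have h := en_mem s x
  rw [← ENNReal.ofReal_mul (by linarith [cc_pos s x, cc_pos s (x + 1)])]
  congr 1
  rw [cc_step s x]; unfold rr
  have := h.1.ne'
  field_simp; ring

lemma ppi_q (s : Sq) (x : ℤ) : ppi s x * qs s x = ENNReal.ofReal (cc s x) := by
  unfold ppi qs qe
  have h := en_mem s x
  rw [← ENNReal.ofReal_mul (by linarith [cc_pos s x, cc_pos s (x + 1)])]
  congr 1
  rw [cc_step s x]; unfold rr
  have := h.1.ne'
  field_simp; ring

lemma ppi_inv (s : Sq) (y : ℤ) :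
    ppi s (y - 1) * ps s (y - 1) + ppi s (y + 1) * qs s (y + 1) ≤ ppi s y := by
  rw [ppi_p, ppi_q, sub_add_cancel, ← ENNReal.ofReal_add (cc_pos _ _).le (cc_pos _ _).le]
  rfl

lemma cc_gap (s : Sq) (k : ℤ) (j : ℕ) (hj : j + 1 ≤ dd s (k + 1)) :
    cc s (aa s k + 1 + j) = cc s (aa s k + 1) := by
  induction j with
  | zero => simp
  | succ j ih =>
    rw [← ih (by omega), cc_step s (aa s k + 1 + j)]
    have : rr s (aa s k + 1 + j) = 1 := by
      unfold rr
      rw [en_gap s (k := k) (by omega) (by rw [aa_succ]; omega)]; norm_num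
    rw [this, one_mul]; push_cast; congr 1; ring

lemma cc_next (s : Sq) (k : ℤ) : cc s (aa s k + 1) = cc s (aa s (k + 1)) := by
  have h1 := one_le_dd s (k + 1)
  rw [← cc_gap s k (dd s (k + 1) - 1) (by omega)]
  congr 1
  rw [aa_succ]; omega

lemma cc_aa (s : Sq) (k : ℤ) : cc s (aa s k) = xi s k * cc s (aa s (k + 1)) := by
  rw [cc_step, cc_next]; unfold rr xi; rw [en_aa]

lemma cc_neg (s : Sq) (n : ℕ) :
    xi s 0 * cc s (aa s (-n)) = ∏ i ∈ Finset.range (n + 1), xi s (-i) := by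
  induction n with
  | zero => simp [aa_zero, cc_zero]
  | succ n ih =>
    rw [Finset.prod_range_succ, ← ih, cc_aa]
    have : -((n + 1 : ℕ) : ℤ) + 1 = -n := by push_cast; ring
    rw [this]; ring

lemma ppi_zero (s : Sq) : 1 ≤ ppi s 0 := by
  unfold ppi
  rw [cc_zero, ENNReal.one_le_ofReal]
  linarith [cc_pos s (0 + 1)]

lemma ppi_neg (s : Sq) {n : ℕ} (hn : 1 ≤ n) {r : ℝ} (hr0 : 0 < r) (hr1 : r < 1)
    (h1 : ∏ i ∈ Finset.range n, xi s (-i) ≤ r ^ n)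
    (h2 : ∏ i ∈ Finset.range (n + 1), xi s (-i) ≤ r ^ (n + 1)) :
    ppi s (aa s (-n)) ≤ ENNReal.ofReal (2 / xi s 0 * r ^ n) := by
  obtain ⟨m, rfl⟩ : ∃ m, n = m + 1 := ⟨n - 1, by omega⟩
  unfold ppi
  apply ENNReal.ofReal_le_ofReal
  rw [cc_next]
  have e : -((m + 1 : ℕ) : ℤ) + 1 = -m := by push_cast; ring
  rw [e]
  rw [← cc_neg] at h1 h2
  have hx := xi_pos s 0
  have h3 : r ^ (m + 1 + 1) ≤ r ^ (m + 1) := pow_le_pow_of_le_one hr0.le hr1.le (by omega)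
  rw [div_mul_eq_mul_div, le_div_iff₀ hx]
  nlinarith

lemma tp_neg (s : Sq) (t : ℕ) (y : ℤ) : tp (ps s) (qs s) t 0 y ≤ ppi s y :=
  (le_mul_of_one_le_left' (ppi_zero s)).trans (tp_le (ppi_inv s) 0 t y)

lemma Good.lower_neg (h : Good Q μ b) :
    ∀ᵐ s ∂Q, ∀ ν : Measure (ℕ → ℤ), IsQuenchedRW (en s) 0 ν → ∀ c : ℝ, 0 ≤ c →
      ∀ᵐ f ∂ν, ∀ᶠ n : ℕ in atTop, ∀ t : ℕ, (t : ℝ) ≤ c * n → f t ≠ aa s (-n) := by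
  filter_upwards [h.xi_prod] with s hs ν hν c hc
  have hr0 := Real.exp_pos (b / 2)
  have hr1 : Real.exp (b / 2) < 1 := by rw [Real.exp_lt_one_iff]; linarith [h.bneg]
  set r := Real.exp (b / 2)
  have := hν.1
  have h0 : ∀ x, 0 ≤ en s x := fun x => (en_mem s x).1.le
  have h1 : ∀ x, en s x ≤ 1 := fun x => (en_mem s x).2.le
  have hx := xi_pos s 0
  have hbound : ∀ᶠ n : ℕ in atTop, ν {f | ∃ t ≤ ⌊c * n⌋₊, f t = aa s (-n)}
      ≤ ENNReal.ofReal ((c * n + 1) * (2 / xi s 0 * r ^ n)) := by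
    filter_upwards [hs, (tendsto_add_atTop_nat 1).eventually hs, eventually_ge_atTop 1]
      with n hn1 hn2 hn0
    have hp := ppi_neg s hn0 hr0 hr1 hn1 hn2
    calc ν {f | ∃ t ≤ ⌊c * n⌋₊, f t = aa s (-n)}
        ≤ ν (⋃ t ∈ Finset.range (⌊c * n⌋₊ + 1), {f | f t = aa s (-n)}) := by
          apply measure_mono
          rintro f ⟨t, ht, hf⟩
          simp only [mem_iUnion, exists_prop, Finset.mem_range]
          exact ⟨t, by omega, hf⟩
      _ ≤ ∑ t ∈ Finset.range (⌊c * n⌋₊ + 1), ν {f | f t = aa s (-n)} := measure_biUnion_finset_le _ _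
      _ ≤ ∑ t ∈ Finset.range (⌊c * n⌋₊ + 1), ENNReal.ofReal (2 / xi s 0 * r ^ n) := by
          refine Finset.sum_le_sum fun t _ => ?_
          rw [measure_tp hν h0 h1]
          exact (tp_neg s t _).trans hp
      _ = ENNReal.ofReal ((⌊c * n⌋₊ + 1 : ℕ) * (2 / xi s 0 * r ^ n)) := by
          rw [Finset.sum_const, Finset.card_range, nsmul_eq_mul, ← ENNReal.ofReal_natCast,
            ← ENNReal.ofReal_mul (by positivity)]
      _ ≤ _ := by
          apply ENNReal.ofReal_le_ofReal
          refine mul_le_mul_of_nonneg_right ?_ (by positivity)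
          push_cast
          have := Nat.floor_le (a := c * n) (by positivity)
          linarith
  have hsm : Summable fun n : ℕ => (c * n + 1) * (2 / xi s 0 * r ^ n) := by
    have a1 : Summable fun n : ℕ => (n : ℝ) ^ 1 * r ^ n :=
      summable_pow_mul_geometric_of_norm_lt_one 1 (by rwa [Real.norm_of_nonneg hr0.le])
    have a2 : Summable fun n : ℕ => r ^ n := summable_geometric_of_lt_one hr0.le hr1
    refine ((a1.mul_left (c * (2 / xi s 0))).add (a2.mul_left (2 / xi s 0))).congr fun n => ?_
    ring
  have hsum := tsum_ne_top_of_ev (fun n => measure_ne_top ν {f | ∃ t ≤ ⌊c * n⌋₊, f t = aa s (-n)})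
    (fun n => by positivity) hsm hbound
  filter_upwards [ae_eventually_notMem hsum] with f hf
  filter_upwards [hf] with n hn t ht heq
  exact hn ⟨t, Nat.le_floor ht, heq⟩
end SRE


namespace SRE

lemma below {f : ℕ → ℤ} {B : ℤ} (h0 : f 0 = 0) (nn : ∀ n, f (n + 1) ≤ f n + 1) (hB : 0 < B) (t : ℕ)
    (h : ∀ u ≤ t, f u ≠ B) : f t < B := by
  induction t with
  | zero => rw [h0]; exact hB
  | succ t ih =>
    have h1 := ih fun u hu => h u (by omega)
    have h2 := nn t
    have h3 := h (t + 1) le_rfl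
    omega

lemma barrier {f B : ℕ → ℤ} {μ : ℝ} (h0 : f 0 = 0) (nn : ∀ n, f (n + 1) ≤ f n + 1)
    (hB : ∀ n : ℕ, (n : ℤ) ≤ B n) (hμ : 0 < μ)
    (hlim : Tendsto (fun n : ℕ => (B n : ℝ) / n) atTop (𝓝 μ))
    (hev : ∀ c : ℕ, ∀ᶠ n : ℕ in atTop, ∀ t : ℕ, (t : ℝ) ≤ c * n → f t ≠ B n) {ε : ℝ} (hε : 0 < ε) :
    ∀ᶠ t : ℕ in atTop, (f t : ℝ) ≤ ε * t := by
  obtain ⟨c, hc⟩ := exists_nat_gt (2 * (μ + 1) / ε)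
  have hcpos : (0 : ℝ) < c := lt_trans (by positivity) hc
  have hc0 : 0 < c := by exact_mod_cast hcpos
  have hn : Tendsto (fun t : ℕ => t / c + 1) atTop atTop :=
    (tendsto_add_atTop_nat 1).comp (Nat.tendsto_div_const_atTop hc0.ne')
  have e1 := hn.eventually (hev c)
  have e2 := hn.eventually (hlim.eventually_lt_const (lt_add_one μ))
  obtain ⟨M, hM⟩ := exists_nat_gt (2 * (μ + 1) / ε)
  filter_upwards [e1, e2, eventually_ge_atTop M] with t h1 h2 h3
  set n := t / c + 1 with hnn
  have htn : t ≤ c * n := by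
    have := Nat.lt_mul_div_succ t hc0
    exact this.le
  have hnt : (n : ℝ) ≤ t / c + 1 := by
    rw [hnn]; push_cast
    have := @Nat.cast_div_le ℝ _ _ _ t c
    linarith
  have hb : f t < B n := by
    refine below h0 nn (by have := hB n; have h1n : 1 ≤ n := Nat.succ_le_succ (Nat.zero_le _); omega) t fun u hu => h1 u ?_
    exact_mod_cast hu.trans htn
  have hn0 : (0 : ℝ) < n := by rw [hnn]; positivity
  rw [div_lt_iff₀ hn0] at h2
  have hb' : (f t : ℝ) < B n := by exact_mod_cast hb
  have h4 : (μ + 1) * n ≤ (μ + 1) * (t / c + 1) := by gcongr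
  have h5 : 2 * (μ + 1) ≤ ε * c := by rw [div_lt_iff₀ hε] at hc; linarith
  have h6 : 2 * (μ + 1) ≤ ε * t := by
    rw [div_lt_iff₀ hε] at hM
    have : (M : ℝ) ≤ t := by exact_mod_cast h3
    nlinarith
  have h7 : 2 * (μ + 1) * (t / c) ≤ ε * t := by
    calc 2 * (μ + 1) * (t / c) ≤ ε * c * (t / c) := by gcongr
      _ = ε * t := by field_simp
  linarith

lemma zero_speed {f B C : ℕ → ℤ} {μ : ℝ} (h0 : f 0 = 0)
    (nn : ∀ n, f (n + 1) = f n + 1 ∨ f (n + 1) = f n - 1) (hμ : 0 < μ)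
    (hB : ∀ n : ℕ, (n : ℤ) ≤ B n) (hlim : Tendsto (fun n : ℕ => (B n : ℝ) / n) atTop (𝓝 μ))
    (hC : ∀ n : ℕ, C n ≤ -(n : ℤ)) (hlim2 : Tendsto (fun n : ℕ => -(C n : ℝ) / n) atTop (𝓝 μ))
    (hev : ∀ c : ℕ, ∀ᶠ n : ℕ in atTop, ∀ t : ℕ, (t : ℝ) ≤ c * n → f t ≠ B n)
    (hev2 : ∀ c : ℕ, ∀ᶠ n : ℕ in atTop, ∀ t : ℕ, (t : ℝ) ≤ c * n → f t ≠ C n) :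
    Tendsto (fun n : ℕ => (f n : ℝ) / n) atTop (𝓝 0) := by
  rw [Metric.tendsto_nhds]
  intro ε hε
  have a1 := barrier h0 (fun n => by rcases nn n with h | h <;> omega) hB hμ hlim hev (half_pos hε)
  have a2 := barrier (f := fun n => -f n) (B := fun n => -C n) (by simp [h0])
    (fun n => by rcases nn n with h | h <;> omega) (fun n => by have := hC n; omega) hμ
    (by simpa using hlim2) (fun c => by
      filter_upwards [hev2 c] with n hn t ht he
      exact hn t ht (by simpa using he)) (half_pos hε)
  filter_upwards [a1, a2, eventually_gt_atTop 0] with t h1 h2 h3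
  have h3' : (0 : ℝ) < t := by exact_mod_cast h3
  rw [Real.dist_eq, sub_zero, abs_div, abs_of_pos h3', div_lt_iff₀ h3', abs_lt]
  push_cast at h2
  constructor <;> nlinarith

lemma speed {f a : ℕ → ℤ} {T : ℕ → ℕ} {μ E : ℝ} (hT : StrictMono T) (hT0 : T 0 = 0)
    (hfT : ∀ k, f (T k) = a k) (hup : ∀ k t, t < T k → f t ≤ a k) (nn : ∀ n, f n - 1 ≤ f (n + 1))
    (hE : 0 < E) (hTl : Tendsto (fun n : ℕ => (T n : ℝ) / n) atTop (𝓝 E))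
    (hal : Tendsto (fun n : ℕ => (a n : ℝ) / n) atTop (𝓝 μ)) :
    Tendsto (fun n : ℕ => (f n : ℝ) / n) atTop (𝓝 (μ / E)) := by
  set k : ℕ → ℕ := fun t => Nat.findGreatest (fun k => T k ≤ t) t with hk
  have hk1 : ∀ t, T (k t) ≤ t := fun t =>
    Nat.findGreatest_spec (P := fun k => T k ≤ t) (Nat.zero_le t) (by simp [hT0])
  have hk2 : ∀ t, t < T (k t + 1) := by
    intro t
    by_contra hcon
    push Not at hcon
    have h1 : k t + 1 ≤ t := (hT.id_le _).trans hcon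
    have := Nat.le_findGreatest (P := fun k => T k ≤ t) h1 hcon
    change k t + 1 ≤ k t at this
    omega
  have hkt : Tendsto k atTop atTop := by
    rw [tendsto_atTop]
    intro m
    filter_upwards [eventually_ge_atTop (T m)] with t ht
    by_contra hcon
    push Not at hcon
    have := hT.monotone (show k t + 1 ≤ m by omega)
    have := hk2 t
    omega
  have hdown : ∀ m j, f m - j ≤ f (m + j) := by
    intro m j
    induction j with
    | zero => simp
    | succ j ih => have := nn (m + j); push_cast; rw [← add_assoc]; omega
  have hlow : ∀ t, a (k t) - (T (k t + 1) - T (k t) : ℤ) ≤ f t := by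
    intro t
    have h1 := hdown (T (k t)) (t - T (k t))
    rw [hfT, Nat.add_sub_cancel' (hk1 t)] at h1
    have h2 := hk1 t
    have h3 := hk2 t
    omega
  -- shifted limits
  have hratio : Tendsto (fun n : ℕ => ((n + 1 : ℕ) : ℝ) / n) atTop (𝓝 1) := by
    have := tendsto_one_div_atTop_nhds_zero_nat (𝕜 := ℝ)
    have h2 := this.const_add 1
    rw [add_zero] at h2
    refine h2.congr' ?_
    filter_upwards [eventually_gt_atTop 0] with n hn
    have : (n : ℝ) ≠ 0 := by positivity
    push_cast; field_simp
  have hTl' : Tendsto (fun n : ℕ => (T (n + 1) : ℝ) / n) atTop (𝓝 E) := by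
    have := ((tendsto_add_atTop_iff_nat 1).2 hTl).mul hratio
    rw [mul_one] at this
    refine this.congr fun n => ?_
    have : ((n + 1 : ℕ) : ℝ) ≠ 0 := by positivity
    field_simp
  have hal' : Tendsto (fun n : ℕ => (a (n + 1) : ℝ) / n) atTop (𝓝 μ) := by
    have := ((tendsto_add_atTop_iff_nat 1).2 hal).mul hratio
    rw [mul_one] at this
    refine this.congr fun n => ?_
    have : ((n + 1 : ℕ) : ℝ) ≠ 0 := by positivity
    field_simp
  have hl : Tendsto (fun n : ℕ => ((a n : ℝ) - (T (n + 1) - T n)) / n) atTop (𝓝 μ) := by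
    have := hal.sub (hTl'.sub hTl)
    rw [sub_self, sub_zero] at this
    refine this.congr fun n => ?_
    ring
  have r1 : Tendsto (fun t : ℕ => (t : ℝ) / k t) atTop (𝓝 E) := by
    refine tendsto_of_tendsto_of_tendsto_of_le_of_le (hTl.comp hkt) (hTl'.comp hkt) ?_ ?_
    · intro t
      simp only [Function.comp]
      have := hk1 t
      gcongr
    · intro t
      simp only [Function.comp]
      have := (hk2 t).le
      gcongr
  have r2 : Tendsto (fun t : ℕ => (f t : ℝ) / k t) atTop (𝓝 μ) := by
    refine tendsto_of_tendsto_of_tendsto_of_le_of_le (hl.comp hkt) (hal'.comp hkt) ?_ ?_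
    · intro t
      simp only [Function.comp]
      have : ((a (k t) : ℝ) - (T (k t + 1) - T (k t))) ≤ f t := by exact_mod_cast hlow t
      gcongr
    · intro t
      simp only [Function.comp]
      have : (f t : ℝ) ≤ a (k t + 1) := by exact_mod_cast hup _ _ (hk2 t)
      gcongr
  refine (r2.div r1 hE.ne').congr' ?_
  filter_upwards [hkt.eventually_gt_atTop 0] with t ht
  have : (k t : ℝ) ≠ 0 := by positivity
  simp only [Pi.div_apply]
  rw [div_div_div_cancel_right₀ this]
end SRE


namespace SRE

lemma meas_sInf {α : Type*} [MeasurableSpace α] {A : α → Set ℕ}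
    (hA : ∀ t, MeasurableSet {x | t ∈ A x}) : Measurable fun x => sInf (A x) := by
  refine measurable_to_countable' fun n => ?_
  have e : (fun x => sInf (A x)) ⁻¹' {n} =
      ({x | n ∈ A x} ∩ ⋂ m : ℕ, ⋂ (_ : m < n), {x | m ∈ A x}ᶜ) ∪
        ({x | n = 0} ∩ ⋂ m : ℕ, {x | m ∈ A x}ᶜ) := by
    ext x
    simp only [mem_preimage, mem_singleton_iff, mem_union, mem_inter_iff, mem_ofPred_eq, mem_iInter,
      mem_compl_iff]
    constructor
    · intro h
      rcases (A x).eq_empty_or_nonempty with he | hne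
      · right
        rw [he] at h ⊢
        rw [Nat.sInf_empty] at h
        exact ⟨h.symm, fun m => by simp⟩
      · left
        refine ⟨h ▸ Nat.sInf_mem hne, fun m hm hmA => ?_⟩
        have := Nat.sInf_le hmA
        omega
    · rintro (⟨h1, h2⟩ | ⟨h1, h2⟩)
      · refine le_antisymm (Nat.sInf_le h1) ?_
        by_contra hcon
        push Not at hcon
        exact h2 _ hcon (Nat.sInf_mem ⟨n, h1⟩)
      · have : A x = ∅ := eq_empty_iff_forall_notMem.2 h2
        rw [this, Nat.sInf_empty, h1]
  rw [e]
  refine MeasurableSet.union ((hA n).inter ?_) (MeasurableSet.inter ?_ ?_)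
  · exact MeasurableSet.iInter fun m => MeasurableSet.iInter fun _ => (hA m).compl
  · exact MeasurableSet.const _
  · exact MeasurableSet.iInter fun m => (hA m).compl

/-- hitting time of the `k`-th marked site -/
def TT (s : Sq) (f : ℕ → ℤ) (k : ℕ) : ℕ := sInf {t | f t = aa s k}

/-- crossing times -/
def tau (s : Sq) (f : ℕ → ℤ) (k : ℕ) : ℕ := TT s f (k + 1) - TT s f k

structure NNhit (s : Sq) (f : ℕ → ℤ) : Prop where
  h0 : f 0 = 0
  nn : ∀ n, f (n + 1) = f n + 1 ∨ f (n + 1) = f n - 1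
  hit : ∀ k : ℕ, ∃ t, f t = aa s k

section
variable {s : Sq} {f : ℕ → ℤ}

lemma NNhit.up (h : NNhit s f) (n : ℕ) : f (n + 1) ≤ f n + 1 := by
  rcases h.nn n with h | h <;> omega
lemma NNhit.dn (h : NNhit s f) (n : ℕ) : f n - 1 ≤ f (n + 1) := by
  rcases h.nn n with h | h <;> omega

lemma NNhit.TT_mem (h : NNhit s f) (k : ℕ) : f (TT s f k) = aa s k := Nat.sInf_mem (h.hit k)
lemma TT_le {k t : ℕ} (h : f t = aa s k) : TT s f k ≤ t := Nat.sInf_le h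

lemma NNhit.TT_zero (h : NNhit s f) : TT s f 0 = 0 := by
  have := TT_le (s := s) (f := f) (k := 0) (t := 0) (by rw [h.h0]; simp [aa_zero])
  omega

lemma NNhit.lt_of_lt (h : NNhit s f) (k t : ℕ) (ht : t < TT s f k) : f t < aa s k := by
  rcases Nat.eq_zero_or_pos k with rfl | hk
  · rw [h.TT_zero] at ht; omega
  · refine below h.h0 h.up (by have := le_aa s k; omega) t fun u hu he => ?_
    have := TT_le he
    omega

lemma NNhit.TT_lt (h : NNhit s f) (k : ℕ) : TT s f k < TT s f (k + 1) := by
  have h1 := h.TT_mem (k + 1)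
  have h2 := aa_lt_succ s k
  by_contra hcon
  push Not at hcon
  push_cast at h1
  rcases hcon.eq_or_lt with he | hlt
  · have := h.TT_mem k
    rw [← he, h1] at this; omega
  · have := h.lt_of_lt k _ hlt
    omega

lemma NNhit.TT_mono (h : NNhit s f) : StrictMono (TT s f) := strictMono_nat_of_lt_succ h.TT_lt

lemma NNhit.sum_tau (h : NNhit s f) (n : ℕ) : ∑ i ∈ Finset.range n, tau s f i = TT s f n := by
  induction n with
  | zero => simp [h.TT_zero]
  | succ n ih =>
    rw [Finset.sum_range_succ, ih]
    have := h.TT_lt n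
    unfold tau; omega

def tl (s : Sq) (y : ℕ → ℕ) : ℕ → ℕ → List (ℤ × ℕ)
  | _, 0 => []
  | k, n + 1 => (aa s (k + 1), y k) :: tl s y (k + 1) n

lemma NNhit.step (h : NNhit s f) (k t : ℕ) :
    ((∀ u < t, f (TT s f k + u) ≠ aa s (k + 1)) ∧ f (TT s f k + t) = aa s (k + 1))
      ↔ TT s f k + t = TT s f (k + 1) := by
  have hlt := h.TT_lt k
  constructor
  · rintro ⟨h1, h2⟩
    have a := TT_le (s := s) (f := f) (k := k + 1) (t := TT s f k + t) (by push_cast; exact h2)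
    refine le_antisymm ?_ a
    by_contra hcon
    push Not at hcon
    refine h1 (TT s f (k + 1) - TT s f k) (by omega) ?_
    rw [Nat.add_sub_cancel' hlt.le, h.TT_mem]; push_cast; rfl
  · intro he
    refine ⟨fun u hu hf => ?_, ?_⟩
    · have := TT_le (s := s) (f := f) (k := k + 1) (t := TT s f k + u) (by push_cast; exact hf)
      omega
    · rw [he, h.TT_mem]; push_cast; rfl

lemma NNhit.mem_hitEv (h : NNhit s f) (y : ℕ → ℕ) (n : ℕ) : ∀ k,
    f ∈ hitEv (TT s f k) (tl s y k n) ↔ ∀ i < n, tau s f (k + i) = y (k + i) := by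
  induction n with
  | zero => intro k; simp [tl, hitEv]
  | succ n ih =>
    intro k
    have hlt := h.TT_lt k
    simp only [tl, hitEv, mem_inter_iff, mem_ofPred_eq]
    rw [h.step]
    constructor
    · rintro ⟨h1, h2⟩
      rw [h1, ih] at h2
      intro i hi
      rcases i with _ | i
      · simp only [add_zero, tau]; omega
      · have := h2 i (by omega)
        rwa [add_assoc, add_comm 1 i] at this
    · intro hi
      have h1 : TT s f k + y k = TT s f (k + 1) := by
        have := hi 0 (by omega)
        simp only [add_zero, tau] at this; omega
      refine ⟨h1, ?_⟩
      rw [h1, ih]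
      intro i hi'
      have := hi (i + 1) (by omega)
      rwa [add_assoc, add_comm 1 i]

lemma lw_tl (s : Sq) (y : ℕ → ℕ) (n : ℕ) : ∀ k : ℕ,
    lw (ps s) (qs s) (aa s k) (tl s y k n) = ∏ i ∈ Finset.range n, Fp (sh^[k + i] s) (y (k + i)) := by
  induction n with
  | zero => intro k; simp [tl, lw]
  | succ n ih =>
    intro k
    simp only [tl, lw]
    have := ih (k + 1)
    push_cast at this
    rw [this, Finset.prod_range_succ', mul_comm, add_zero, Fp_iter]
    congr 1
    refine Finset.prod_congr rfl fun i _ => ?_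
    rw [add_assoc, add_comm 1 i]

/-- cylinder probabilities of the crossing times -/
lemma measure_tau {ν : Measure (ℕ → ℤ)} (hν : IsQuenchedRW (en s) 0 ν) (hN : ∀ᵐ f ∂ν, NNhit s f)
    (y : ℕ → ℕ) (n : ℕ) :
    ν {f | ∀ i < n, tau s f i = y i} = ∏ i ∈ Finset.range n, Fp (sh^[i] s) (y i) := by
  have h0 : ∀ x, 0 ≤ en s x := fun x => (en_mem s x).1.le
  have h1 : ∀ x, en s x ≤ 1 := fun x => (en_mem s x).2.le
  have e := lw_tl s y n 0
  have e2 := measure_hitEv hν h0 h1 (tl s y 0 n)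
  simp only [Nat.cast_zero, aa_zero, zero_add] at e
  rw [← e]
  change ν (hitEv 0 _) = lw (ps s) (qs s) 0 _ at e2
  rw [← e2]
  apply measure_congr
  filter_upwards [hN] with f hf
  have := hf.mem_hitEv y n 0
  rw [hf.TT_zero] at this
  simp only [zero_add] at this
  exact propext this.symm
end

section
variable {Q : Measure Sq} {μ b : ℝ}

lemma mt_aa {s : Sq} (hR : ∀ k, Rr s k ≠ ⊤) (n : ℕ) : mt (ps s) (qs s) 0 (aa s n) ≠ ⊤ := by
  induction n with
  | zero => simp [aa_zero, mt_self]
  | succ n ih =>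
    push_cast
    rw [mt_add (pq s) (by have := le_aa s n; omega) (aa_lt_succ s n).le ih, aa_succ,
      mt_gap hR n _ le_rfl]
    have := hR n
    finiteness

lemma Good.nnhit (h : Good Q μ b) : ∀ᵐ s ∂Q, ∀ ν : Measure (ℕ → ℤ), IsQuenchedRW (en s) 0 ν →
    ∀ᵐ f ∂ν, NNhit s f := by
  filter_upwards [h.Rr_zero] with s hs ν hν
  have hR := Rr_all hs
  have := hν.1
  have h0 : ∀ x, 0 ≤ en s x := fun x => (en_mem s x).1.le
  have h1 : ∀ x, en s x ≤ 1 := fun x => (en_mem s x).2.le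
  have hh : ∀ k : ℕ, ∀ᵐ f ∂ν, ∃ t, f t = aa s k := by
    intro k
    have e : {f : ℕ → ℤ | ∃ t, f t = aa s k} = ⋃ t, hitEv 0 [(aa s k, t)] := by
      ext f
      simp only [hitEv, inter_univ, zero_add, mem_iUnion, mem_ofPred_eq]
      constructor
      · intro hex
        classical
        exact ⟨Nat.find hex, fun u hu => Nat.find_min hex hu, Nat.find_spec hex⟩
      · rintro ⟨t, -, ht⟩; exact ⟨t, ht⟩
    have hm : ∀ t (y : ℤ), MeasurableSet {f : ℕ → ℤ | f t = y} := fun t y =>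
      measurableSet_eq_fun (measurable_pi_apply t) measurable_const
    have hmeas : ∀ t, MeasurableSet (hitEv 0 [(aa s k, t)]) := by
      intro t
      have : hitEv 0 [(aa s k, t)] =
          (⋂ u : ℕ, ⋂ (_ : u < t), {f | f u = aa s k}ᶜ) ∩ {f | f t = aa s k} := by
        ext f; simp [hitEv]
      rw [this]
      exact (MeasurableSet.iInter fun u => MeasurableSet.iInter fun _ => (hm u _).compl).inter (hm t _)
    have hdis : Pairwise (Function.onFun Disjoint fun t => hitEv 0 [(aa s k, t)]) := by
      intro t u htu
      rw [Function.onFun, Set.disjoint_left]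
      intro f hf hf'
      simp only [hitEv, inter_univ, zero_add, mem_ofPred_eq] at hf hf'
      rcases lt_or_gt_of_ne htu with h | h
      · exact hf'.1 _ h hf.2
      · exact hf.1 _ h hf'.2
    have h2 : ν {f | ∃ t, f t = aa s k} = 1 := by
      rw [e, measure_iUnion hdis hmeas, ← tsum_fp_eq_one (pq s) (mt_aa hR k)]
      refine tsum_congr fun t => ?_
      rw [measure_hitEv hν h0 h1]
      simp [lw, ps, qs]
    rw [ae_iff]
    have h3 : MeasurableSet {f : ℕ → ℤ | ∃ t, f t = aa s k} := by
      rw [e]; exact MeasurableSet.iUnion hmeas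
    exact (prob_compl_eq_zero_iff h3).2 h2
  filter_upwards [nn_ae hν h0 h1, ae_all_iff.2 hh] with f hf1 hf2
  exact ⟨hf1.1, hf1.2, hf2⟩
end
end SRE


namespace SRE

def sft (x : ℕ → ℕ) : ℕ → ℕ := fun n => x (n + 1)

lemma meas_sft : Measurable sft := measurable_pi_lambda _ fun n => measurable_pi_apply _

def cylN (n : ℕ) (y : ℕ → ℕ) : Set (ℕ → ℕ) := {x | ∀ i < n, x i = y i}

lemma meas_cylN (n : ℕ) (y : ℕ → ℕ) : MeasurableSet (cylN n y) := by
  have : cylN n y = ⋂ i : ℕ, ⋂ (_ : i < n), {x | x i = y i} := by ext x; simp [cylN]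
  rw [this]
  exact MeasurableSet.iInter fun i => MeasurableSet.iInter fun _ =>
    measurableSet_eq_fun (measurable_pi_apply i) measurable_const

lemma ext_cylN {ν₁ ν₂ : Measure (ℕ → ℕ)} [IsProbabilityMeasure ν₁] [IsProbabilityMeasure ν₂]
    (h : ∀ n y, ν₁ (cylN n y) = ν₂ (cylN n y)) : ν₁ = ν₂ := by
  refine ext_of_generate_finite {A | ∃ n y, A = cylN n y} ?_ ?_ ?_ (by simp)
  · apply le_antisymm
    · rw [MeasurableSpace.pi]
      refine iSup_le fun n => ?_
      rw [← measurable_iff_comap_le]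
      refine @measurable_to_countable' _ _ _ _ (MeasurableSpace.generateFrom _) _ fun j => ?_
      have e : (fun x : ℕ → ℕ => x n) ⁻¹' {j} =
          ⋃ L : List ℕ, ⋃ (_ : L.getD n 0 = j), cylN (n + 1) (fun i => L.getD i 0) := by
        ext x
        simp only [mem_preimage, mem_singleton_iff, mem_iUnion, exists_prop, cylN, mem_ofPred_eq]
        constructor
        · intro hx
          have hL : ∀ i < n + 1, ((List.range (n + 1)).map x).getD i 0 = x i := by
            intro i hi
            rw [List.getD_eq_getElem _ _ (by simpa using hi)]
            simp
          exact ⟨(List.range (n + 1)).map x, by rw [hL n (by omega), hx],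
            fun i hi => (hL i hi).symm⟩
        · rintro ⟨L, h1, h2⟩
          rw [h2 n (by omega), h1]
      rw [e]
      refine MeasurableSet.iUnion fun L => MeasurableSet.iUnion fun _ => ?_
      exact MeasurableSpace.measurableSet_generateFrom ⟨_, _, rfl⟩
    · refine MeasurableSpace.generateFrom_le ?_
      rintro _ ⟨n, y, rfl⟩
      exact meas_cylN n y
  · rintro _ ⟨n, y, rfl⟩ _ ⟨m, z, rfl⟩ ⟨w, hw1, hw2⟩
    refine ⟨max n m, w, ?_⟩
    ext x
    simp only [cylN, mem_inter_iff, mem_ofPred_eq] at hw1 hw2 ⊢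
    constructor
    · rintro ⟨h1, h2⟩ i hi
      rcases lt_max_iff.1 hi with h | h
      · rw [h1 i h, hw1 i h]
      · rw [h2 i h, hw2 i h]
    · intro h1
      exact ⟨fun i hi => by rw [h1 i (lt_max_of_lt_left hi), hw1 i hi],
        fun i hi => by rw [h1 i (lt_max_of_lt_right hi), hw2 i hi]⟩
  · rintro _ ⟨n, y, rfl⟩; exact h n y

section
variable {Ω : Type*} [MeasurableSpace Ω] {P : Measure Ω} [IsProbabilityMeasure P]
  {K : Kernel Ω (ℕ → ℤ)} [IsMarkovKernel K] {S : Ω → Sq} {μ b : ℝ}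

lemma meas_hitset (hS : Measurable S) (k : ℤ) (t : ℕ) :
    MeasurableSet {p : Ω × (ℕ → ℤ) | p.2 t = aa (S p.1) k} :=
  measurableSet_eq_fun ((measurable_pi_apply t).comp measurable_snd)
    ((meas_aa k).comp (hS.comp measurable_fst))

lemma meas_TT (hS : Measurable S) (k : ℕ) :
    Measurable fun p : Ω × (ℕ → ℤ) => TT (S p.1) p.2 k :=
  meas_sInf (A := fun p : Ω × (ℕ → ℤ) => {t | p.2 t = aa (S p.1) k}) fun t => meas_hitset hS k t

lemma meas_tau (hS : Measurable S) :
    Measurable fun p : Ω × (ℕ → ℤ) => tau (S p.1) p.2 :=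
  measurable_pi_lambda _ fun k => (meas_TT hS (k + 1)).sub (meas_TT hS k)

lemma meas_NN (hS : Measurable S) : MeasurableSet {p : Ω × (ℕ → ℤ) | NNhit (S p.1) p.2} := by
  have e : {p : Ω × (ℕ → ℤ) | NNhit (S p.1) p.2} = {p | p.2 0 = 0} ∩
      ((⋂ n : ℕ, ({p | p.2 (n + 1) = p.2 n + 1} ∪ {p | p.2 (n + 1) = p.2 n - 1})) ∩
        ⋂ k : ℕ, ⋃ t : ℕ, {p | p.2 t = aa (S p.1) k}) := by
    ext p
    simp only [mem_ofPred_eq, mem_inter_iff, mem_iInter, mem_union, mem_iUnion]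
    exact ⟨fun h => ⟨h.h0, h.nn, h.hit⟩, fun h => ⟨h.1, h.2.1, h.2.2⟩⟩
  have hc : ∀ t : ℕ, Measurable fun p : Ω × (ℕ → ℤ) => p.2 t := fun t =>
    (measurable_pi_apply t).comp measurable_snd
  rw [e]
  refine (measurableSet_eq_fun (hc 0) measurable_const).inter (MeasurableSet.inter ?_ ?_)
  · exact MeasurableSet.iInter fun n => (measurableSet_eq_fun (hc _) ((hc n).add_const 1)).union
      (measurableSet_eq_fun (hc _) ((hc n).sub_const 1))
  · exact MeasurableSet.iInter fun k => MeasurableSet.iUnion fun t => meas_hitset hS k t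

lemma nnhit_ae (hS : Measurable S) (h : Good (P.map S) μ b)
    (hK : ∀ᵐ ω ∂P, IsQuenchedRW (en (S ω)) 0 (K ω)) :
    ∀ᵐ p ∂(P ⊗ₘ K), NNhit (S p.1) p.2 := by
  refine Measure.ae_compProd_of_ae_ae (meas_NN hS) ?_
  filter_upwards [ae_of_ae_map hS.aemeasurable h.nnhit, hK] with ω h1 h2
  exact h1 _ h2

/-- law of the sequence of crossing times -/
def nuT (P : Measure Ω) (K : Kernel Ω (ℕ → ℤ)) (S : Ω → Sq) : Measure (ℕ → ℕ) :=
  (P ⊗ₘ K).map fun p => tau (S p.1) p.2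

lemma nuT_prob (hS : Measurable S) : IsProbabilityMeasure (nuT P K S) :=
  Measure.isProbabilityMeasure_map (meas_tau hS).aemeasurable

lemma meas_prodF (n k : ℕ) (y : ℕ → ℕ) :
    Measurable fun s : Sq => ∏ i ∈ Finset.range n, Fp (sh^[i + k] s) (y i) :=
  Finset.measurable_fun_prod _ fun i _ => (meas_Fp _).comp (meas_sh.iterate _)

lemma nuT_cyl (hS : Measurable S) (h : Good (P.map S) μ b)
    (hK : ∀ᵐ ω ∂P, IsQuenchedRW (en (S ω)) 0 (K ω)) (n : ℕ) (y : ℕ → ℕ) :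
    nuT P K S (cylN n y) = ∫⁻ s, ∏ i ∈ Finset.range n, Fp (sh^[i] s) (y i) ∂(P.map S) := by
  have hm : Measurable fun s : Sq => ∏ i ∈ Finset.range n, Fp (sh^[i] s) (y i) := meas_prodF n 0 y
  rw [nuT, Measure.map_apply (meas_tau hS) (meas_cylN n y),
    Measure.compProd_apply ((meas_tau hS) (meas_cylN n y)), lintegral_map hm hS]
  refine lintegral_congr_ae ?_
  filter_upwards [ae_of_ae_map hS.aemeasurable h.nnhit, hK] with ω h1 h2
  exact measure_tau h2 (h1 _ h2) y n

lemma Good.Fp_sum {Q : Measure Sq} (h : Good Q μ b) : ∀ᵐ s ∂Q, ∑' t, Fp s t = 1 := by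
  filter_upwards [h.Mt_ae] with s hs
  exact tsum_fp_eq_one (pq s) hs.2

lemma nuT_shift (hS : Measurable S) (h : Good (P.map S) μ b)
    (hK : ∀ᵐ ω ∂P, IsQuenchedRW (en (S ω)) 0 (K ω)) :
    MeasurePreserving sft (nuT P K S) (nuT P K S) := by
  refine ⟨meas_sft, ?_⟩
  have := nuT_prob (P := P) (K := K) hS
  have : IsProbabilityMeasure ((nuT P K S).map sft) :=
    Measure.isProbabilityMeasure_map meas_sft.aemeasurable
  refine ext_cylN fun n y => ?_
  rw [Measure.map_apply meas_sft (meas_cylN n y)]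
  set z : ℕ → ℕ → ℕ := fun t i => Nat.casesOn i t y with hz
  have e : sft ⁻¹' cylN n y = ⋃ t : ℕ, cylN (n + 1) (z t) := by
    ext x
    simp only [mem_preimage, mem_iUnion, cylN, mem_ofPred_eq, sft]
    constructor
    · intro hx
      refine ⟨x 0, fun i hi => ?_⟩
      rcases i with _ | i
      · rfl
      · exact hx i (by omega)
    · rintro ⟨t, ht⟩ i hi
      exact ht (i + 1) (by omega)
  have hdis : Pairwise (Function.onFun Disjoint fun t => cylN (n + 1) (z t)) := by
    intro t u htu
    rw [Function.onFun, Set.disjoint_left]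
    intro x hx hx'
    have h1 : x 0 = t := hx 0 (by omega)
    have h2 : x 0 = u := hx' 0 (by omega)
    exact htu (h1.symm.trans h2)
  rw [e, measure_iUnion hdis fun t => meas_cylN _ _, nuT_cyl hS h hK]
  have e2 : ∀ t, nuT P K S (cylN (n + 1) (z t)) =
      ∫⁻ s, Fp s t * ∏ i ∈ Finset.range n, Fp (sh^[i + 1] s) (y i) ∂(P.map S) := by
    intro t
    rw [nuT_cyl hS h hK]
    refine lintegral_congr fun s => ?_
    rw [Finset.prod_range_succ', mul_comm]
    rfl
  have hm : ∀ t, Measurable fun s : Sq => Fp s t * ∏ i ∈ Finset.range n, Fp (sh^[i + 1] s) (y i) :=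
    fun t => (meas_Fp t).mul (meas_prodF n 1 y)
  simp_rw [e2]
  rw [← lintegral_tsum fun t => (hm t).aemeasurable]
  have e3 : ∫⁻ s, ∑' t, Fp s t * ∏ i ∈ Finset.range n, Fp (sh^[i + 1] s) (y i) ∂(P.map S) =
      ∫⁻ s, ∏ i ∈ Finset.range n, Fp (sh^[i] (sh s)) (y i) ∂(P.map S) := by
    refine lintegral_congr_ae ?_
    filter_upwards [h.Fp_sum] with s hs
    rw [ENNReal.tsum_mul_right, hs, one_mul]
    rfl
  rw [e3]
  exact h.mp.lintegral_comp (meas_prodF n 0 y)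

lemma nuT_mean (hS : Measurable S) (h : Good (P.map S) μ b)
    (hK : ∀ᵐ ω ∂P, IsQuenchedRW (en (S ω)) 0 (K ω)) :
    ∫⁻ x, (x 0 : ℝ≥0∞) ∂(nuT P K S) ≤ EM (P.map S) := by
  have e : ∫⁻ x, (x 0 : ℝ≥0∞) ∂(nuT P K S) =
      ∫⁻ t : ℕ, (t : ℝ≥0∞) ∂((nuT P K S).map fun x => x 0) := by
    rw [lintegral_map measurable_from_top (measurable_pi_apply 0)]
  rw [e, lintegral_countable']
  have e2 : ∀ t : ℕ, ((nuT P K S).map fun x => x 0) {t} = ∫⁻ s, Fp s t ∂(P.map S) := by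
    intro t
    rw [Measure.map_apply (measurable_pi_apply 0) (measurableSet_singleton t)]
    have : (fun x : ℕ → ℕ => x 0) ⁻¹' {t} = cylN 1 (fun _ => t) := by
      ext x; simp [cylN]
    rw [this, nuT_cyl hS h hK]
    simp
  simp_rw [e2]
  have e3 : ∀ t : ℕ, (t : ℝ≥0∞) * ∫⁻ s, Fp s t ∂(P.map S) = ∫⁻ s, (t : ℝ≥0∞) * Fp s t ∂(P.map S) :=
    fun t => (lintegral_const_mul _ (meas_Fp t)).symm
  simp_rw [e3]
  rw [← lintegral_tsum fun t => ((meas_Fp t).const_mul _).aemeasurable]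
  exact lintegral_mono fun s => tsum_mul_fp_le (pq s) _ _

end
end SRE


namespace SRE
section
variable {Ω : Type*} [MeasurableSpace Ω] {P : Measure Ω} [IsProbabilityMeasure P]
  {K : Kernel Ω (ℕ → ℤ)} [IsMarkovKernel K] {S : Ω → Sq} {μ b : ℝ}

lemma meas_ev {α : Type*} [MeasurableSpace α] {A : ℕ → α → Prop}
    (hA : ∀ n, MeasurableSet {x | A n x}) : MeasurableSet {x | ∀ᶠ n in atTop, A n x} := by
  have : {x | ∀ᶠ n in atTop, A n x} = ⋃ N : ℕ, ⋂ n : ℕ, ⋂ (_ : N ≤ n), {x | A n x} := by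
    ext x; simp [eventually_atTop]
  rw [this]
  exact MeasurableSet.iUnion fun N => MeasurableSet.iInter fun n => MeasurableSet.iInter fun _ => hA n

lemma TT_lower (hS : Measurable S) (h : Good (P.map S) μ b)
    (hK : ∀ᵐ ω ∂P, IsQuenchedRW (en (S ω)) 0 (K ω)) {c : ℝ} (hc0 : 0 ≤ c)
    (hc : ENNReal.ofReal c < EM (P.map S)) :
    ∀ᵐ p ∂(P ⊗ₘ K), ∀ᶠ n : ℕ in atTop, c * n ≤ (TT (S p.1) p.2 n : ℝ) := by
  refine Measure.ae_compProd_of_ae_ae (meas_ev fun n => ?_) ?_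
  · exact measurableSet_le measurable_const (measurable_from_top.comp (meas_TT hS n))
  · filter_upwards [ae_of_ae_map hS.aemeasurable h.nnhit,
      ae_of_ae_map hS.aemeasurable (h.lower hc0 hc), hK] with ω h1 h2 h3
    filter_upwards [h1 _ h3, h2 _ h3] with f hf1 hf2
    filter_upwards [hf2] with n hn
    by_contra hcon
    push Not at hcon
    exact hn _ hcon.le (hf1.TT_mem n)

lemma TT_lim (hS : Measurable S) (h : Good (P.map S) μ b)
    (hK : ∀ᵐ ω ∂P, IsQuenchedRW (en (S ω)) 0 (K ω)) (hE : EM (P.map S) ≠ ⊤) :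
    ∀ᵐ p ∂(P ⊗ₘ K), Tendsto (fun n : ℕ => (TT (S p.1) p.2 n : ℝ) / n) atTop
      (𝓝 (EM (P.map S)).toReal) := by
  set E := (EM (P.map S)).toReal with hEd
  have := nuT_prob (P := P) (K := K) hS
  have hNN := nnhit_ae hS h hK
  set g : (ℕ → ℕ) → ℝ := fun x => (x 0 : ℝ) with hg
  have hgm : Measurable g := measurable_from_top.comp (measurable_pi_apply 0)
  have hmean := nuT_mean hS h hK
  have hge : ∀ x : ℕ → ℕ, ENNReal.ofReal (g x) = (x 0 : ℝ≥0∞) := fun x => by simp [hg]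
  have hgi : Integrable g (nuT P K S) := by
    refine ⟨hgm.aestronglyMeasurable, ?_⟩
    rw [hasFiniteIntegral_iff_ofReal (ae_of_all _ fun x => by simp [hg])]
    simp_rw [hge]
    exact hmean.trans_lt (lt_top_iff_ne_top.2 hE)
  have hI : ∫ x, g x ∂(nuT P K S) ≤ E := by
    rw [integral_eq_lintegral_of_nonneg_ae (ae_of_all _ fun x => by simp [hg])
      hgm.aestronglyMeasurable]
    simp_rw [hge]
    exact ENNReal.toReal_mono hE hmean
  have hbs : ∀ n x, birkhoffSum sft g n x = ∑ i ∈ Finset.range n, (x i : ℝ) := by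
    intro n x
    unfold birkhoffSum
    refine Finset.sum_congr rfl fun i _ => ?_
    have : ∀ i k, (sft^[i] x) k = x (k + i) := by
      intro i
      induction i with
      | zero => intro k; rfl
      | succ i ih =>
        intro k
        rw [Function.iterate_succ_apply']
        change (sft^[i] x) (k + 1) = _
        rw [ih]; congr 1; omega
    simp only [hg, this, zero_add]
  have htel : ∀ᵐ p ∂(P ⊗ₘ K), ∀ n : ℕ,
      birkhoffSum sft g n (tau (S p.1) p.2) = (TT (S p.1) p.2 n : ℝ) := by
    filter_upwards [hNN] with p hp n
    rw [hbs, ← hp.sum_tau n]; push_cast; rfl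
  have hcase : ∀ c : ℝ, 0 ≤ c → c < E → ∀ᵐ p ∂(P ⊗ₘ K), ∀ᶠ n : ℕ in atTop,
      c * n ≤ (TT (S p.1) p.2 n : ℝ) := by
    intro c hc0 hc
    refine TT_lower hS h hK hc0 ?_
    exact (ENNReal.ofReal_lt_iff_lt_toReal hc0 hE).2 hc
  have hlowq : ∀ᵐ x ∂(nuT P K S), ∀ q : ℚ, 0 ≤ (q : ℝ) → (q : ℝ) < E → ∀ᶠ n : ℕ in atTop,
      (q : ℝ) * n ≤ birkhoffSum sft g n x := by
    rw [ae_all_iff]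
    intro q
    by_cases hq0 : 0 ≤ (q : ℝ)
    · by_cases hq1 : (q : ℝ) < E
      · simp only [hq0, hq1, forall_true_left]
        have hset : MeasurableSet {x : ℕ → ℕ | ∀ᶠ n : ℕ in atTop,
            (q : ℝ) * n ≤ birkhoffSum sft g n x} := by
          refine meas_ev fun n => measurableSet_le measurable_const ?_
          have e : birkhoffSum sft g n = fun x => ∑ i ∈ Finset.range n, (x i : ℝ) := funext (hbs n)
          rw [e]
          exact Finset.measurable_fun_sum _ fun i _ => measurable_from_top.comp (measurable_pi_apply i)
        unfold nuT
        rw [ae_map_iff (meas_tau hS).aemeasurable hset]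
        filter_upwards [hcase q hq0 hq1, htel] with p h1 h2
        filter_upwards [h1] with n hn
        rw [h2]; exact hn
      · exact ae_of_all _ fun x _ hh => absurd hh hq1
    · exact ae_of_all _ fun x hh => absurd hh hq0
  have hlow : ∀ᵐ x ∂(nuT P K S), ∀ β < ∫ x, g x ∂(nuT P K S), ∀ᶠ n : ℕ in atTop,
      β * n ≤ birkhoffSum sft g n x := by
    filter_upwards [hlowq] with x hx β hβ
    have hnn : ∀ n, 0 ≤ birkhoffSum sft g n x := fun n => by rw [hbs]; positivity
    rcases lt_or_ge β 0 with hb0 | hb0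
    · refine Eventually.of_forall fun n => le_trans ?_ (hnn n)
      exact mul_nonpos_of_nonpos_of_nonneg hb0.le (by positivity)
    · obtain ⟨q, hq1, hq2⟩ := exists_rat_btwn (hβ.trans_le hI)
      filter_upwards [hx q (by linarith) hq2] with n hn
      refine le_trans ?_ hn
      gcongr
  have hB := birkhoff_of_lower (nuT_shift hS h hK) hgm hgi hlow
  have hB' : ∀ᵐ p ∂(P ⊗ₘ K), Tendsto (fun n : ℕ => (TT (S p.1) p.2 n : ℝ) / n) atTop
      (𝓝 (∫ x, g x ∂(nuT P K S))) := by
    have := ae_of_ae_map (meas_tau hS).aemeasurable hB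
    filter_upwards [this, htel] with p h1 h2
    simpa only [h2] using h1
  have hIE : ∫ x, g x ∂(nuT P K S) = E := by
    refine le_antisymm hI ?_
    by_contra hcon
    push Not at hcon
    obtain ⟨c, hc1, hc2⟩ := exists_between hcon
    have hI0 : 0 ≤ ∫ x, g x ∂(nuT P K S) := integral_nonneg fun x => by simp [hg]
    obtain ⟨p, hp1, hp2⟩ := (hB'.and (hcase c (hI0.trans hc1.le) hc2)).exists
    have : c ≤ ∫ x, g x ∂(nuT P K S) := by
      refine ge_of_tendsto hp1 ?_
      filter_upwards [hp2, eventually_gt_atTop 0] with n h1 h2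
      have : (0 : ℝ) < n := by exact_mod_cast h2
      rwa [le_div_iff₀ this]
    linarith
  rwa [hIE] at hB'

lemma EM_pos (h : Good (P.map S) μ b) : 0 < EM (P.map S) :=
  lt_of_lt_of_le (ENNReal.ofReal_pos.2 h.D0_pos) h.EM_ge

/-- the speed -/
lemma speed_ae (hS : Measurable S) (h : Good (P.map S) μ b)
    (hK : ∀ᵐ ω ∂P, IsQuenchedRW (en (S ω)) 0 (K ω)) :
    ∀ᵐ p ∂(P ⊗ₘ K), Tendsto (fun n : ℕ => (p.2 n : ℝ) / (n : ℝ)) atTop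
      (𝓝 (μ / (EM (P.map S)).toReal)) := by
  have hmeas : ∀ v : ℝ, MeasurableSet {p : Ω × (ℕ → ℤ) |
      Tendsto (fun n : ℕ => (p.2 n : ℝ) / (n : ℝ)) atTop (𝓝 v)} := by
    intro v
    refine measurableSet_tendsto (𝓝 v) fun n => ?_
    exact (measurable_from_top.comp ((measurable_pi_apply n).comp measurable_snd)).div_const _
  by_cases hE : EM (P.map S) = ⊤
  · rw [hE, ENNReal.toReal_top, div_zero]
    refine Measure.ae_compProd_of_ae_ae (hmeas 0) ?_
    have hlow : ∀ᵐ s ∂(P.map S), ∀ c : ℕ, ∀ ν : Measure (ℕ → ℤ), IsQuenchedRW (en s) 0 ν →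
        ∀ᵐ f ∂ν, ∀ᶠ n : ℕ in atTop, ∀ t : ℕ, (t : ℝ) ≤ (c : ℝ) * n → f t ≠ aa s n := by
      rw [ae_all_iff]
      intro c
      refine h.lower (by positivity) ?_
      rw [hE]; exact ENNReal.ofReal_lt_top
    filter_upwards [ae_of_ae_map hS.aemeasurable h.nnhit, ae_of_ae_map hS.aemeasurable hlow,
      ae_of_ae_map hS.aemeasurable h.lower_neg, ae_of_ae_map hS.aemeasurable h.aa_lim,
      ae_of_ae_map hS.aemeasurable h.aam_lim, hK] with ω h1 h2 h3 h4 h5 h6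
    have h2' : ∀ᵐ f ∂(K ω), ∀ c : ℕ, ∀ᶠ n : ℕ in atTop, ∀ t : ℕ, (t : ℝ) ≤ (c : ℝ) * n →
        f t ≠ aa (S ω) n := ae_all_iff.2 fun c => h2 c _ h6
    have h3' : ∀ᵐ f ∂(K ω), ∀ c : ℕ, ∀ᶠ n : ℕ in atTop, ∀ t : ℕ, (t : ℝ) ≤ (c : ℝ) * n →
        f t ≠ aa (S ω) (-n) := ae_all_iff.2 fun c => h3 _ h6 c (by positivity)
    filter_upwards [h1 _ h6, h2', h3'] with f hf1 hf2 hf3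
    exact zero_speed hf1.h0 hf1.nn h.mpos (fun n => le_aa _ n) h4 (fun n => aa_neg_le _ n) h5 hf2 hf3
  · have haa : ∀ᵐ p ∂(P ⊗ₘ K), Tendsto (fun n : ℕ => (aa (S p.1) n : ℝ) / n) atTop (𝓝 μ) := by
      refine Measure.ae_compProd_of_ae_ae ?_ ?_
      · refine measurableSet_tendsto (𝓝 μ) fun n => ?_
        exact (measurable_from_top.comp ((meas_aa n).comp (hS.comp measurable_fst))).div_const _
      · filter_upwards [ae_of_ae_map hS.aemeasurable h.aa_lim] with ω h1
        exact ae_of_all _ fun _ => h1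
    filter_upwards [nnhit_ae hS h hK, TT_lim hS h hK hE, haa] with p h1 h2 h3
    exact speed (T := TT (S p.1) p.2) (a := fun k => aa (S p.1) k) h1.TT_mono h1.TT_zero h1.TT_mem
      (fun k t ht => (h1.lt_of_lt k t ht).le) h1.dn
      (ENNReal.toReal_pos (EM_pos h).ne' hE) h2 h3
end
end SRE


namespace SRE
section
variable {Ω : Type*} [MeasurableSpace Ω]

def SS (lam : ℤ → Ω → ℝ) (d : ℤ → Ω → ℕ) (ω : Ω) : Sq := fun n => (lam n ω, d n ω)

variable {P : Measure Ω} {lam : ℤ → Ω → ℝ} {d : ℤ → Ω → ℕ} {a : ℤ → Ω → ℤ}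

lemma meas_SS (h1 : ∀ k, Measurable (lam k)) (h2 : ∀ k, Measurable (d k)) : Measurable (SS lam d) :=
  measurable_pi_lambda _ fun n => (h1 n).prodMk (h2 n)

lemma dd_SS (hd : ∀ k ω, 1 ≤ d k ω) (ω : Ω) (k : ℤ) : dd (SS lam d ω) k = d k ω :=
  max_eq_right (hd k ω)

lemma ll_SS {ω : Ω} {k : ℤ} (h : lam k ω ∈ Ioo (0 : ℝ) 1) : ll (SS lam d ω) k = lam k ω :=
  if_pos h

lemma aa_SS (hd : ∀ k ω, 1 ≤ d k ω) (ha0 : ∀ ω, a 0 ω = 0)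
    (ha : ∀ ω, ∀ k : ℤ, a k ω - a (k - 1) ω = d k ω) (ω : Ω) (k : ℤ) :
    aa (SS lam d ω) k = a k ω := by
  refine aa_uniq (aa (SS lam d ω)) (fun k => a k ω) (by simp [aa_zero, ha0]) (fun k => ?_) k
  rw [aa_rec, dd_SS hd, ha]

lemma indep_map {Q β γ : Type*} [MeasurableSpace Q] [MeasurableSpace β] [MeasurableSpace γ]
    {S : Ω → Q} {f : Q → β} {g : Q → γ} (hS : Measurable S) (hf : Measurable f) (hg : Measurable g)
    (h : IndepFun (fun ω => f (S ω)) (fun ω => g (S ω)) P) : IndepFun f g (P.map S) := by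
  rw [indepFun_iff_measure_inter_preimage_eq_mul] at h ⊢
  intro s t hs ht
  rw [Measure.map_apply hS ((hf hs).inter (hg ht)), Measure.map_apply hS (hf hs),
    Measure.map_apply hS (hg ht)]
  exact h s t hs ht
end
end SRE

theorem statement5
    {Ω : Type*} [MeasurableSpace Ω] (P : Measure Ω) [IsProbabilityMeasure P]
    (lam : ℤ → Ω → ℝ) (d : ℤ → Ω → ℕ) (a : ℤ → Ω → ℤ)
    (μ b : ℝ) (hμ : 0 < μ) (hb : b < 0)
    (hlam_meas : ∀ k, Measurable (lam k)) (hd_meas : ∀ k, Measurable (d k))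
    (hlam01 : ∀ k, ∀ᵐ ω ∂P, lam k ω ∈ Set.Ioo (0 : ℝ) 1)
    (hd_pos : ∀ k ω, 1 ≤ d k ω)
    (ha0 : ∀ ω, a 0 ω = 0)
    (ha_rec : ∀ ω, ∀ k : ℤ, a k ω - a (k - 1) ω = d k ω)
    (h_erg : Ergodic (fun f : ℤ → ℝ × ℕ => fun n => f (n + 1))
      (P.map fun ω => fun n : ℤ => (lam n ω, d n ω)))
    (hlogd : ∫⁻ ω, ENNReal.ofReal (Real.log (d 0 ω)) ∂P ≠ ⊤)
    (h_indep : IndepFun (fun ω => fun k : ℤ => d k ω) (fun ω => fun k : ℤ => lam k ω) P)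
    -- `E_P(d_0) = μ`
    (hd_mean : ∫⁻ ω, (d 0 ω : ℝ≥0∞) ∂P = ENNReal.ofReal μ)
    -- `E_P(log ξ_0) = b`
    (hxi_int : Integrable (fun ω => Real.log ((1 - lam 0 ω) / lam 0 ω)) P)
    (hxi_mean : ∫ ω, Real.log ((1 - lam 0 ω) / lam 0 ω) ∂P = b)
    -- quenched law and annealed law
    (K : Kernel Ω (ℕ → ℤ)) [IsMarkovKernel K]
    (hK : ∀ ω, IsQuenchedRW (sparseEnv (fun k => lam k ω) (fun k => a k ω)) 0 (K ω)) :
    ∃ v : ℝ,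
      (∀ᵐ p ∂(P ⊗ₘ K), Tendsto (fun n : ℕ => (p.2 n : ℝ) / (n : ℝ)) atTop (𝓝 v)) ∧
      v ≤ (1 / μ) * ((1 - Real.exp b) / (1 + Real.exp b)) ∧
      (v = (1 / μ) * ((1 - Real.exp b) / (1 + Real.exp b)) ↔
        (∃ c : ℕ, ∀ᵐ ω ∂P, d 0 ω = c) ∧ (∃ c : ℝ, ∀ᵐ ω ∂P, lam 0 ω = c)) ∧
      (v = (1 / μ) * ((1 - Real.exp b) / (1 + Real.exp b)) →
        ∀ᵐ ω ∂P, lam 0 ω = 1 / (1 + Real.exp b)) := by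
  have hS := SRE.meas_SS hlam_meas hd_meas
  have hall : ∀ᵐ ω ∂P, ∀ k, SRE.ll (SRE.SS lam d ω) k = lam k ω := by
    rw [ae_all_iff]
    intro k
    filter_upwards [hlam01 k] with ω hω
    exact SRE.ll_SS hω
  have hdd := SRE.dd_SS (lam := lam) hd_pos
  have haa := SRE.aa_SS (lam := lam) hd_pos ha0 ha_rec
  have hlog : (fun ω => Real.log (SRE.xi (SRE.SS lam d ω) 0)) =ᵐ[P]
      fun ω => Real.log ((1 - lam 0 ω) / lam 0 ω) := by
    filter_upwards [hall] with ω hω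
    simp only [SRE.xi, hω 0]
  have hlm : Measurable fun s : SRE.Sq => Real.log (SRE.xi s 0) := (SRE.meas_xi 0).log
  have hG : SRE.Good (P.map (SRE.SS lam d)) μ b := by
    refine ⟨Measure.isProbabilityMeasure_map hS.aemeasurable, h_erg, ?_, ?_, ?_, ?_, hμ, hb⟩
    · rw [lintegral_map (SRE.meas_dde 0) hS, ← hd_mean]
      simp only [hdd]
    · rw [integrable_map_measure hlm.aestronglyMeasurable hS.aemeasurable]
      exact hxi_int.congr hlog.symm
    · rw [integral_map hS.aemeasurable hlm.aestronglyMeasurable, integral_congr_ae hlog, hxi_mean]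
    · refine SRE.indep_map hS (measurable_pi_lambda _ SRE.meas_dd)
        (measurable_pi_lambda _ SRE.meas_ll) ?_
      refine h_indep.congr ?_ ?_
      · exact ae_of_all _ fun ω => by funext k; exact (hdd ω k).symm
      · filter_upwards [hall] with ω hω
        funext k; exact (hω k).symm
  have hKq : ∀ᵐ ω ∂P, IsQuenchedRW (SRE.en (SRE.SS lam d ω)) 0 (K ω) := by
    filter_upwards [hall] with ω hω
    have e : SRE.en (SRE.SS lam d ω) = sparseEnv (fun k => lam k ω) (fun k => a k ω) := by
      unfold SRE.en
      rw [show SRE.ll (SRE.SS lam d ω) = fun k => lam k ω from funext hω,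
        show SRE.aa (SRE.SS lam d ω) = fun k => a k ω from funext (haa ω)]
    rw [e]; exact hK ω
  have hDpos := hG.D0_pos
  have hge := hG.EM_ge
  have hr1 := hG.r1
  have hr0 := Real.exp_pos b
  set Q := P.map (SRE.SS lam d) with hQ
  have hval : (1 / μ) * ((1 - Real.exp b) / (1 + Real.exp b)) = μ / SRE.D0 μ b := by
    unfold SRE.D0
    have : 1 - Real.exp b ≠ 0 := by linarith
    field_simp
  rw [hval]
  have hDnn : 0 < μ / SRE.D0 μ b := div_pos hμ hDpos
  have hiff : μ / (SRE.EM Q).toReal = μ / SRE.D0 μ b ↔ SRE.EM Q = ENNReal.ofReal (SRE.D0 μ b) := by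
    constructor
    · intro h
      have hne : (SRE.EM Q).toReal ≠ 0 := by
        intro h0
        rw [h0, div_zero] at h
        linarith
      have hne' : SRE.EM Q ≠ ⊤ := fun h0 => hne (by rw [h0, ENNReal.toReal_top])
      rw [div_eq_div_iff hne hDpos.ne'] at h
      have : SRE.D0 μ b = (SRE.EM Q).toReal := mul_left_cancel₀ hμ.ne' h
      rw [this, ENNReal.ofReal_toReal hne']
    · intro h
      rw [h, ENNReal.toReal_ofReal hDpos.le]
  have hl : SRE.EM Q = ENNReal.ofReal (SRE.D0 μ b) → ∀ᵐ ω ∂P, lam 0 ω = 1 / (1 + Real.exp b) := by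
    intro h
    filter_upwards [ae_of_ae_map hS.aemeasurable (hG.EM_eq_l h), hall, hlam01 0] with ω h1 h2 h3
    have h4 := SRE.xi_pos (SRE.SS lam d ω) 0
    have h5 : SRE.xi (SRE.SS lam d ω) 0 = Real.exp b := by rw [← h1, Real.exp_log h4]
    rw [SRE.xi, h2 0, div_eq_iff h3.1.ne'] at h5
    rw [eq_div_iff (by positivity)]
    linarith
  refine ⟨μ / (SRE.EM Q).toReal, SRE.speed_ae hS hG hKq, ?_, ?_, ?_⟩
  · by_cases hE : SRE.EM Q = ⊤
    · rw [hE, ENNReal.toReal_top, div_zero]; exact hDnn.le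
    · have : SRE.D0 μ b ≤ (SRE.EM Q).toReal := (ENNReal.ofReal_le_iff_le_toReal hE).1 hge
      exact div_le_div_of_nonneg_left hμ.le hDpos this
  · rw [hiff]
    constructor
    · intro h
      refine ⟨?_, _, hl h⟩
      obtain ⟨c, hc⟩ := hG.EM_eq_d h
      refine ⟨c, ?_⟩
      filter_upwards [ae_of_ae_map hS.aemeasurable hc] with ω h1
      rw [← hdd ω 0, h1]
    · rintro ⟨⟨c, hc⟩, ⟨l, hl'⟩⟩
      refine hG.EM_const (c := c) (l := l) ?_ ?_
      · refine (ae_map_iff hS.aemeasurable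
          (measurableSet_eq_fun (SRE.meas_dd 0) measurable_const)).2 ?_
        filter_upwards [hc] with ω h1
        rw [hdd, h1]
      · refine (ae_map_iff hS.aemeasurable
          (measurableSet_eq_fun (SRE.meas_ll 0) measurable_const)).2 ?_
        filter_upwards [hl', hall] with ω h1 h2
        rw [h2, h1]
  · rw [hiff]; exact hl
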